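/- There exists a finite presentation (m, R) such that, writing G for its presented group, the set of codes of finite presentations whose presented group embeds into G (i.e. codes of presentations (m', R') such that there exists an injective group homomorphism from the presented group of (m', R') into G) is not recursively enumerable, i.e. is not the domain of any partial recursive function ℕ →. ℕ. -/

import Mathlib

/-- A word in `m` generators. -/
abbrev Word (m : ℕ) : Type := List (Fin m × Bool)

/-- A finite presentation: a number of generators together with a finite list of relator words. -/
abbrev FinPres : Type := Σ m : ℕ, List (Word m)

/-- The set of relators of a finite presentation, as elements of the free group. -/
def FinPres.rels (P : FinPres) : Set (FreeGroup (Fin P.1)) :=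
  {x | ∃ r ∈ P.2, x = FreeGroup.mk r}

/-- The group presented by a finite presentation. -/
abbrev FinPres.Grp (P : FinPres) : Type := PresentedGroup P.rels

/-- The projection from the free group onto the presented group. -/
def FinPres.proj (P : FinPres) : FreeGroup (Fin P.1) →* P.Grp :=
  PresentedGroup.mk P.rels

/-- The `n`-th recursively enumerable set: the domain of the `n`-th partial recursive
function under the canonical numbering. -/
def W (n : ℕ) : Set ℕ := {x | ((Denumerable.ofNat Nat.Partrec.Code n).eval x).Dom}

/-- The set of orders of nontrivial torsion elements of a group. -/
def TorOrd (G : Type*) [Group G] : Set ℕ := {n | 2 ≤ n ∧ ∃ g : G, orderOf g = n}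

namespace HNNExtension

variable {G : Type*} [Group G] {A B : Subgroup G} {φ : A ≃* B}

open NormalWord in
/-- The number of stable letters in the normal form of an element of an HNN extension. -/
noncomputable def len (g : HNNExtension G A B φ) : ℕ :=
  (g • (empty : NormalWord (Classical.choice (TransversalPair.nonempty G A B)))).toList.length

open NormalWord in
theorem len_of_mul (h : G) (g : HNNExtension G A B φ) : len (of h * g) = len g := by
  simp [len, mul_smul, of_smul_eq_smul]

open NormalWord in
theorem len_unitsSMul_of_cancels {d : TransversalPair G A B} (u : ℤˣ) (w : NormalWord d)
    (h : Cancels u w) : (unitsSMul φ u w).toList.length + 1 = w.toList.length := by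
  unfold unitsSMul
  rw [dif_pos h]
  cases w using consRecOn with
  | ofGroup g => simp [Cancels] at h
  | cons g v w h1 h2 ih => simp [unitsSMulWithCancel]

open NormalWord in
theorem len_unitsSMul_of_not_cancels {d : TransversalPair G A B} (u : ℤˣ) (w : NormalWord d)
    (h : ¬ Cancels u w) : (unitsSMul φ u w).toList.length = w.toList.length + 1 := by
  unfold unitsSMul
  rw [dif_neg h]
  simp

open NormalWord in
theorem len_t_mul_lt_iff (u : ℤˣ) (g : HNNExtension G A B φ) :
    len (t ^ (u : ℤ) * g) < len g ↔
      Cancels u (g • (empty : NormalWord (Classical.choice (TransversalPair.nonempty G A B)))) := by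
  by_cases h : Cancels u
      (g • (empty : NormalWord (Classical.choice (TransversalPair.nonempty G A B))))
  · have := len_unitsSMul_of_cancels (φ := φ) u _ h
    simp only [len, mul_smul, t_pow_smul_eq_unitsSMul, h, iff_true]
    omega
  · have := len_unitsSMul_of_not_cancels (φ := φ) u _ h
    simp only [len, mul_smul, t_pow_smul_eq_unitsSMul, h, iff_false]
    omega

open NormalWord in
theorem len_t_mul (u : ℤˣ) (g : HNNExtension G A B φ) :
    len (t ^ (u : ℤ) * g) = len g + 1 ∨ len (t ^ (u : ℤ) * g) + 1 = len g := by
  simp only [len, mul_smul, t_pow_smul_eq_unitsSMul]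
  by_cases h : Cancels u
      (g • (empty : NormalWord (Classical.choice (TransversalPair.nonempty G A B))))
  · exact Or.inr (len_unitsSMul_of_cancels u _ h)
  · exact Or.inl (len_unitsSMul_of_not_cancels u _ h)

open NormalWord in
theorem len_eq_zero_iff {g : HNNExtension G A B φ} : len g = 0 ↔ ∃ h, g = of h := by
  constructor
  · intro h
    have h1 := (equiv φ (Classical.choice (TransversalPair.nonempty G A B))).left_inv g
    refine ⟨(g • (empty : NormalWord (Classical.choice (TransversalPair.nonempty G A B)))).head, ?_⟩
    rw [len, List.length_eq_zero_iff] at h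
    conv_lhs => rw [← h1]
    simp [equiv, ReducedWord.prod, h]
  · rintro ⟨h, rfl⟩
    have := len_of_mul h (1 : HNNExtension G A B φ)
    rw [mul_one] at this
    rw [this]
    simp [len]

@[simp] theorem len_of (h : G) : len (of h : HNNExtension G A B φ) = 0 :=
  len_eq_zero_iff.2 ⟨h, rfl⟩

theorem len_t_mul_lt {u : ℤˣ} {h : G} {g : HNNExtension G A B φ}
    (hg : len (t ^ (u : ℤ) * (of h * g)) < len g) :
    len (t ^ (u : ℤ) * (of h * g)) + 1 = len g := by
  have := len_t_mul u (of h * g)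
  rw [len_of_mul] at this
  omega

open NormalWord in
theorem exists_len_t_mul {g : HNNExtension G A B φ} (hg : len g ≠ 0) :
    ∃ (u : ℤˣ) (h : G), len (t ^ (u : ℤ) * (of h * g)) + 1 = len g := by
  set w := g • (empty : NormalWord (Classical.choice (TransversalPair.nonempty G A B))) with hw
  obtain ⟨a, ha⟩ : ∃ a, a ∈ w.toList.head? := by
    cases h : w.toList with
    | nil => simp [len, ← hw, h] at hg
    | cons a l => exact ⟨a, by simp⟩
  refine ⟨-a.1, w.head⁻¹, len_t_mul_lt ?_⟩
  rw [← len_of_mul w.head⁻¹ g, len_t_mul_lt_iff, mul_smul, ← hw, of_smul_eq_smul]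
  refine ⟨by simp, ?_⟩
  simp only [Option.mem_def] at ha
  simp [ha]

open NormalWord in
theorem eq_of_len_t_mul_lt {u v : ℤˣ} {h : G} {g : HNNExtension G A B φ}
    (hu : len (t ^ (u : ℤ) * g) < len g) (hv : len (t ^ (v : ℤ) * (of h * g)) < len g) :
    u = v ∧ h ∈ toSubgroup A B u := by
  rw [← len_of_mul h g, len_t_mul_lt_iff, mul_smul, of_smul_eq_smul] at hv
  rw [len_t_mul_lt_iff] at hu
  obtain ⟨h1, h2⟩ := hu
  obtain ⟨h3, h4⟩ := hv
  simp only [group_smul_toList, h2, Option.some.injEq, neg_inj] at h4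
  subst h4
  simp only [group_smul_head] at h3
  exact ⟨rfl, (Subgroup.mul_mem_cancel_right _ h1).1 h3⟩

theorem t_mul_of_toSubgroup (u : ℤˣ) (h : toSubgroup A B u) :
    (t ^ (u : ℤ) * of (h : G) : HNNExtension G A B φ) =
      of (toSubgroupEquiv φ u h : G) * t ^ (u : ℤ) := by
  rcases Int.units_eq_one_or u with rfl | rfl
  · rw [Units.val_one, zpow_one]
    exact t_mul_of h
  · rw [Units.val_neg, Units.val_one, zpow_neg, zpow_one]
    exact inv_t_mul_of h

theorem len_induction {motive : HNNExtension G A B φ → Prop} (of : ∀ h, motive (of h))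
    (step : ∀ (h : G) (u : ℤˣ) (g), len (t ^ (u : ℤ) * g) = len g + 1 → motive g →
      motive (HNNExtension.of h * (t ^ (u : ℤ) * g))) (g) : motive g := by
  induction hn : len g using Nat.strong_induction_on generalizing g with
  | _ n ih =>
    by_cases h0 : len g = 0
    · obtain ⟨h, rfl⟩ := len_eq_zero_iff.1 h0
      exact of h
    · obtain ⟨u, h, hl⟩ := exists_len_t_mul h0
      have := step h⁻¹ (-u) (t ^ (u : ℤ) * (HNNExtension.of h * g))
        (by simp [len_of_mul, hl]) (ih _ (by omega) _ rfl)
      simpa using this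

theorem len_mul_le (g g' : HNNExtension G A B φ) : len (g * g') ≤ len g + len g' := by
  induction g using len_induction with
  | of h => simp [len_of_mul]
  | step h u g hg ih =>
    have := len_t_mul u (g * g')
    rw [mul_assoc, len_of_mul, mul_assoc, len_of_mul, hg]
    omega

theorem len_mul_of (g : HNNExtension G A B φ) (h : G) : len (g * of h) = len g := by
  apply le_antisymm
  · simpa using len_mul_le g (of h)
  · have := len_mul_le (g * of h) (of h⁻¹)
    rwa [map_inv, mul_inv_cancel_right, ← map_inv, len_of, add_zero] at this

theorem len_t_zpow_le (u : ℤˣ) : len (t ^ (u : ℤ) : HNNExtension G A B φ) ≤ 1 := by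
  have := len_t_mul u (of 1 : HNNExtension G A B φ)
  rw [len_of, map_one, mul_one] at this
  omega

theorem len_inv_le (g : HNNExtension G A B φ) : len g⁻¹ ≤ len g := by
  induction g using len_induction with
  | of h => simp [← map_inv]
  | step h u g hg ih =>
    rw [len_of_mul, hg, mul_inv_rev, ← map_inv, len_mul_of, mul_inv_rev, ← zpow_neg]
    refine (len_mul_le _ _).trans ?_
    have := len_t_zpow_le (φ := φ) (-u)
    push_cast at this
    omega

theorem len_inv (g : HNNExtension G A B φ) : len g⁻¹ = len g :=
  le_antisymm (len_inv_le g) (by simpa using len_inv_le g⁻¹)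

/-- An involution in an HNN extension is conjugate into the base group. -/
theorem exists_conj_of_mul_self_eq_one {g : HNNExtension G A B φ} (hg : g * g = 1) :
    ∃ (c : HNNExtension G A B φ) (h : G), c * g * c⁻¹ = of h := by
  induction hn : len g using Nat.strong_induction_on generalizing g with
  | _ n ih =>
  by_cases h0 : len g = 0
  · obtain ⟨h, rfl⟩ := len_eq_zero_iff.1 h0
    exact ⟨1, h, by simp⟩
  obtain ⟨u, h, hl⟩ := exists_len_t_mul h0
  obtain ⟨g', hg'⟩ : ∃ g', g' = of h * g * (of h)⁻¹ := ⟨_, rfl⟩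
  have hlen : len g' = n := by rw [hg', ← map_inv, len_mul_of, len_of_mul, hn]
  have hsq : g' * g' = 1 := by
    calc g' * g' = of h * (g * g) * (of h)⁻¹ := by rw [hg']; group
      _ = 1 := by simp [hg]
  have hp : len (t ^ (u : ℤ) * g') + 1 = n := by
    rw [hg', ← mul_assoc, ← map_inv, len_mul_of, hl, hn]
  obtain ⟨p, hpdef⟩ : ∃ p, p = t ^ (u : ℤ) * g' := ⟨_, rfl⟩
  rw [← hpdef] at hp
  have hpinv : p⁻¹ * t ^ (u : ℤ) = g' := by
    rw [hpdef, mul_inv_rev, inv_mul_cancel_right, inv_eq_of_mul_eq_one_right hsq]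
  have hlenp : len p⁻¹ ≠ 0 := by
    intro h1
    rw [len_inv] at h1
    obtain ⟨b, hb⟩ := len_eq_zero_iff.1 h1
    have hm := congr_arg (lift (1 : G →* Multiplicative ℤ) (Multiplicative.ofAdd 1)
      (fun _ => by simp) : HNNExtension G A B φ →* Multiplicative ℤ) hsq
    rw [← hpinv, hb] at hm
    simp only [map_mul, map_inv, map_zpow, lift_t, lift_of, MonoidHom.one_apply, map_one] at hm
    rcases Int.units_eq_one_or u with rfl | rfl
    · simp only [← ofAdd_zero, ← ofAdd_neg, ← ofAdd_add, Units.val_one, zpow_one] at hm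
      exact absurd (Multiplicative.ofAdd.injective hm) (by norm_num)
    · simp only [← ofAdd_zero, ← ofAdd_neg, ← ofAdd_add, Units.val_one, zpow_one, Units.val_neg,
        zpow_neg] at hm
      exact absurd (Multiplicative.ofAdd.injective hm) (by norm_num)
  obtain ⟨v, k, hv⟩ := exists_len_t_mul hlenp
  rw [len_inv] at hv hlenp
  have hv' : len (t ^ (v : ℤ) * (of k * g')) < len g' := by
    rw [hlen, ← hpinv, ← mul_assoc, ← mul_assoc, mul_assoc (t ^ (v : ℤ))]
    have := len_mul_le (t ^ (v : ℤ) * (of k * p⁻¹)) (t ^ (u : ℤ))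
    have := len_t_zpow_le (φ := φ) u
    omega
  obtain ⟨rfl, hk⟩ := eq_of_len_t_mul_lt (by rw [← hpdef, hlen]; omega) hv'
  rw [← mul_assoc, t_mul_of_toSubgroup u ⟨k, hk⟩, mul_assoc, len_of_mul] at hv
  have hconj : t ^ (u : ℤ) * g' * (t ^ (u : ℤ))⁻¹ = t ^ (u : ℤ) * p⁻¹ := by
    rw [← hpinv]; group
  obtain ⟨c, b, hc⟩ := ih (len (t ^ (u : ℤ) * p⁻¹)) (by omega)
    (g := t ^ (u : ℤ) * g' * (t ^ (u : ℤ))⁻¹)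
    (by
      calc _ = t ^ (u : ℤ) * (g' * g') * (t ^ (u : ℤ))⁻¹ := by group
        _ = 1 := by simp [hsq]) (by rw [hconj])
  exact ⟨c * t ^ (u : ℤ) * of h, b, by rw [← hc, hg']; group⟩

end HNNExtension

namespace HNNExtension

variable {G : Type*} [Group G] {A B : Subgroup G} {φ : A ≃* B}

/-- Products `α₀ t^u₁ α₁ ⋯ t^uₙ αₙ` with all `αᵢ` in a subgroup `K` of the base group, along which
the number of stable letters grows at each step. -/
inductive IsReducedIn (K : Subgroup G) : HNNExtension G A B φ → Prop
  | of (α : G) (hα : α ∈ K) : IsReducedIn K (of α)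
  | step (α : G) (hα : α ∈ K) (u : ℤˣ) (a : HNNExtension G A B φ) (ha : IsReducedIn K a)
      (hl : len (t ^ (u : ℤ) * a) = len a + 1) : IsReducedIn K (HNNExtension.of α * (t ^ (u : ℤ) * a))

/-- The subgroup of an HNN extension generated by a subgroup of the base and the stable letter. -/
def extendSubgroup (A B : Subgroup G) (φ : A ≃* B) (K : Subgroup G) :
    Subgroup (HNNExtension G A B φ) :=
  Subgroup.closure (of '' (K : Set G) ∪ {t})

theorem of_mem_extendSubgroup {K : Subgroup G} {α : G} (hα : α ∈ K) :
    of α ∈ extendSubgroup A B φ K :=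
  Subgroup.subset_closure (Or.inl ⟨α, hα, rfl⟩)

theorem t_mem_extendSubgroup {K : Subgroup G} : t ∈ extendSubgroup A B φ K :=
  Subgroup.subset_closure (Or.inr rfl)

variable {K : Subgroup G}
  (hK : ∀ (u : ℤˣ) (h : toSubgroup A B u), (h : G) ∈ K → (toSubgroupEquiv φ u h : G) ∈ K)

theorem IsReducedIn.of_mul {a : HNNExtension G A B φ} (ha : IsReducedIn K a) {α : G} (hα : α ∈ K) :
    IsReducedIn K (HNNExtension.of α * a) := by
  cases ha with
  | of β hβ => rw [← map_mul]; exact .of _ (mul_mem hα hβ)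
  | step β hβ u a ha hl =>
    rw [← mul_assoc, ← map_mul]; exact .step _ (mul_mem hα hβ) u a ha hl

include hK

theorem IsReducedIn.t_mul {a : HNNExtension G A B φ} (ha : IsReducedIn K a) (v : ℤˣ) :
    IsReducedIn K (t ^ (v : ℤ) * a) := by
  rcases len_t_mul v a with h | h
  · simpa using IsReducedIn.step 1 (one_mem K) v a ha h
  cases ha with
  | of β hβ => simp at h
  | step β hβ u a ha hl =>
    rw [len_of_mul, hl] at h
    obtain ⟨rfl, hβ'⟩ := eq_of_len_t_mul_lt (u := -u) (v := v) (h := β) (g := t ^ (u : ℤ) * a)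
      (by push_cast; rw [zpow_neg, inv_mul_cancel_left]; omega) (by omega)
    rw [← mul_assoc, t_mul_of_toSubgroup (-u) ⟨β, hβ'⟩]
    push_cast
    rw [zpow_neg, mul_assoc, inv_mul_cancel_left]
    exact ha.of_mul (hK _ _ hβ)

theorem isReducedIn_of_mem {a : HNNExtension G A B φ} (ha : a ∈ extendSubgroup A B φ K) :
    IsReducedIn K a := by
  induction ha using Subgroup.closure_induction_left with
  | one => rw [← map_one of]; exact .of 1 (one_mem K)
  | mul_left x hx y _ ih =>
    rcases hx with ⟨α, hα, rfl⟩ | rfl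
    · exact ih.of_mul hα
    · simpa using ih.t_mul hK 1
  | inv_mul_cancel x hx y _ ih =>
    rcases hx with ⟨α, hα, rfl⟩ | rfl
    · rw [← map_inv]; exact ih.of_mul (inv_mem hα)
    · simpa using ih.t_mul hK (-1)

theorem of_mem_extendSubgroup_iff {α : G} : of α ∈ extendSubgroup A B φ K ↔ α ∈ K := by
  refine ⟨fun h => ?_, of_mem_extendSubgroup⟩
  have h1 := isReducedIn_of_mem hK h
  generalize hx : of α = x at h1
  cases h1 with
  | of β hβ => rwa [of_injective φ hx]
  | step β hβ u a ha hl =>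
    have := congr_arg len hx
    rw [len_of_mul, hl, len_of] at this
    omega

omit hK in
theorem len_mul_of_isReducedIn {g : HNNExtension G A B φ}
    (hg : ∀ a ∈ extendSubgroup A B φ K, len g ≤ len (a * g)) {a : HNNExtension G A B φ}
    (ha : IsReducedIn K a) : len (a * g) = len a + len g := by
  induction ha with
  | of α hα => simp [len_of_mul]
  | step α hα u a ha hl ih =>
    rw [mul_assoc, len_of_mul, len_of_mul, mul_assoc, hl]
    rcases len_t_mul u (a * g) with h | h
    · omega
    exfalso
    cases ha with
    | of β hβ =>
      have := hg (t ^ (u : ℤ) * of β)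
        (mul_mem (zpow_mem t_mem_extendSubgroup _) (of_mem_extendSubgroup hβ))
      rw [len_of_mul] at h
      rw [mul_assoc] at this
      omega
    | step β hβ v a ha hl' =>
      rw [len_of_mul, hl', mul_assoc, len_of_mul, mul_assoc] at ih
      have hle := len_mul_le a g
      rw [mul_assoc, len_of_mul, mul_assoc] at h
      obtain ⟨rfl, hβ'⟩ := eq_of_len_t_mul_lt (u := -v) (v := u) (h := β)
        (g := t ^ (v : ℤ) * (a * g))
        (by push_cast; rw [zpow_neg, inv_mul_cancel_left]; omega) (by omega)
      rw [← mul_assoc (t ^ _), t_mul_of_toSubgroup (-v) ⟨β, hβ'⟩, mul_assoc, len_of_mul,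
        len_of_mul, hl'] at hl
      push_cast at hl
      rw [zpow_neg, inv_mul_cancel_left] at hl
      omega

omit hK in
/-- If no conjugate of `z` under the base group lies in an associated subgroup, then only elements
of the base group conjugate `z` into the base group. -/
theorem exists_of_of_conj {z : G} (hz : ∀ (g : G) (u : ℤˣ), g * z * g⁻¹ ∉ toSubgroup A B u)
    {g : HNNExtension G A B φ} {b : G} (h : g * of z = of b * g) : ∃ h, g = of h := by
  induction hn : len g using Nat.strong_induction_on generalizing g b with
  | _ n ih =>
  by_cases h0 : len g = 0
  · exact len_eq_zero_iff.1 h0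
  exfalso
  obtain ⟨u, k, hl⟩ := exists_len_t_mul h0
  have h1 : t ^ (u : ℤ) * (of (k * b * k⁻¹) * (of k * g)) = t ^ (u : ℤ) * (of k * g) * of z := by
    simp only [map_mul, map_inv, mul_assoc, inv_mul_cancel_left, h]
  obtain ⟨-, hk⟩ := eq_of_len_t_mul_lt (u := u) (v := u) (g := of k * g) (h := k * b * k⁻¹)
    (by rw [len_of_mul k]; omega) (by rw [h1, len_mul_of, len_of_mul k]; omega)
  rw [← mul_assoc, t_mul_of_toSubgroup u ⟨_, hk⟩, mul_assoc] at h1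
  obtain ⟨y, hy⟩ := ih _ (by omega) h1.symm rfl
  rw [hy, ← map_mul, ← map_mul] at h1
  apply hz y (-u)
  rw [← of_injective φ h1, mul_inv_cancel_right]
  exact SetLike.coe_mem _

end HNNExtension

/-- The properties of a group `B` above `Υ`, and of a subgroup `A` meeting `Υ` in `A₀`, that are
preserved along the tower of HNN extensions. -/
structure IsStage {Υ B : Type*} [Group Υ] [Group B] (N A₀ : Subgroup Υ) (ι : Υ →* B)
    (A : Subgroup B) : Prop where
  inj : Function.Injective ι
  mal : ∀ z ∈ N, z ≠ 1 → ∀ g, g * ι z * g⁻¹ ∈ ι.range → g ∈ ι.range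
  mem : ∀ y, ι y ∈ A ↔ y ∈ A₀
  conj : ∀ z ∈ N, z ≠ 1 → ∀ g, g * ι z * g⁻¹ ∈ A → ∃ a ∈ A, ∃ y, g = a * ι y
  invol : ∀ g, g * g = 1 → ∃ c y, c * g * c⁻¹ = ι y

namespace IsStage

variable {Υ B K : Type*} [Group Υ] [Group B] [Group K] {N A₀ : Subgroup Υ} {ι : Υ →* B}
  {A : Subgroup B}

theorem refl : IsStage N A₀ (MonoidHom.id Υ) A₀ where
  inj := Function.injective_id
  mal _ _ _ g _ := ⟨g, rfl⟩
  mem _ := Iff.rfl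
  conj _ _ _ g _ := ⟨1, one_mem _, g, by simp⟩
  invol g _ := ⟨1, g, by simp⟩

/-- The isomorphism between the images of two injective homomorphisms. -/
noncomputable def rangeEquiv (f f' : K →* B) (hf : Function.Injective f)
    (hf' : Function.Injective f') : f.range ≃* f'.range :=
  (MonoidHom.ofInjective hf).symm.trans (MonoidHom.ofInjective hf')

theorem rangeEquiv_apply (f f' : K →* B) (hf : Function.Injective f)
    (hf' : Function.Injective f') (k : K) :
    (rangeEquiv f f' hf hf' ⟨f k, k, rfl⟩ : B) = f' k := by
  have : (⟨f k, k, rfl⟩ : f.range) = MonoidHom.ofInjective hf k := Subtype.ext rfl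
  rw [rangeEquiv, MulEquiv.trans_apply, this, MulEquiv.symm_apply_apply,
    MonoidHom.ofInjective_apply]

theorem rangeEquiv_symm_apply (f f' : K →* B) (hf : Function.Injective f)
    (hf' : Function.Injective f') (k : K) :
    ((rangeEquiv f f' hf hf').symm ⟨f' k, k, rfl⟩ : B) = f k :=
  rangeEquiv_apply f' f hf' hf k

open HNNExtension in
theorem step [N.Normal] (h : IsStage N A₀ ι A) (f f' : K →* Υ)
    (hf : ∀ k, f k ∈ N → k = 1) (hf' : ∀ k, f' k ∈ N → k = 1)
    (hA : ∀ k, f k ∈ A₀ ↔ f' k ∈ A₀)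
    (hi : Function.Injective (ι.comp f)) (hi' : Function.Injective (ι.comp f')) :
    IsStage N A₀ ((of (φ := rangeEquiv _ _ hi hi')).comp ι)
      (extendSubgroup _ _ (rangeEquiv _ _ hi hi') A) := by
  have hz : ∀ z ∈ N, z ≠ 1 → ∀ (g : B) (u : ℤˣ),
      g * ι z * g⁻¹ ∉ toSubgroup (ι.comp f).range (ι.comp f').range u := by
    intro z hz hz1 g u hg
    obtain ⟨k, f₀, h₀, hk⟩ : ∃ (k : K) (f₀ : K →* Υ), (∀ k, f₀ k ∈ N → k = 1) ∧
        ι (f₀ k) = g * ι z * g⁻¹ := by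
      rcases Int.units_eq_one_or u with rfl | rfl
      · obtain ⟨k, hk⟩ := hg
        exact ⟨k, f, hf, hk⟩
      · obtain ⟨k, hk⟩ := hg
        exact ⟨k, f', hf', hk⟩
    obtain ⟨y, rfl⟩ := h.mal z hz hz1 g ⟨_, hk⟩
    rw [← map_inv, ← map_mul, ← map_mul] at hk
    have h1 := h.inj hk
    have h2 := h₀ k (h1 ▸ Subgroup.Normal.conj_mem inferInstance z hz y)
    rw [h2, map_one] at h1
    exact hz1 (by simpa using h1.symm)
  have hK : ∀ (u : ℤˣ) (x : toSubgroup (ι.comp f).range (ι.comp f').range u), (x : B) ∈ A →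
      (toSubgroupEquiv (rangeEquiv _ _ hi hi') u x : B) ∈ A := by
    intro u x hx
    rcases Int.units_eq_one_or u with rfl | rfl
    · obtain ⟨_, k, rfl⟩ := x
      have := rangeEquiv_apply _ _ hi hi' k
      simp only [toSubgroupEquiv_one]
      erw [this]
      exact (h.mem _).2 ((hA k).1 ((h.mem _).1 hx))
    · obtain ⟨_, k, rfl⟩ := x
      have := rangeEquiv_symm_apply _ _ hi hi' k
      simp only [toSubgroupEquiv_neg_one]
      erw [this]
      exact (h.mem _).2 ((hA k).2 ((h.mem _).1 hx))
  have hbase : ∀ z ∈ N, z ≠ 1 → ∀ (g : HNNExtension _ _ _ (rangeEquiv _ _ hi hi')) (b : B),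
      g * of (ι z) * g⁻¹ = of b → ∃ c, g = of c := fun z hzN hz1 g b hg =>
    exists_of_of_conj (hz z hzN hz1) (b := b) (by rw [← hg]; group)
  refine ⟨(of_injective _).comp h.inj, ?_, ?_, ?_, ?_⟩
  · rintro z hzN hz1 g ⟨y, hy⟩
    obtain ⟨c, rfl⟩ := hbase z hzN hz1 g (ι y) hy.symm
    simp only [MonoidHom.comp_apply, ← map_mul, ← map_inv] at hy
    obtain ⟨y', hy'⟩ := h.mal z hzN hz1 c ⟨y, of_injective _ hy⟩
    exact ⟨y', by simp [hy']⟩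
  · intro y
    rw [MonoidHom.comp_apply, of_mem_extendSubgroup_iff hK, h.mem]
  · intro z hzN hz1 g hg
    obtain ⟨_, ⟨a₀, ha₀, rfl⟩, hmin⟩ := WellFounded.has_min (wellFounded_lt (α := ℕ))
      ((fun a => len (a * g)) '' (extendSubgroup _ _ (rangeEquiv _ _ hi hi') A : Set _))
      ⟨_, 1, one_mem _, rfl⟩
    have hmin' : ∀ a ∈ extendSubgroup _ _ (rangeEquiv _ _ hi hi') A,
        len (a₀ * g) ≤ len (a * (a₀ * g)) := by
      intro a ha
      have := hmin _ ⟨a * a₀, mul_mem ha ha₀, rfl⟩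
      rw [← mul_assoc]
      simpa using this
    have hconj : a₀ * g * of (ι z) * (a₀ * g)⁻¹ ∈ extendSubgroup _ _ (rangeEquiv _ _ hi hi') A := by
      have := mul_mem (mul_mem ha₀ hg) (inv_mem ha₀)
      convert this using 1
      simp only [MonoidHom.comp_apply]
      group
    have hlen := len_mul_of_isReducedIn hmin' (isReducedIn_of_mem hK hconj)
    rw [inv_mul_cancel_right, len_mul_of] at hlen
    obtain ⟨b, hb⟩ := len_eq_zero_iff.1 (show len (a₀ * g * of (ι z) * (a₀ * g)⁻¹) = 0 by omega)
    obtain ⟨c, hc⟩ := hbase z hzN hz1 _ b hb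
    rw [hc, ← map_inv, ← map_mul, ← map_mul, of_mem_extendSubgroup_iff hK] at hconj
    obtain ⟨a, ha, y, rfl⟩ := h.conj z hzN hz1 c hconj
    exact ⟨a₀⁻¹ * of a, mul_mem (inv_mem ha₀) (of_mem_extendSubgroup ha), y, by
      rw [mul_assoc, MonoidHom.comp_apply, ← map_mul, ← hc, inv_mul_cancel_left]⟩
  · intro g hg
    obtain ⟨c, b, hc⟩ := exists_conj_of_mul_self_eq_one hg
    obtain ⟨c', y, hy⟩ := h.invol b (of_injective (rangeEquiv _ _ hi hi') (by
      rw [map_mul, ← hc, map_one]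
      calc _ = c * (g * g) * c⁻¹ := by group
        _ = 1 := by simp [hg]))
    exact ⟨of c' * c, y, by
      rw [MonoidHom.comp_apply, ← hy, map_mul, map_mul, ← hc, map_inv]; group⟩

end IsStage

/-- An HNN extension of a finitely presented group with finitely generated associated subgroups is
finitely presented. -/
theorem HNNExtension.isFinitelyPresented {G : Type*} [Group G] {A B : Subgroup G} (φ : A ≃* B)
    [Group.IsFinitelyPresented G] (hA : A.FG) :
    Group.IsFinitelyPresented (HNNExtension G A B φ) := by
  open Monoid in
  obtain ⟨S, hS, hSfin⟩ := (Subgroup.fg_iff A).1 hA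
  have hSA : ∀ s ∈ S, s ∈ A := fun s hs => hS ▸ Subgroup.subset_closure hs
  let f : Coprod G (Multiplicative ℤ) →* HNNExtension G A B φ :=
    Coprod.lift of (zpowersHom _ t)
  let r : S → Coprod G (Multiplicative ℤ) := fun s =>
    Coprod.inr (Multiplicative.ofAdd 1) * Coprod.inl (s : G) *
      (Coprod.inr (Multiplicative.ofAdd 1))⁻¹ * (Coprod.inl (φ ⟨s, hSA s s.2⟩ : G))⁻¹
  have : Finite S := hSfin
  have hsurj : Function.Surjective f := by
    intro x
    induction x using HNNExtension.induction_on with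
    | of g => exact ⟨Coprod.inl g, by simp [f]⟩
    | t => exact ⟨Coprod.inr (Multiplicative.ofAdd 1), by simp [f]⟩
    | mul x y hx hy =>
      obtain ⟨a, rfl⟩ := hx
      obtain ⟨b, rfl⟩ := hy
      exact ⟨a * b, map_mul f a b⟩
    | inv x hx =>
      obtain ⟨a, rfl⟩ := hx
      exact ⟨a⁻¹, map_inv f a⟩
  refine Group.IsFinitelyPresented.of_surjective f hsurj ⟨Set.range r, Set.finite_range r, ?_⟩
  apply le_antisymm
  · apply Subgroup.normalClosure_le_normal
    rintro _ ⟨s, rfl⟩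
    simp only [r, f, SetLike.mem_coe, MonoidHom.mem_ker, map_mul, map_inv, Coprod.lift_apply_inl,
      Coprod.lift_apply_inr, zpowersHom_apply, toAdd_ofAdd, zpow_one]
    rw [t_mul_of (⟨s, hSA s s.2⟩ : A)]
    simp
  · let q := QuotientGroup.mk' (Subgroup.normalClosure (Set.range r))
    let ψ : HNNExtension G A B φ →* _ := HNNExtension.lift (q.comp Coprod.inl)
      (q (Coprod.inr (Multiplicative.ofAdd 1))) (by
        suffices H : ∀ a (ha : a ∈ Subgroup.closure S) (ha' : a ∈ A),
            q (Coprod.inr (Multiplicative.ofAdd 1)) * q (Coprod.inl a) =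
              q (Coprod.inl (φ ⟨a, ha'⟩ : G)) * q (Coprod.inr (Multiplicative.ofAdd 1)) from
          fun a => H a (hS ▸ a.2) a.2
        intro a ha
        induction ha using Subgroup.closure_induction with
        | mem s hs =>
          intro _
          have : q (r ⟨s, hs⟩) = 1 := (QuotientGroup.eq_one_iff _).2
            (Subgroup.subset_normalClosure ⟨_, rfl⟩)
          simp only [r, map_mul, map_inv] at this
          rw [mul_inv_eq_one, mul_inv_eq_iff_eq_mul] at this
          exact this
        | one => intro h; rw [show (⟨1, h⟩ : A) = 1 from rfl]; simp
        | mul x y hx hy ihx ihy =>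
          intro h
          have hx' : x ∈ A := hS ▸ hx
          have hy' : y ∈ A := hS ▸ hy
          rw [show (⟨x * y, h⟩ : A) = ⟨x, hx'⟩ * ⟨y, hy'⟩ from rfl]
          simp only [map_mul, Subgroup.coe_mul]
          rw [← mul_assoc, ihx hx', mul_assoc, ihy hy', mul_assoc]
        | inv x hx ih =>
          intro h
          have hx' : x ∈ A := hS ▸ hx
          rw [show (⟨x⁻¹, h⟩ : A) = ⟨x, hx'⟩⁻¹ from rfl]
          simp only [map_inv, Subgroup.coe_inv]
          rw [eq_inv_mul_iff_mul_eq, ← mul_assoc, ← ih hx', mul_inv_cancel_right])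
    have hψ : ψ.comp f = q := by
      apply Coprod.hom_ext
      · ext g; simp [ψ, f]
      · apply MonoidHom.ext_mint; simp [ψ, f]
    intro x hx
    rw [← QuotientGroup.eq_one_iff]
    change q x = 1
    rw [← hψ, MonoidHom.comp_apply, MonoidHom.mem_ker.1 hx, map_one]

open HNNExtension in
theorem exists_isStage {Υ K : Type} [Group Υ] [Group K] [Group.FG K]
    [Group.IsFinitelyPresented Υ] (N A₀ : Subgroup Υ) [N.Normal]
    (edges : List ((K →* Υ) × (K →* Υ)))
    (h₁ : ∀ e ∈ edges, ∀ k, e.1 k ∈ N → k = 1) (h₂ : ∀ e ∈ edges, ∀ k, e.2 k ∈ N → k = 1)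
    (hA : ∀ e ∈ edges, ∀ k, e.1 k ∈ A₀ ↔ e.2 k ∈ A₀) :
    ∃ (B : Type) (_ : Group B) (ι : Υ →* B) (A : Subgroup B) (S : Set B),
      IsStage N A₀ ι A ∧ Group.IsFinitelyPresented B ∧ S.Finite ∧
      A = Subgroup.closure (ι '' A₀ ∪ S) ∧
      ∀ e ∈ edges, ∃ s ∈ S, ∀ k, s * ι (e.1 k) * s⁻¹ = ι (e.2 k) := by
  induction edges with
  | nil =>
    exact ⟨Υ, _, MonoidHom.id Υ, A₀, ∅, IsStage.refl, inferInstance, Set.finite_empty,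
      by simp, by simp⟩
  | cons e l ih =>
    obtain ⟨B, _, ι, A, S, hB, hfp, hS, hAS, hr⟩ := ih
      (fun e he => h₁ e (List.mem_cons_of_mem _ he)) (fun e he => h₂ e (List.mem_cons_of_mem _ he))
      (fun e he => hA e (List.mem_cons_of_mem _ he))
    have hi : ∀ f : K →* Υ, (∀ k, f k ∈ N → k = 1) → Function.Injective (ι.comp f) := by
      intro f hf
      apply hB.inj.comp
      rw [injective_iff_map_eq_one]
      exact fun k hk => hf k (hk ▸ one_mem N)
    have hi₁ := hi e.1 (h₁ e List.mem_cons_self)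
    have hi₂ := hi e.2 (h₂ e List.mem_cons_self)
    refine ⟨_, _, _, _, of '' S ∪ {t}, hB.step e.1 e.2 (h₁ e List.mem_cons_self)
      (h₂ e List.mem_cons_self) (hA e List.mem_cons_self) hi₁ hi₂, ?_,
      (hS.image _).union (Set.finite_singleton _), ?_, ?_⟩
    · apply HNNExtension.isFinitelyPresented
      exact (Group.fg_iff_subgroup_fg _).1 inferInstance
    · rw [extendSubgroup, hAS, ← Subgroup.coe_map, MonoidHom.map_closure, Subgroup.closure_union,
        Subgroup.closure_eq, ← Subgroup.closure_union, Set.image_union, Set.union_assoc,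
        MonoidHom.coe_comp, Set.image_comp]
    · intro e' he'
      rcases List.mem_cons.1 he' with rfl | he'
      · refine ⟨t, Or.inr rfl, fun k => ?_⟩
        have := equiv_eq_conj (φ := IsStage.rangeEquiv _ _ hi₁ hi₂) ⟨ι (e'.1 k), k, rfl⟩
        rw [MonoidHom.comp_apply, ← this]
        exact congr_arg of (IsStage.rangeEquiv_apply _ _ hi₁ hi₂ k)
      · obtain ⟨s, hs, hk⟩ := hr e' he'
        exact ⟨of s, Or.inl ⟨s, hs, rfl⟩, fun k => by
          simp only [MonoidHom.comp_apply, ← map_mul, ← map_inv, hk]⟩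

namespace Monoid.CoprodI

variable {ι : Type*} [DecidableEq ι] {G : ι → Type*} [∀ i, Group (G i)]

/-- The subgroup of a free product generated by subgroups of the factors. -/
def factorSubgroup (H : ∀ i, Subgroup (G i)) : Subgroup (CoprodI G) := ⨆ i, (H i).map of

variable {H : ∀ i, Subgroup (G i)}

omit [DecidableEq ι] in
theorem of_mem_factorSubgroup {i : ι} {g : G i} (hg : g ∈ H i) : of g ∈ factorSubgroup H :=
  le_iSup (fun i => (H i).map of) i ⟨g, hg, rfl⟩

omit [DecidableEq ι] in
theorem factorSubgroup_le {S : Subgroup (CoprodI G)} :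
    factorSubgroup H ≤ S ↔ ∀ i, ∀ g ∈ H i, of g ∈ S := by
  simp only [factorSubgroup, iSup_le_iff, Subgroup.map_le_iff_le_comap]
  exact Iff.rfl

theorem of_mem_factorSubgroup_iff {i : ι} {g : G i} : of g ∈ factorSubgroup H ↔ g ∈ H i := by
  refine ⟨fun h => ?_, of_mem_factorSubgroup⟩
  have hle : factorSubgroup H ≤
      (H i).comap (lift (Pi.mulSingle i (MonoidHom.id (G i)))) := by
    rw [factorSubgroup_le]
    intro j g hg
    rw [Subgroup.mem_comap, lift_of]
    by_cases hij : j = i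
    · subst hij; simpa using hg
    · rw [Pi.mulSingle_eq_of_ne hij]; exact one_mem _
  simpa using hle h

theorem toWord_mem_of_mem_factorSubgroup {w : Word G} (h : w.prod ∈ factorSubgroup H) :
    ∀ l ∈ w.toList, l.2 ∈ H l.1 := by
  classical
  have hr : factorSubgroup H ≤ (lift fun i => (of (M := G)).comp (H i).subtype).range := by
    rw [factorSubgroup_le]
    intro i g hg
    exact ⟨of (M := fun i => H i) ⟨g, hg⟩, by simp⟩
  obtain ⟨y, hy⟩ := hr h
  obtain ⟨v, rfl⟩ : ∃ v : Word (fun i => H i), v.prod = y :=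
    ⟨Word.equiv y, Word.equiv.symm_apply_apply y⟩
  let v' : Word G :=
    { toList := v.toList.map fun l => ⟨l.1, l.2⟩
      ne_one := by
        intro l hl
        obtain ⟨x, hx, rfl⟩ := List.mem_map.1 hl
        simpa using v.ne_one x hx
      chain_ne := by
        rw [List.isChain_map]
        exact v.chain_ne }
  have hv : w = v' := by
    apply Word.equiv.symm.injective
    change w.prod = v'.prod
    rw [← hy]
    simp [Word.prod, v', map_list_prod, List.map_map, Function.comp_def]
  subst hv
  intro l hl
  obtain ⟨x, hx, rfl⟩ := List.mem_map.1 hl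
  exact x.2.2

omit [DecidableEq ι] in
theorem prod_mem_factorSubgroup {l : List (Σ i, G i)} (h : ∀ x ∈ l, x.2 ∈ H x.1) :
    (l.map fun x => of x.2).prod ∈ factorSubgroup H := by
  apply list_prod_mem
  intro x hx
  obtain ⟨y, hy, rfl⟩ := List.mem_map.1 hx
  exact of_mem_factorSubgroup (h y hy)

theorem exists_of_conj_mem_factorSubgroup {i : ι} {g : G i} (hg : g ≠ 1) {τ : CoprodI G}
    (h : τ * of g * τ⁻¹ ∈ factorSubgroup H) :
    ∃ a ∈ factorSubgroup H, ∃ c : G i, τ = a * of c ∧ c * g * c⁻¹ ∈ H i := by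
  classical
  obtain ⟨w, hw⟩ : ∃ w : Word G, w.prod = τ⁻¹ := ⟨Word.equiv τ⁻¹, Word.equiv.symm_apply_apply _⟩
  obtain ⟨p, rfl⟩ := (Word.equivPair i).symm.surjective w
  rw [Word.equivPair_symm, Word.prod_rcons] at hw
  suffices ha : p.tail.prod⁻¹ ∈ factorSubgroup H by
    have hτ : τ = p.tail.prod⁻¹ * of p.head⁻¹ := by
      rw [← inv_inj, ← hw, mul_inv_rev, inv_inv, ← map_inv, inv_inv]
    refine ⟨_, ha, p.head⁻¹, hτ, ?_⟩
    rw [← of_mem_factorSubgroup_iff (H := H)]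
    have := mul_mem (mul_mem (inv_mem ha) h) ha
    rw [hτ] at this
    convert this using 1
    simp only [map_mul, map_inv, inv_inv, mul_inv_rev]
    group
  by_cases h0 : p.tail = Word.empty
  · simp [h0, one_mem]
  obtain ⟨j, k, v, hv⟩ := NeWord.of_word p.tail h0
  have hji : i ≠ j := by
    have := p.fstIdx_ne
    rw [Word.fstIdx_ne_iff, ← hv] at this
    exact this _ v.toList_head?
  have hg' : p.head⁻¹ * g * p.head ≠ 1 := by
    intro h1
    apply hg
    rw [mul_assoc, inv_mul_eq_one, eq_comm] at h1
    simpa using h1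
  let u := (v.inv.append hji.symm (NeWord.singleton _ hg')).append hji v
  have hu : u.toWord.prod = τ * of g * τ⁻¹ := by
    have hvp : v.prod = p.tail.prod := by rw [NeWord.prod, hv]
    have : u.prod = p.tail.prod⁻¹ * of (p.head⁻¹ * g * p.head) * p.tail.prod := by
      simp [u, hvp]
    rw [← NeWord.prod, this, ← hw, ← inv_inv τ, ← hw]
    simp only [map_mul, map_inv, mul_inv_rev]
    group
  rw [← hu] at h
  have hl := toWord_mem_of_mem_factorSubgroup h
  refine inv_mem ?_
  rw [← hv]
  refine prod_mem_factorSubgroup fun x hx => hl x ?_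
  change x ∈ u.toList
  exact List.mem_append_right _ hx

theorem exists_of_conj {i j : ι} {g : G i} (hg : g ≠ 1) {g' : G j} {τ : CoprodI G}
    (h : τ * of g * τ⁻¹ = of g') : i = j ∧ ∃ c : G i, τ = of c := by
  obtain ⟨a, ha, c, rfl, hc⟩ := exists_of_conj_mem_factorSubgroup
    (H := Function.update (fun _ => ⊥) j (⊤ : Subgroup (G j))) hg (τ := τ)
    (by rw [h, of_mem_factorSubgroup_iff]; simp)
  by_cases hij : i = j
  · subst hij
    refine ⟨rfl, ?_⟩
    have : factorSubgroup (Function.update (fun _ => ⊥) i (⊤ : Subgroup (G i))) ≤ (of : G i →* CoprodI G).range := by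
      rw [factorSubgroup_le]
      intro k y hy
      by_cases hik : k = i
      · subst hik; exact ⟨y, rfl⟩
      · rw [Function.update_of_ne hik] at hy
        have : y = 1 := hy
        rw [this, map_one]; exact one_mem _
    obtain ⟨b, rfl⟩ := this ha
    exact ⟨b * c, by simp⟩
  · rw [Function.update_of_ne hij] at hc
    have : c * g * c⁻¹ = 1 := hc
    exact absurd (by simpa using this) hg

omit [DecidableEq ι] in
theorem exists_conj_of_eq_reverse [Nonempty ι] (n : ℕ) (l : List (Σ i, G i)) (hn : l.length ≤ n)
    (hl : l = (l.map fun x => (⟨x.1, x.2⁻¹⟩ : Σ i, G i)).reverse) :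
    ∃ (c : CoprodI G) (i : ι) (g : G i), c * (l.map fun x => of x.2).prod * c⁻¹ = of g := by
  induction n generalizing l with
  | zero =>
    obtain rfl := List.length_eq_zero_iff.1 (Nat.le_zero.1 hn)
    exact ⟨1, Classical.arbitrary ι, 1, by simp⟩
  | succ n ih =>
    rcases List.eq_nil_or_concat l with rfl | ⟨l', y, rfl⟩
    · exact ⟨1, Classical.arbitrary ι, 1, by simp⟩
    cases l' with
    | nil => exact ⟨1, y.1, y.2, by simp⟩
    | cons x m =>
      simp only [List.concat_eq_append, List.cons_append, List.map_cons, List.map_append,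
        List.map_nil, List.reverse_cons, List.reverse_append, List.reverse_nil, List.nil_append,
        List.cons.injEq] at hl
      obtain ⟨hx, hm⟩ := hl
      obtain ⟨hm, hy⟩ := List.append_inj' hm rfl
      obtain ⟨c, i, g, hc⟩ := ih m (by simp at hn; omega) hm
      refine ⟨c * (of x.2)⁻¹, i, g, ?_⟩
      simp only [List.cons.injEq, and_true] at hy
      rw [← hc, hy]
      simp
      group

theorem exists_conj_of_mul_self_eq_one [Nonempty ι] {τ : CoprodI G} (h : τ * τ = 1) :
    ∃ (c : CoprodI G) (i : ι) (g : G i), c * τ * c⁻¹ = of g := by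
  classical
  obtain ⟨w, rfl⟩ : ∃ w : Word G, w.prod = τ := ⟨Word.equiv τ, Word.equiv.symm_apply_apply _⟩
  refine exists_conj_of_eq_reverse _ w.toList le_rfl ?_
  let w' : Word G :=
    { toList := (w.toList.map fun x => (⟨x.1, x.2⁻¹⟩ : Σ i, G i)).reverse
      ne_one := by
        intro l hl
        rw [List.mem_reverse] at hl
        obtain ⟨x, hx, rfl⟩ := List.mem_map.1 hl
        simpa using w.ne_one x hx
      chain_ne := by
        rw [List.isChain_reverse, List.isChain_map]
        exact w.chain_ne.imp fun _ _ h => h.symm }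
  have : w = w' := by
    apply Word.equiv.symm.injective
    change w.prod = w'.prod
    rw [mul_eq_one_iff_eq_inv.1 h]
    simp [Word.prod, w', List.prod_inv_reverse, List.map_map, Function.comp_def]
  conv_lhs => rw [this]

end Monoid.CoprodI

/-- The fundamental group of the Klein bottle, with elements in normal form `w ^ a * e ^ b`. -/
@[ext]
structure KleinGroup where
  /-- the exponent of `w` -/
  a : ℤ
  /-- the exponent of `e` -/
  b : ℤ

namespace KleinGroup

instance : Mul KleinGroup := ⟨fun x y => ⟨x.a + x.b.negOnePow * y.a, x.b + y.b⟩⟩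
instance : One KleinGroup := ⟨⟨0, 0⟩⟩
instance : Inv KleinGroup := ⟨fun x => ⟨-(x.b.negOnePow * x.a), -x.b⟩⟩

theorem mul_def (x y : KleinGroup) : x * y = ⟨x.a + x.b.negOnePow * y.a, x.b + y.b⟩ := rfl
theorem one_def : (1 : KleinGroup) = ⟨0, 0⟩ := rfl
theorem inv_def (x : KleinGroup) : x⁻¹ = ⟨-(x.b.negOnePow * x.a), -x.b⟩ := rfl

instance : Group KleinGroup where
  mul_assoc x y z := by
    simp only [mul_def, Int.negOnePow_add, Units.val_mul]
    congr 1 <;> ring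
  one_mul x := by simp [mul_def, one_def]
  mul_one x := by simp [mul_def, one_def]
  inv_mul_cancel x := by simp [mul_def, inv_def, one_def]

theorem conj_mk_zero (x : KleinGroup) (k : ℤ) :
    x * ⟨k, 0⟩ * x⁻¹ = ⟨x.b.negOnePow * k, 0⟩ := by
  simp only [mul_def, inv_def, add_zero, add_neg_cancel, mk.injEq, and_true]
  have : (x.b.negOnePow : ℤ) * x.b.negOnePow = 1 := by
    rw [← Units.val_mul, Int.units_mul_self, Units.val_one]
  linear_combination (-x.a) * this

theorem mk_zero_zpow (a n : ℤ) : (⟨a, 0⟩ : KleinGroup) ^ n = ⟨n * a, 0⟩ := by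
  have h : ∀ n : ℕ, (⟨a, 0⟩ : KleinGroup) ^ n = ⟨n * a, 0⟩ := by
    intro n
    induction n with
    | zero => simp [one_def]
    | succ n ih => rw [pow_succ, ih]; simp [mul_def]; ring
  cases n with
  | ofNat n => simpa using h n
  | negSucc n => rw [zpow_negSucc, h, Int.negSucc_eq]; simp [inv_def]; ring

/-- The homomorphism from the Klein bottle group defined by images of the generators. -/
def lift {G : Type*} [Group G] (w e : G) (h : e * w * e⁻¹ = w⁻¹) : KleinGroup →* G where
  toFun x := w ^ x.a * e ^ x.b
  map_one' := by simp [one_def]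
  map_mul' x y := by
    have key : ∀ b : ℤ, e ^ b * w * (e ^ b)⁻¹ = w ^ (b.negOnePow : ℤ) := by
      intro b
      have hs : ∀ c d : ℤ, e ^ c * w * (e ^ c)⁻¹ = w ^ (c.negOnePow : ℤ) →
          e ^ d * w * (e ^ d)⁻¹ = w ^ (d.negOnePow : ℤ) →
          e ^ (c + d) * w * (e ^ (c + d))⁻¹ = w ^ ((c + d).negOnePow : ℤ) := by
        intro c d hc hd
        rw [Int.negOnePow_add, Units.val_mul, zpow_mul, ← hc, conj_zpow, ← hd, zpow_add]
        group
      induction b with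
      | zero => simp
      | succ n ih => exact hs _ _ ih (by simpa using h)
      | pred n ih =>
        refine hs _ (-1) ih ?_
        rw [Int.negOnePow_neg, Int.negOnePow_one, Units.val_neg, Units.val_one, zpow_neg_one,
          zpow_neg_one]
        have h' := congrArg (fun z => e⁻¹ * z⁻¹ * e) h
        simpa [mul_assoc] using h'.symm
    have := key x.b
    change w ^ (x.a + x.b.negOnePow * y.a) * e ^ (x.b + y.b) = _
    rw [zpow_add, zpow_add, zpow_mul, ← this, conj_zpow]
    group

theorem lift_apply {G : Type*} [Group G] (w e : G) (h : e * w * e⁻¹ = w⁻¹) (x : KleinGroup) :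
    lift w e h x = w ^ x.a * e ^ x.b := rfl

theorem eq_zpow_mul_zpow (x : KleinGroup) :
    x = (⟨1, 0⟩ : KleinGroup) ^ x.a * (⟨0, 1⟩ : KleinGroup) ^ x.b := by
  have h : ∀ n : ℕ, (⟨0, 1⟩ : KleinGroup) ^ n = ⟨0, n⟩ := by
    intro n
    induction n with
    | zero => simp [one_def]
    | succ n ih => rw [pow_succ, ih]; simp [mul_def]
  have h' : ∀ n : ℤ, (⟨0, 1⟩ : KleinGroup) ^ n = ⟨0, n⟩ := by
    intro n
    cases n with
    | ofNat n => simpa using h n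
    | negSucc n => rw [zpow_negSucc, h, Int.negSucc_eq]; simp [inv_def]
  rw [mk_zero_zpow, h']
  simp [mul_def]

theorem hom_ext {G : Type*} [Group G] {f g : KleinGroup →* G} (hw : f ⟨1, 0⟩ = g ⟨1, 0⟩)
    (he : f ⟨0, 1⟩ = g ⟨0, 1⟩) : f = g := by
  ext x
  rw [eq_zpow_mul_zpow x]
  simp [hw, he]

end KleinGroup

/-- The homomorphism from the group of order two given by an involution. -/
def involutionHom {G : Type*} [Group G] (θ : G) (h : θ * θ = 1) : Multiplicative (ZMod 2) →* G :=
  AddMonoidHom.toMultiplicativeLeft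
    (ZMod.lift 2 ⟨zmultiplesHom (Additive G) (Additive.ofMul θ), by
      change ((2 : ℤ) • Additive.ofMul θ) = 0
      rw [two_zsmul]
      exact h⟩)

@[simp] theorem involutionHom_ofAdd_one {G : Type*} [Group G] (θ : G) (h : θ * θ = 1) :
    involutionHom θ h (Multiplicative.ofAdd 1) = θ := by
  have := ZMod.lift_coe 2 (⟨zmultiplesHom (Additive G) (Additive.ofMul θ), by
      change ((2 : ℤ) • Additive.ofMul θ) = 0
      rw [two_zsmul]
      exact h⟩ : { f : ℤ →+ Additive G // f (2 : ℕ) = 0 }) 1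
  rw [Int.cast_one] at this
  exact (congrArg Additive.toMul this).trans (by simp)

theorem eq_one_or_eq_ofAdd_one (x : Multiplicative (ZMod 2)) :
    x = 1 ∨ x = Multiplicative.ofAdd 1 := by
  revert x; decide

/-- The product of the Klein bottle group and a group of order two. -/
abbrev Gadget : Type := KleinGroup × Multiplicative (ZMod 2)

namespace Gadget

/-- Powers of the first generator. -/
def w (k : ℤ) : Gadget := (⟨k, 0⟩, 1)
/-- The element inverting `w` under conjugation. -/
def e : Gadget := (⟨0, 1⟩, 1)
/-- The central involution. -/
def θ : Gadget := (1, Multiplicative.ofAdd 1)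

theorem w_zpow (a n : ℤ) : w a ^ n = w (n * a) := by
  simp [w, Prod.pow_mk, KleinGroup.mk_zero_zpow]

@[simp] theorem w_zero : w 0 = 1 := rfl

theorem w_one_zpow (n : ℤ) : w 1 ^ n = w n := by rw [w_zpow, mul_one]

theorem w_add (a b : ℤ) : w (a + b) = w a * w b := by
  rw [← w_one_zpow, zpow_add, w_one_zpow, w_one_zpow]

theorem w_inv (a : ℤ) : (w a)⁻¹ = w (-a) := by
  rw [← w_one_zpow, ← zpow_neg, w_one_zpow]

theorem w_injective : Function.Injective w := fun _ _ h =>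
  congrArg (fun x : Gadget => x.1.a) h

theorem conj_w (x : Gadget) (k : ℤ) : x * w k * x⁻¹ = w (x.1.b.negOnePow * k) := by
  refine Prod.ext (x.1.conj_mk_zero k) ?_
  simp [w]

theorem conj_w_eq_or (x : Gadget) : (∀ k, x * w k * x⁻¹ = w k) ∨ ∀ k, x * w k * x⁻¹ = w (-k) := by
  rcases Int.even_or_odd x.1.b with h | h
  · left; intro k; rw [conj_w, Int.negOnePow_even _ h]; simp
  · right; intro k; rw [conj_w, Int.negOnePow_odd _ h]; simp

theorem w_mem_zpowers {m k : ℤ} : w k ∈ Subgroup.zpowers (w m) ↔ m ∣ k := by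
  rw [Subgroup.mem_zpowers_iff]
  constructor
  · rintro ⟨n, h⟩
    rw [w_zpow] at h
    exact ⟨n, by rw [← w_injective h, mul_comm]⟩
  · rintro ⟨n, rfl⟩
    exact ⟨n, by rw [w_zpow, mul_comm]⟩

theorem e_conj_w : e * w 1 * e⁻¹ = (w 1)⁻¹ := by
  rw [conj_w, w_inv]; simp [e]

theorem θ_mul_θ : θ * θ = 1 := rfl

theorem θ_ne_one : θ ≠ 1 := by
  intro h
  have : (Multiplicative.ofAdd 1 : Multiplicative (ZMod 2)) = 1 := congrArg Prod.snd h
  revert this; decide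

theorem θ_commute (x : Gadget) : Commute θ x := by
  refine Prod.ext (by simp [θ]) (mul_comm _ _)

theorem eq_one_or_eq_θ {x : Gadget} (h : x * x = 1) : x = 1 ∨ x = θ := by
  have hb : x.1.b + x.1.b = 0 := congrArg (fun x : Gadget => x.1.b) h
  have hb : x.1.b = 0 := by omega
  have ha : x.1.a + x.1.b.negOnePow * x.1.a = 0 := congrArg (fun x : Gadget => x.1.a) h
  have ha : x.1.a = 0 := by rw [hb] at ha; simp at ha; omega
  have h1 : x.1 = 1 := KleinGroup.ext ha hb
  rcases eq_one_or_eq_ofAdd_one x.2 with h2 | h2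
  · exact Or.inl (Prod.ext h1 h2)
  · exact Or.inr (Prod.ext h1 h2)

theorem exists_mul_self_eq_w {x y : Gadget} (h : y * x * y⁻¹ = x⁻¹) : ∃ a, x * x = w (a + a) := by
  have hb : y.1.b + x.1.b + -y.1.b = -x.1.b := congrArg (fun x : Gadget => x.1.b) h
  have hb : x.1.b = 0 := by omega
  refine ⟨x.1.a, Prod.ext (KleinGroup.ext ?_ ?_) ?_⟩
  · change x.1.a + x.1.b.negOnePow * x.1.a = _
    rw [hb]; simp [w]
  · change x.1.b + x.1.b = 0
    omega
  · rcases eq_one_or_eq_ofAdd_one x.2 with h2 | h2 <;> simp [h2, w]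
    rfl

section lift

variable {G : Type*} [Group G]

/-- The homomorphism from the gadget determined by elements satisfying its relations. -/
def lift (a b c : G) (hba : b * a * b⁻¹ = a⁻¹) (hc : c * c = 1) (hca : Commute c a)
    (hcb : Commute c b) : Gadget →* G :=
  MonoidHom.noncommCoprod (KleinGroup.lift a b hba) (involutionHom c hc) (by
    intro m n
    rcases eq_one_or_eq_ofAdd_one n with rfl | rfl
    · simp
    · rw [involutionHom_ofAdd_one, KleinGroup.lift_apply]
      exact ((hca.zpow_right _).mul_right (hcb.zpow_right _)).symm)

variable {a b c : G} {hba : b * a * b⁻¹ = a⁻¹} {hc : c * c = 1} {hca : Commute c a}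
    {hcb : Commute c b}

@[simp] theorem lift_w (k : ℤ) : lift a b c hba hc hca hcb (w k) = a ^ k := by
  simp [lift, w, KleinGroup.lift_apply]

@[simp] theorem lift_e : lift a b c hba hc hca hcb e = b := by
  simp [lift, e, KleinGroup.lift_apply]

@[simp] theorem lift_θ : lift a b c hba hc hca hcb θ = c := by
  simp [lift, θ]

theorem hom_ext {f g : Gadget →* G} (hw : f (w 1) = g (w 1)) (he : f e = g e) (hθ : f θ = g θ) :
    f = g := by
  have h1 : f.comp (MonoidHom.inl _ _) = g.comp (MonoidHom.inl _ _) := KleinGroup.hom_ext hw he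
  ext x
  have h2 : f (1, x.2) = g (1, x.2) := by
    rcases eq_one_or_eq_ofAdd_one x.2 with h | h <;> rw [h]
    · exact (map_one f).trans (map_one g).symm
    · exact hθ
  have hx : x = (x.1, 1) * (1, x.2) := by simp
  rw [hx, map_mul, map_mul, h2]
  congr 1
  exact DFunLike.congr_fun h1 x.1

end lift

end Gadget

open Monoid

/-- The factors of the free product `Tower Q`. -/
def Fac (Q : Type) : Option ℤ → Type
  | none => FreeGroup (Q × ℤ)
  | some _ => Gadget

instance (Q : Type) : ∀ i, Group (Fac Q i)
  | none => inferInstanceAs (Group (FreeGroup (Q × ℤ)))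
  | some _ => inferInstanceAs (Group Gadget)

/-- The free product of a free group on `Q × ℤ` and of copies of the gadget indexed by `ℤ`. -/
abbrev Tower (Q : Type) : Type := CoprodI (Fac Q)

namespace Tower

variable {Q : Type}

/-- The inclusion of the free factor. -/
def free : FreeGroup (Q × ℤ) →* Tower Q := CoprodI.of (M := Fac Q) (i := none)

/-- The inclusion of the copy of the gadget indexed by `u`. -/
def gad (u : ℤ) : Gadget →* Tower Q := CoprodI.of (M := Fac Q) (i := some u)

/-- The generator of the free factor indexed by `(q, u)`. -/
def t (q : Q) (u : ℤ) : Tower Q := free (FreeGroup.of (q, u))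

section lift
variable {G : Type*} [Group G]

/-- The homomorphism defined by images of the free generators and of the gadgets. -/
def lift (f : Q → ℤ → G) (h : ℤ → Gadget →* G) : Tower Q →* G :=
  CoprodI.lift fun
    | none => FreeGroup.lift fun p => f p.1 p.2
    | some u => h u

variable (f : Q → ℤ → G) (h : ℤ → Gadget →* G)

@[simp] theorem lift_free (x : FreeGroup (Q × ℤ)) :
    lift f h (free x) = FreeGroup.lift (fun p => f p.1 p.2) x :=
  CoprodI.lift_of _ _

@[simp] theorem lift_t (q : Q) (u : ℤ) : lift f h (t q u) = f q u := by
  simp [t]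

@[simp] theorem lift_gad (u : ℤ) (x : Gadget) : lift f h (gad u x) = h u x :=
  CoprodI.lift_of _ _

theorem hom_ext {f g : Tower Q →* G} (ht : ∀ q u, f (t q u) = g (t q u))
    (hg : ∀ u x, f (gad u x) = g (gad u x)) : f = g := by
  refine CoprodI.ext_hom _ _ fun i => ?_
  cases i with
  | none => exact FreeGroup.ext_hom _ _ fun p => ht p.1 p.2
  | some u => exact MonoidHom.ext fun x => hg u x

end lift

/-- The endomorphism shifting indices by `a.1` and twisting the free generators by `w a.2`. -/
def actHom (a : ℤ × ℤ) : Tower Q →* Tower Q :=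
  lift (fun q u => t q (u + a.1) * gad (u + a.1) (Gadget.w a.2)) fun u => gad (u + a.1)

@[simp] theorem actHom_t (a : ℤ × ℤ) (q : Q) (u : ℤ) :
    actHom a (t q u) = t q (u + a.1) * gad (u + a.1) (Gadget.w a.2) := lift_t ..

@[simp] theorem actHom_gad (a : ℤ × ℤ) (u : ℤ) (x : Gadget) :
    actHom a (gad u x : Tower Q) = gad (u + a.1) x := lift_gad ..

theorem actHom_add (a b : ℤ × ℤ) : (actHom (a + b) : Tower Q →* _) = (actHom a).comp (actHom b) := by
  apply hom_ext
  · intro q u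
    simp [add_comm a.1, add_assoc, Gadget.w_add, mul_assoc]
  · intro u x
    simp [add_comm a.1, add_assoc]

theorem actHom_zero : (actHom 0 : Tower Q →* _) = MonoidHom.id _ := by
  apply hom_ext <;> simp

/-- The action of `ℤ × ℤ` on the tower. -/
def act : Multiplicative (ℤ × ℤ) →* MulAut (Tower Q) where
  toFun a := MonoidHom.toMulEquiv (actHom a.toAdd) (actHom (-a.toAdd))
    (by rw [← actHom_add, neg_add_cancel, actHom_zero])
    (by rw [← actHom_add, add_neg_cancel, actHom_zero])
  map_one' := by
    ext x
    exact DFunLike.congr_fun actHom_zero x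
  map_mul' a b := by
    ext x
    exact DFunLike.congr_fun (actHom_add a.toAdd b.toAdd) x

end Tower

/-- The tower extended by the shift and the twist. -/
abbrev Mast (Q : Type) : Type := Tower Q ⋊[Tower.act] Multiplicative (ℤ × ℤ)

namespace Mast

open SemidirectProduct Tower

variable {Q : Type}

/-- The element of `Mast Q` acting as the shift by `n` and the twist by `l`. -/
def x (n l : ℤ) : Mast Q := inr (Multiplicative.ofAdd (n, l))

theorem x_add (n l n' l' : ℤ) : (x (n + n') (l + l') : Mast Q) = x n l * x n' l' := by
  simp [x, ← map_mul, ← ofAdd_add]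

@[simp] theorem x_zero : (x 0 0 : Mast Q) = 1 := rfl

theorem x_conj_inl (n l : ℤ) (τ : Tower Q) : x n l * inl τ * (x n l)⁻¹ = inl (actHom (n, l) τ) :=
  (inl_aut (φ := act) _ τ).symm

theorem eq_inl_mul_x (y : Mast Q) : ∃ τ n l, y = inl τ * x n l :=
  ⟨y.left, y.right.toAdd.1, y.right.toAdd.2, (inl_left_mul_inr_right y).symm⟩

theorem x_one_zero_zpow (n : ℤ) : (x 1 0 : Mast Q) ^ n = x n 0 := by
  rw [x, ← map_zpow, x, ← ofAdd_zsmul]; simp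

theorem x_zero_one_zpow (n : ℤ) : (x 0 1 : Mast Q) ^ n = x 0 n := by
  rw [x, ← map_zpow, x, ← ofAdd_zsmul]; simp

end Mast

namespace Mast

open SemidirectProduct Tower

variable {Q : Type}

/-- A tuple of group elements satisfying the defining relations of `Mast Q`. -/
structure Rep (Q : Type) (G : Type*) [Group G] where
  /-- images of the free generators with index `0` -/
  t : Q → G
  /-- image of the generator `w` of the gadget with index `0` -/
  w : G
  /-- image of the generator `e` of the gadget with index `0` -/
  e : G
  /-- image of the generator `θ` of the gadget with index `0` -/
  θ : G
  /-- image of the shift -/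
  x : G
  /-- image of the twist -/
  d : G
  e_conj_w : e * w * e⁻¹ = w⁻¹
  θ_mul_θ : θ * θ = 1
  θ_w : Commute θ w
  θ_e : Commute θ e
  d_x : Commute d x
  d_w : Commute d w
  d_e : Commute d e
  d_θ : Commute d θ
  d_conj_t : ∀ q, d * t q * d⁻¹ = t q * w

section
variable {G : Type*} [Group G] (r : Rep Q G)

theorem Rep.d_zpow_conj_t (q : Q) (l : ℤ) : r.d ^ l * r.t q * (r.d ^ l)⁻¹ = r.t q * r.w ^ l := by
  have h : (r.t q)⁻¹ * r.d * (r.t q)⁻¹⁻¹ = r.w * r.d := by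
    have := r.d_conj_t q
    rw [mul_inv_eq_iff_eq_mul, mul_assoc] at this
    rw [inv_inv, mul_assoc, this, inv_mul_cancel_left]
  have h2 : (r.t q)⁻¹ * r.d ^ l * (r.t q)⁻¹⁻¹ = r.w ^ l * r.d ^ l := by
    rw [← conj_zpow, h, r.d_w.symm.mul_zpow]
  rw [inv_inv, mul_assoc, inv_mul_eq_iff_eq_mul] at h2
  rw [h2]
  group

/-- The homomorphism from the gadget given by a representation. -/
def Rep.gadget : Gadget →* G := Gadget.lift r.w r.e r.θ r.e_conj_w r.θ_mul_θ r.θ_w r.θ_e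

theorem Rep.d_zpow_commute_gadget (l : ℤ) (g : Gadget) : Commute (r.d ^ l) (r.gadget g) := by
  refine Commute.zpow_left ?_ l
  have : (MulAut.conj r.d).toMonoidHom.comp r.gadget = r.gadget := by
    apply Gadget.hom_ext
    · have := r.d_w
      simp [Rep.gadget, this.eq]
    · have := r.d_e
      simp [Rep.gadget, this.eq]
    · have := r.d_θ
      simp [Rep.gadget, this.eq]
  have := DFunLike.congr_fun this g
  simp only [MonoidHom.coe_comp, Function.comp_apply, MulEquiv.coe_toMonoidHom,
    MulAut.conj_apply] at this
  exact mul_inv_eq_iff_eq_mul.1 this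

/-- The homomorphism from the tower given by a representation. -/
def Rep.tower : Tower Q →* G :=
  Tower.lift (fun q u => r.x ^ u * r.t q * (r.x ^ u)⁻¹)
    fun u => (MulAut.conj (r.x ^ u)).toMonoidHom.comp r.gadget

/-- The homomorphism from the group of shifts and twists given by a representation. -/
def Rep.shift : Multiplicative (ℤ × ℤ) →* G where
  toFun a := r.x ^ a.toAdd.1 * r.d ^ a.toAdd.2
  map_one' := by simp
  map_mul' a b := by
    have := (r.d_x.zpow_zpow a.toAdd.2 b.toAdd.1).eq
    simp only [toAdd_mul, Prod.fst_add, Prod.snd_add, zpow_add, mul_assoc]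
    congr 1
    rw [← mul_assoc, ← this, mul_assoc]

/-- The homomorphism from `Mast Q` given by a representation. -/
def lift : Mast Q →* G :=
  SemidirectProduct.lift r.tower r.shift (by
    intro a
    have hx := (r.d_x.zpow_zpow a.toAdd.2)
    apply Tower.hom_ext
    · intro q u
      have h1 := r.d_zpow_conj_t q a.toAdd.2
      have h2 := (hx u).eq
      change r.tower (actHom a.toAdd (t q u)) = r.shift a * r.tower (t q u) * (r.shift a)⁻¹
      rw [actHom_t, map_mul]
      simp only [Rep.tower, Tower.lift_t, Tower.lift_gad, Rep.shift, MonoidHom.coe_mk,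
        OneHom.coe_mk, MonoidHom.coe_comp, Function.comp_apply, MulEquiv.coe_toMonoidHom,
        MulAut.conj_apply, Rep.gadget, Gadget.lift_w]
      have h3 : r.x ^ a.toAdd.1 * r.d ^ a.toAdd.2 * (r.x ^ u * r.t q * (r.x ^ u)⁻¹) *
          (r.x ^ a.toAdd.1 * r.d ^ a.toAdd.2)⁻¹ = r.x ^ a.toAdd.1 * (r.d ^ a.toAdd.2 * r.x ^ u) *
          r.t q * (r.x ^ a.toAdd.1 * (r.d ^ a.toAdd.2 * r.x ^ u))⁻¹ := by group
      rw [h3, h2, add_comm u, zpow_add]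
      calc _ = r.x ^ a.toAdd.1 * r.x ^ u * (r.t q * r.w ^ a.toAdd.2) *
            (r.x ^ a.toAdd.1 * r.x ^ u)⁻¹ := by group
        _ = _ := by rw [← h1]; group
    · intro u g
      have h1 := (r.d_zpow_commute_gadget a.toAdd.2 g).eq
      have h2 := (hx u).eq
      change r.tower (actHom a.toAdd (gad u g)) = r.shift a * r.tower (gad u g) * (r.shift a)⁻¹
      rw [actHom_gad]
      simp only [Rep.tower, Tower.lift_gad, Rep.shift, MonoidHom.coe_mk,
        OneHom.coe_mk, MonoidHom.coe_comp, Function.comp_apply, MulEquiv.coe_toMonoidHom,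
        MulAut.conj_apply]
      have h3 : r.x ^ a.toAdd.1 * r.d ^ a.toAdd.2 * (r.x ^ u * r.gadget g * (r.x ^ u)⁻¹) *
          (r.x ^ a.toAdd.1 * r.d ^ a.toAdd.2)⁻¹ = r.x ^ a.toAdd.1 * (r.d ^ a.toAdd.2 * r.x ^ u) *
          r.gadget g * (r.x ^ a.toAdd.1 * (r.d ^ a.toAdd.2 * r.x ^ u))⁻¹ := by group
      rw [h3, h2, add_comm u, zpow_add]
      calc _ = r.x ^ a.toAdd.1 * r.x ^ u * (r.gadget g * r.d ^ a.toAdd.2) * (r.d ^ a.toAdd.2)⁻¹ *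
            (r.x ^ a.toAdd.1 * r.x ^ u)⁻¹ := by group
        _ = _ := by rw [← h1]; group)

theorem lift_inl (y : Tower Q) : lift r (inl y) = r.tower y := SemidirectProduct.lift_inl ..

theorem lift_x (n l : ℤ) : lift r (x n l) = r.x ^ n * r.d ^ l := SemidirectProduct.lift_inr ..

@[simp] theorem lift_t (q : Q) (u : ℤ) : lift r (inl (t q u)) = r.x ^ u * r.t q * (r.x ^ u)⁻¹ := by
  simp [lift_inl, Rep.tower]

@[simp] theorem lift_gad (u : ℤ) (g : Gadget) :
    lift r (inl (gad u g)) = r.x ^ u * r.gadget g * (r.x ^ u)⁻¹ := by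
  rw [lift_inl, Rep.tower, Tower.lift_gad]
  rfl

theorem hom_ext {f g : Mast Q →* G} (ht : ∀ q, f (inl (t q 0)) = g (inl (t q 0)))
    (hw : f (inl (gad 0 (Gadget.w 1))) = g (inl (gad 0 (Gadget.w 1))))
    (he : f (inl (gad 0 Gadget.e)) = g (inl (gad 0 Gadget.e)))
    (hθ : f (inl (gad 0 Gadget.θ)) = g (inl (gad 0 Gadget.θ))) (hx : f (x 1 0) = g (x 1 0))
    (hd : f (x 0 1) = g (x 0 1)) : f = g := by
  have hX : ∀ n l, f (x n l) = g (x n l) := by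
    intro n l
    rw [show (x n l : Mast Q) = x 1 0 ^ n * x 0 1 ^ l by
      rw [x_one_zero_zpow, x_zero_one_zpow, ← x_add, add_zero, zero_add]]
    simp [hx, hd]
  have hg : ∀ y, f (inl (gad 0 y)) = g (inl (gad 0 y)) := fun y => DFunLike.congr_fun
    (Gadget.hom_ext (f := (f.comp inl).comp (gad 0)) (g := (g.comp inl).comp (gad 0)) hw he hθ) y
  apply SemidirectProduct.hom_ext
  · apply Tower.hom_ext
    · intro q u
      have : (inl (t q u) : Mast Q) = x u 0 * inl (t q 0) * (x u 0)⁻¹ := by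
        rw [x_conj_inl]; simp
      simp [this, hX, ht]
    · intro u y
      have : (inl (gad u y) : Mast Q) = x u 0 * inl (gad 0 y) * (x u 0)⁻¹ := by
        rw [x_conj_inl]; simp
      simp [this, hX, hg]
  · ext a
    exact hX a.1 a.2

end

/-- The canonical representation of `Mast Q` in itself. -/
def Rep.self (Q : Type) : Rep Q (Mast Q) where
  t q := inl (Tower.t q 0)
  w := inl (gad 0 (Gadget.w 1))
  e := inl (gad 0 Gadget.e)
  θ := inl (gad 0 Gadget.θ)
  x := Mast.x 1 0
  d := Mast.x 0 1
  e_conj_w := by rw [← map_mul, ← map_mul, ← map_inv, ← map_inv, ← map_mul, ← map_mul,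
    Gadget.e_conj_w, map_inv, map_inv]
  θ_mul_θ := by rw [← map_mul, ← map_mul, Gadget.θ_mul_θ, map_one, map_one]
  θ_w := ((Gadget.θ_commute _).map (gad 0)).map inl
  θ_e := ((Gadget.θ_commute _).map (gad 0)).map inl
  d_x := by rw [Commute, SemiconjBy, ← x_add, ← x_add]; simp
  d_w := by rw [Commute, SemiconjBy, ← mul_inv_eq_iff_eq_mul, x_conj_inl]; simp
  d_e := by rw [Commute, SemiconjBy, ← mul_inv_eq_iff_eq_mul, x_conj_inl]; simp
  d_θ := by rw [Commute, SemiconjBy, ← mul_inv_eq_iff_eq_mul, x_conj_inl]; simp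
  d_conj_t q := by rw [x_conj_inl]; simp

variable (Q) in
/-- The defining relators of `Mast Q`. -/
def relators : Set (FreeGroup (Q ⊕ Fin 5)) :=
  let t (q : Q) : FreeGroup (Q ⊕ Fin 5) := FreeGroup.of (Sum.inl q)
  let g (i : Fin 5) : FreeGroup (Q ⊕ Fin 5) := FreeGroup.of (Sum.inr i)
  {g 1 * g 0 * (g 1)⁻¹ * (g 0)⁻¹⁻¹, g 2 * g 2, g 2 * g 0 * (g 0 * g 2)⁻¹,
    g 2 * g 1 * (g 1 * g 2)⁻¹, g 4 * g 3 * (g 3 * g 4)⁻¹, g 4 * g 0 * (g 0 * g 4)⁻¹,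
    g 4 * g 1 * (g 1 * g 4)⁻¹, g 4 * g 2 * (g 2 * g 4)⁻¹} ∪
    Set.range fun q => g 4 * t q * (g 4)⁻¹ * (t q * g 0)⁻¹

/-- The canonical representation of `Mast Q` in the group defined by its relators. -/
def Rep.presented (Q : Type) : Rep Q (PresentedGroup (relators Q)) where
  t q := .of (.inl q)
  w := .of (.inr 0)
  e := .of (.inr 1)
  θ := .of (.inr 2)
  x := .of (.inr 3)
  d := .of (.inr 4)
  e_conj_w := PresentedGroup.mk_eq_mk_of_mul_inv_mem (by simp [relators])
  θ_mul_θ := PresentedGroup.one_of_mem (rels := relators Q) (by simp [relators])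
  θ_w := PresentedGroup.mk_eq_mk_of_mul_inv_mem (by simp [relators])
  θ_e := PresentedGroup.mk_eq_mk_of_mul_inv_mem (by simp [relators])
  d_x := PresentedGroup.mk_eq_mk_of_mul_inv_mem (by simp [relators])
  d_w := PresentedGroup.mk_eq_mk_of_mul_inv_mem (by simp [relators])
  d_e := PresentedGroup.mk_eq_mk_of_mul_inv_mem (by simp [relators])
  d_θ := PresentedGroup.mk_eq_mk_of_mul_inv_mem (by simp [relators])
  d_conj_t q := PresentedGroup.mk_eq_mk_of_mul_inv_mem (Or.inr ⟨q, rfl⟩)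

/-- The images of the generators of the presentation of `Mast Q`. -/
def Rep.gen {G : Type*} [Group G] (r : Rep Q G) : Q ⊕ Fin 5 → G :=
  Sum.elim r.t ![r.w, r.e, r.θ, r.x, r.d]

theorem Rep.lift_gen_relators {G : Type*} [Group G] (r : Rep Q G) :
    ∀ y ∈ relators Q, FreeGroup.lift r.gen y = 1 := by
  rintro y (hy | ⟨q, rfl⟩)
  · have h0 := r.e_conj_w
    have h1 := r.θ_mul_θ
    have h2 := r.θ_w.eq
    have h3 := r.θ_e.eq
    have h4 := r.d_x.eq
    have h5 := r.d_w.eq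
    have h6 := r.d_e.eq
    have h7 := r.d_θ.eq
    rcases hy with rfl | rfl | rfl | rfl | rfl | rfl | rfl | rfl <;>
      simp only [map_mul, map_inv, FreeGroup.lift_apply_of, Rep.gen, Sum.elim_inr, Matrix.cons_val]
    · rw [h0]; simp
    · exact h1
    all_goals rw [mul_inv_eq_one]; assumption
  · simp only [map_mul, map_inv, FreeGroup.lift_apply_of, Rep.gen, Sum.elim_inr, Sum.elim_inl,
      Matrix.cons_val]
    rw [mul_inv_eq_one]
    exact r.d_conj_t q

instance [Finite Q] : Group.IsFinitelyPresented (Mast Q) := by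
  have : Finite (relators Q) := Set.Finite.to_subtype
    ((Set.toFinite _).union (Set.finite_range _))
  let f : PresentedGroup (relators Q) →* Mast Q :=
    PresentedGroup.toGroup (Rep.self Q).lift_gen_relators
  let g : Mast Q →* PresentedGroup (relators Q) := lift (Rep.presented Q)
  have hf (i) : f (PresentedGroup.of i) = (Rep.self Q).gen i := PresentedGroup.toGroup.of _
  have hfg : f.comp g = MonoidHom.id _ := by
    apply hom_ext
    · intro q
      simp [g, Rep.presented]
      exact hf (.inl q)
    · simp [g, Rep.presented, Rep.gadget]
      exact hf (.inr 0)
    · simp [g, Rep.presented, Rep.gadget]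
      exact hf (.inr 1)
    · simp [g, Rep.presented, Rep.gadget]
      exact hf (.inr 2)
    · simp [g, Rep.presented, lift_x]
      exact hf (.inr 3)
    · simp [g, Rep.presented, lift_x]
      exact hf (.inr 4)
  have hgf : g.comp f = MonoidHom.id _ := by
    apply PresentedGroup.ext
    intro i
    rw [MonoidHom.comp_apply, hf]
    rcases i with q | i
    · simp [g, Rep.gen, Rep.self, Rep.presented]
    · fin_cases i <;> simp [g, Rep.gen, Rep.self, Rep.presented, Rep.gadget, lift_x]
  exact Group.IsFinitelyPresented.equiv (MonoidHom.toMulEquiv f g hgf hfg)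

end Mast

/-- The action of `ℤ` on the free group on `ℤ` by shifting generators. -/
def freeShift : Multiplicative ℤ →* MulAut (FreeGroup ℤ) where
  toFun n := FreeGroup.freeGroupCongr (Equiv.addRight n.toAdd)
  map_one' := by
    apply MulEquiv.toMonoidHom_injective
    apply FreeGroup.ext_hom
    intro a
    simp
  map_mul' m n := by
    apply MulEquiv.toMonoidHom_injective
    apply FreeGroup.ext_hom
    intro a
    simp [add_assoc, add_comm m.toAdd]

@[simp] theorem freeShift_of (n : Multiplicative ℤ) (a : ℤ) :
    freeShift n (FreeGroup.of a) = FreeGroup.of (a + n.toAdd) := by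
  simp [freeShift]

/-- The free group on `ℤ` extended by the shift; it is generated by two elements. -/
abbrev ShiftGroup : Type := FreeGroup ℤ ⋊[freeShift] Multiplicative ℤ

namespace Tower

variable {Q : Type}

/-- The homomorphism killing the gadgets. -/
def collapse : Tower Q →* FreeGroup (Q × ℤ) := lift (fun q u => FreeGroup.of (q, u)) fun _ => 1

/-- The subgroup generated by the free generators with index in `E` and by `w ^ m u` in the
gadget with index `u`. -/
def sub (E : Set (Q × ℤ)) (m : ℤ → ℤ) : Subgroup (Tower Q) :=
  Monoid.CoprodI.factorSubgroup fun
    | none => Subgroup.closure (FreeGroup.of '' E)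
    | some u => Subgroup.zpowers (Gadget.w (m u))

variable {E : Set (Q × ℤ)} {m : ℤ → ℤ}

theorem sub_le {S : Subgroup (Tower Q)} :
    sub E m ≤ S ↔ (∀ p ∈ E, t p.1 p.2 ∈ S) ∧ ∀ u, gad u (Gadget.w (m u)) ∈ S := by
  rw [sub, Monoid.CoprodI.factorSubgroup_le]
  constructor
  · exact fun h => ⟨fun p hp => h none _ (Subgroup.subset_closure ⟨p, hp, rfl⟩),
      fun u => h (some u) _ (Subgroup.mem_zpowers _)⟩
  · rintro ⟨h1, h2⟩ (_ | u) g hg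
    · have : Subgroup.closure (FreeGroup.of '' E) ≤ S.comap free := by
        rw [Subgroup.closure_le]
        rintro _ ⟨p, hp, rfl⟩
        exact h1 p hp
      exact this hg
    · have : Subgroup.zpowers (Gadget.w (m u)) ≤ S.comap (gad u) := by
        rw [Subgroup.zpowers_le]
        exact h2 u
      exact this hg

theorem t_mem_sub {q : Q} {u : ℤ} (h : (q, u) ∈ E) : t q u ∈ sub E m := (sub_le.1 le_rfl).1 _ h

theorem gad_mem_sub {u : ℤ} {y : Gadget} :
    gad u y ∈ sub E m ↔ y ∈ Subgroup.zpowers (Gadget.w (m u)) :=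
  Monoid.CoprodI.of_mem_factorSubgroup_iff (i := some u)

theorem gad_w_mem_sub {u k : ℤ} : gad u (Gadget.w k) ∈ sub E m ↔ m u ∣ k := by
  rw [gad_mem_sub, Gadget.w_mem_zpowers]

/-- The homomorphism sending the generator `n` to the free generator with state `q` and index
`i + j * n`, modified by an element of a gadget. -/
def arm (q : Q) (i j κ l : ℤ) : FreeGroup ℤ →* Tower Q :=
  FreeGroup.lift fun n => t q (i + j * n) * gad (i + j * n) (Gadget.w (κ + l * n))

variable {q : Q} {i j κ l : ℤ}

@[simp] theorem arm_of (n : ℤ) : arm q i j κ l (FreeGroup.of n) =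
    t q (i + j * n) * gad (i + j * n) (Gadget.w (κ + l * n)) := FreeGroup.lift_apply_of

open Classical in
/-- A left inverse of `FreeGroup.map fun n => (q, i + j * n)`. -/
noncomputable def armRetract (q : Q) (i j : ℤ) : FreeGroup (Q × ℤ) →* FreeGroup ℤ :=
  FreeGroup.lift fun p => if h : ∃ n, p = (q, i + j * n) then FreeGroup.of h.choose else 1

theorem armRetract_of (hj : j ≠ 0) (n : ℤ) :
    armRetract q i j (FreeGroup.of (q, i + j * n)) = FreeGroup.of n := by
  have h : ∃ n', (q, i + j * n) = (q, i + j * n') := ⟨n, rfl⟩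
  have hc : h.choose = n := by
    simp [hj]
  rw [armRetract, FreeGroup.lift_apply_of, dif_pos h, hc]

theorem armRetract_collapse_arm (hj : j ≠ 0) (x : FreeGroup ℤ) :
    armRetract q i j (collapse (arm q i j κ l x)) = x := by
  have : ((armRetract q i j).comp collapse).comp (arm q i j κ l) = MonoidHom.id _ := by
    apply FreeGroup.ext_hom
    intro n
    simp [collapse, armRetract_of hj]
  exact DFunLike.congr_fun this x

theorem arm_mem_sub_iff (hj : j ≠ 0)
    (hm : ∀ n, (q, i + j * n) ∈ E → m (i + j * n) ∣ κ + l * n) (x : FreeGroup ℤ) :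
    arm q i j κ l x ∈ sub E m ↔
      x ∈ Subgroup.closure (FreeGroup.of '' {n | (q, i + j * n) ∈ E}) := by
  constructor
  · intro h
    have hle : sub E m ≤ (Subgroup.closure (FreeGroup.of '' {n | (q, i + j * n) ∈ E})).comap
        ((armRetract q i j).comp collapse) := by
      rw [sub_le]
      constructor
      · rintro p hp
        rw [Subgroup.mem_comap]
        simp only [collapse, MonoidHom.comp_apply, lift_t]
        by_cases h : ∃ n, p = (q, i + j * n)
        · obtain ⟨n, rfl⟩ := h
          rw [armRetract_of hj]
          exact Subgroup.subset_closure ⟨n, hp, rfl⟩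
        · rw [armRetract, FreeGroup.lift_apply_of, dif_neg h]
          exact one_mem _
      · intro u
        simp [collapse]
    simpa [armRetract_collapse_arm hj] using hle h
  · intro h
    have : Subgroup.closure (FreeGroup.of '' {n | (q, i + j * n) ∈ E}) ≤
        (sub E m).comap (arm q i j κ l) := by
      rw [Subgroup.closure_le]
      rintro _ ⟨n, hn, rfl⟩
      rw [SetLike.mem_coe, Subgroup.mem_comap, arm_of]
      exact mul_mem (t_mem_sub hn) (gad_w_mem_sub.2 (hm n hn))
    exact this h

end Tower

theorem ShiftGroup.closure_eq_top : Subgroup.closure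
    {(SemidirectProduct.inl (FreeGroup.of 0) : ShiftGroup),
      SemidirectProduct.inr (Multiplicative.ofAdd 1)} = ⊤ := by
  set S := Subgroup.closure {(SemidirectProduct.inl (FreeGroup.of 0) : ShiftGroup),
      SemidirectProduct.inr (Multiplicative.ofAdd 1)}
  have h0 : SemidirectProduct.inl (FreeGroup.of 0) ∈ S := Subgroup.subset_closure (by simp)
  have h1 : ∀ n : Multiplicative ℤ, SemidirectProduct.inr n ∈ S := by
    intro n
    have : (SemidirectProduct.inr (Multiplicative.ofAdd 1) : ShiftGroup) ∈ S :=
      Subgroup.subset_closure (by simp)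
    have := zpow_mem this n.toAdd
    rwa [← map_zpow, ← ofAdd_zsmul, smul_eq_mul, mul_one] at this
  rw [eq_top_iff]
  rintro y -
  rw [← SemidirectProduct.inl_left_mul_inr_right y]
  refine mul_mem ?_ (h1 _)
  generalize y.left = z
  have : (⊤ : Subgroup (FreeGroup ℤ)) ≤ S.comap SemidirectProduct.inl := by
    rw [← FreeGroup.closure_range_of, Subgroup.closure_le]
    rintro _ ⟨n, rfl⟩
    have := mul_mem (mul_mem (h1 (Multiplicative.ofAdd n)) h0) (inv_mem (h1 (Multiplicative.ofAdd n)))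
    rw [← map_inv, ← SemidirectProduct.inl_aut] at this
    simpa using this
  exact this (Subgroup.mem_top z)

instance : Group.FG ShiftGroup :=
  ⟨⟨{SemidirectProduct.inl (FreeGroup.of 0), SemidirectProduct.inr (Multiplicative.ofAdd 1)}, by
    simpa using ShiftGroup.closure_eq_top⟩⟩

namespace Mast

open SemidirectProduct Tower

variable {Q : Type}

/-- The normal subgroup generated by the gadgets. -/
def core (Q : Type) : Subgroup (Mast Q) := (collapse (Q := Q)).ker.map inl

theorem collapse_actHom (a : ℤ × ℤ) (τ : Tower Q) :
    collapse (actHom a τ) = FreeGroup.map (fun p => (p.1, p.2 + a.1)) (collapse τ) := by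
  have : collapse.comp (actHom a : Tower Q →* _) =
      (FreeGroup.map (fun p => (p.1, p.2 + a.1))).comp collapse := by
    apply Tower.hom_ext <;> simp [collapse]
  exact DFunLike.congr_fun this τ

instance : (core Q).Normal := by
  refine ⟨?_⟩
  rintro _ ⟨τ, hτ, rfl⟩ g
  obtain ⟨σ, n, l, rfl⟩ := eq_inl_mul_x g
  have : inl σ * x n l * inl τ * (inl σ * x n l)⁻¹ = inl (σ * actHom (n, l) τ * σ⁻¹) := by
    rw [map_mul, map_mul, ← x_conj_inl, map_inv]
    group
  rw [this]
  refine ⟨_, ?_, rfl⟩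
  have hτ : collapse τ = 1 := hτ
  simp [MonoidHom.mem_ker, collapse_actHom, hτ]

theorem gad_mem_core (u : ℤ) (y : Gadget) : inl (gad u y) ∈ core Q :=
  ⟨_, by simp [collapse], rfl⟩

theorem inl_mem_map {S : Subgroup (Tower Q)} {τ : Tower Q} :
    (inl τ : Mast Q) ∈ S.map inl ↔ τ ∈ S :=
  Subgroup.mem_map_iff_mem inl_injective

/-- The homomorphism extending `Tower.arm` and sending the shift to a shift and a twist. -/
def arm (q : Q) (i j κ l : ℤ) : ShiftGroup →* Mast Q :=
  SemidirectProduct.lift (inl.comp (Tower.arm q i j κ l))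
    (inr.comp (AddMonoidHom.toMultiplicative
      ((AddMonoidHom.mulLeft j).prod (AddMonoidHom.mulLeft l)))) (by
    intro s
    apply FreeGroup.ext_hom
    intro n
    change inl (Tower.arm q i j κ l (freeShift s (FreeGroup.of n))) =
      x (j * s.toAdd) (l * s.toAdd) * inl (Tower.arm q i j κ l (FreeGroup.of n)) *
        (x (j * s.toAdd) (l * s.toAdd))⁻¹
    rw [x_conj_inl]
    simp only [freeShift_of, Tower.arm_of, actHom_t, actHom_gad, map_mul]
    simp only [mul_assoc, ← map_mul, ← Gadget.w_add]
    ring_nf)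

variable {q : Q} {i j κ l : ℤ}

@[simp] theorem arm_inl (y : FreeGroup ℤ) :
    arm q i j κ l (inl y) = inl (Tower.arm q i j κ l y) := SemidirectProduct.lift_inl ..

theorem eq_inl_of_arm_mem_range (hj : j ≠ 0) {k : ShiftGroup} {τ : Tower Q}
    (h : arm q i j κ l k = inl τ) : ∃ y, k = inl y := by
  have h1 : (arm q i j κ l k).right.toAdd.1 = j * k.right.toAdd := by
    rw [← inl_left_mul_inr_right k, map_mul, arm_inl]
    simp [arm]
  rw [h] at h1
  have h2 : k.right = 1 := by
    have : (0 : ℤ) = j * k.right.toAdd := h1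
    rw [eq_comm, mul_eq_zero] at this
    simpa [hj] using this
  refine ⟨k.left, ?_⟩
  rw [← inl_left_mul_inr_right k, h2]
  simp

theorem eq_one_of_arm_mem_core (hj : j ≠ 0) {k : ShiftGroup} (h : arm q i j κ l k ∈ core Q) :
    k = 1 := by
  obtain ⟨τ, hτ, h⟩ := h
  obtain ⟨y, rfl⟩ := eq_inl_of_arm_mem_range hj h.symm
  rw [arm_inl] at h
  rw [inl_injective h] at hτ
  have := armRetract_collapse_arm (κ := κ) (l := l) (q := q) (i := i) hj y
  rw [show collapse (Tower.arm q i j κ l y) = 1 from hτ, map_one] at this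
  rw [← this, map_one]

theorem arm_mem_map_sub_iff {E : Set (Q × ℤ)} {m : ℤ → ℤ} (hj : j ≠ 0)
    (hm : ∀ n, (q, i + j * n) ∈ E → m (i + j * n) ∣ κ + l * n) (k : ShiftGroup) :
    arm q i j κ l k ∈ (sub E m).map inl ↔
      k ∈ (Subgroup.closure (FreeGroup.of '' {n | (q, i + j * n) ∈ E})).map inl := by
  constructor
  · rintro ⟨τ, hτ, h⟩
    obtain ⟨y, rfl⟩ := eq_inl_of_arm_mem_range hj h.symm
    rw [arm_inl] at h
    rw [inl_injective h] at hτ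
    exact ⟨y, (arm_mem_sub_iff hj hm y).1 hτ, rfl⟩
  · rintro ⟨y, hy, rfl⟩
    rw [arm_inl, inl_mem_map]
    exact (arm_mem_sub_iff hj hm y).2 hy

end Mast

namespace HNNExtension

variable {G : Type*} [Group G] {A : Subgroup G}

/-- The retraction of an HNN extension with trivial twist onto its base group. -/
noncomputable def retract (A : Subgroup G) : HNNExtension G A A (MulEquiv.refl A) →* G :=
  lift (MonoidHom.id G) 1 (by simp)

@[simp] theorem retract_of (g : G) : retract A (of g) = g := lift_of ..

@[simp] theorem retract_t : retract A t = 1 := lift_t ..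

theorem t_zpow_commute {a : G} (ha : a ∈ A) (u : ℤˣ) :
    Commute (t ^ (u : ℤ)) (of a : HNNExtension G A A (MulEquiv.refl A)) :=
  Commute.zpow_left (t_mul_of (φ := MulEquiv.refl A) ⟨a, ha⟩) _

theorem mem_toSubgroup_self {u : ℤˣ} {a : G} : a ∈ toSubgroup A A u ↔ a ∈ A := by
  rcases Int.units_eq_one_or u with rfl | rfl <;> simp

theorem conj_of_eq_of_retract {z z' : G} (hz : ∀ b, b * z * b⁻¹ ∈ A → b * z' * b⁻¹ ∈ A)
    {g : HNNExtension G A A (MulEquiv.refl A)} {b : G} (h : g * of z = of b * g) :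
    g * of z' * g⁻¹ = of (retract A g * z' * (retract A g)⁻¹) := by
  induction hn : len g using Nat.strong_induction_on generalizing g b with
  | _ n ih =>
  by_cases h0 : len g = 0
  · obtain ⟨c, rfl⟩ := len_eq_zero_iff.1 h0
    simp
  obtain ⟨u, k, hl⟩ := exists_len_t_mul h0
  have h1 : t ^ (u : ℤ) * (of (k * b * k⁻¹) * (of k * g)) = t ^ (u : ℤ) * (of k * g) * of z := by
    simp only [map_mul, map_inv, mul_assoc, inv_mul_cancel_left, h]
  obtain ⟨-, hk⟩ := eq_of_len_t_mul_lt (u := u) (v := u) (g := of k * g) (h := k * b * k⁻¹)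
    (by rw [len_of_mul k]; omega) (by rw [h1, len_mul_of, len_of_mul k]; omega)
  rw [mem_toSubgroup_self] at hk
  rw [← mul_assoc, (t_zpow_commute hk u).eq, mul_assoc] at h1
  have h2 := ih _ (by omega) h1.symm rfl
  set g₁ := t ^ (u : ℤ) * (of k * g) with hg₁
  have hb := congrArg (retract A) h1
  simp only [map_mul, retract_of] at hb
  have hA : retract A g₁ * z' * (retract A g₁)⁻¹ ∈ A := by
    apply hz
    rwa [← hb, mul_inv_cancel_right]
  have hg : g = of k⁻¹ * ((t ^ (u : ℤ))⁻¹ * g₁) := by simp [hg₁]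
  have hr : retract A g = k⁻¹ * retract A g₁ := by
    rw [hg, map_mul, map_mul, ← zpow_neg, map_zpow]; simp
  have h3 : (t ^ (u : ℤ))⁻¹ * (g₁ * of z' * g₁⁻¹) * (t ^ (u : ℤ)) = g₁ * of z' * g₁⁻¹ := by
    rw [h2, mul_assoc, ← (t_zpow_commute hA u).eq, inv_mul_cancel_left]
  calc g * of z' * g⁻¹ = of k⁻¹ * ((t ^ (u : ℤ))⁻¹ * (g₁ * of z' * g₁⁻¹) * (t ^ (u : ℤ))) * of k := by
        rw [hg]; simp [mul_assoc]
    _ = _ := by rw [h3, h2, hr]; simp [mul_assoc]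

end HNNExtension

namespace Tower

variable {Q : Type} {E : Set (Q × ℤ)} {m : ℤ → ℤ}

theorem eq_gad_of_conj {u u' : ℤ} {g g' : Gadget} (hg : g ≠ 1) {τ : Tower Q}
    (h : τ * gad u g * τ⁻¹ = gad u' g') : u = u' ∧ ∃ c, τ = gad u c := by
  obtain ⟨h1, c, hc⟩ := Monoid.CoprodI.exists_of_conj (G := Fac Q) (i := some u) (j := some u')
    (g := g) hg (g' := g') h
  exact ⟨by simpa using h1, c, hc⟩

theorem conj_w_mem_sub {F : ℤ} (hF : F ≠ 0) (hm : ∀ u N, m u ∣ N * F → m u ∣ N) {u N : ℤ}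
    {τ : Tower Q} (h : τ * gad u (Gadget.w (N * F)) * τ⁻¹ ∈ sub E m) :
    τ * gad u (Gadget.w N) * τ⁻¹ ∈ sub E m := by
  by_cases hN : N = 0
  · simp [hN]
  have hw : Gadget.w (N * F) ≠ 1 := fun h => by
    have := Gadget.w_injective (h.trans Gadget.w_zero.symm)
    simp [hN, hF] at this
  obtain ⟨a, ha, c, rfl, hc⟩ : ∃ a ∈ sub E m, ∃ c : Gadget, τ = a * gad u c ∧
      c * Gadget.w (N * F) * c⁻¹ ∈ Subgroup.zpowers (Gadget.w (m u)) :=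
    Monoid.CoprodI.exists_of_conj_mem_factorSubgroup (G := Fac Q)
      (i := some u) (g := Gadget.w (N * F)) hw h
  have key : gad u (c * Gadget.w N * c⁻¹) ∈ sub E m := by
    rw [gad_mem_sub]
    rcases Gadget.conj_w_eq_or c with h | h <;> rw [h, Gadget.w_mem_zpowers] at hc ⊢
    · exact hm _ _ hc
    · rw [dvd_neg] at hc ⊢
      exact hm _ _ hc
  have := mul_mem (mul_mem ha key) (inv_mem ha)
  convert this using 1
  simp only [map_mul, map_inv, mul_inv_rev, mul_assoc]

theorem exists_conj_eq_θ {τ : Tower Q} (h : τ * τ = 1) (h1 : τ ≠ 1) :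
    ∃ c u, c * τ * c⁻¹ = gad u Gadget.θ := by
  obtain ⟨c, i, g, hc⟩ := Monoid.CoprodI.exists_conj_of_mul_self_eq_one (G := Fac Q) h
  have hg : g * g = 1 := by
    apply Monoid.CoprodI.of_injective (M := Fac Q) i
    rw [map_mul, ← hc, map_one]
    calc _ = c * (τ * τ) * c⁻¹ := by group
      _ = 1 := by simp [h]
  have hg1 : g ≠ 1 := by
    rintro rfl
    rw [map_one, mul_inv_eq_one] at hc
    exact h1 (by simpa using hc)
  cases i with
  | none =>
    have key : ∀ x : FreeGroup (Q × ℤ), x * x = 1 → x = 1 := fun x hx =>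
      (pow_eq_one_iff_left two_ne_zero).1 ((pow_two x).trans hx)
    exact absurd (key g hg) hg1
  | some u =>
    refine ⟨c, u, hc.trans ?_⟩
    rcases Gadget.eq_one_or_eq_θ hg with h | h
    · exact absurd h hg1
    · rw [h]; rfl

end Tower

namespace Mast

open SemidirectProduct Tower

variable {Q : Type} {E : Set (Q × ℤ)} {m : ℤ → ℤ}

theorem conj_inl_gad (τ : Tower Q) (n l u : ℤ) (g : Gadget) :
    inl τ * x n l * inl (gad u g) * (inl τ * x n l)⁻¹ = inl (τ * gad (u + n) g * τ⁻¹) := by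
  have := x_conj_inl n l (gad u g : Tower Q)
  rw [actHom_gad] at this
  rw [map_mul, map_mul, ← this, map_inv]
  group

theorem eq_gad_mul_x_of_conj {u : ℤ} {g g' : Gadget} (hg : g ≠ 1) {y : Mast Q}
    (h : y * inl (gad u g) * y⁻¹ = inl (gad u g')) :
    ∃ c l, y = inl (gad u c) * x 0 l ∧ c * g * c⁻¹ = g' := by
  obtain ⟨τ, n, l, rfl⟩ := eq_inl_mul_x y
  rw [conj_inl_gad] at h
  have h := inl_injective h
  obtain ⟨hu, c, rfl⟩ := eq_gad_of_conj hg h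
  obtain rfl : n = 0 := by omega
  refine ⟨c, l, by simp, ?_⟩
  apply Monoid.CoprodI.of_injective (M := Fac Q) (some u)
  rw [add_zero] at h
  change gad u _ = gad u _
  rw [← h]
  simp

/-- The homomorphism onto the group of order two detecting the central involutions. -/
def parity : Mast Q →* Multiplicative (ZMod 2) :=
  lift { t := 1, w := 1, e := 1, θ := Multiplicative.ofAdd 1, x := 1, d := 1
         e_conj_w := rfl, θ_mul_θ := rfl, θ_w := rfl, θ_e := rfl, d_x := rfl, d_w := rfl,
         d_e := rfl, d_θ := rfl, d_conj_t := fun _ => rfl }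

theorem parity_eq_one_of_mem {y : Mast Q} (hy : y ∈ (sub E m).map inl) : parity y = 1 := by
  have : (sub E m).map inl ≤ (parity (Q := Q)).ker := by
    rw [Subgroup.map_le_iff_le_comap, sub_le]
    constructor
    · intro p _
      simp [parity, MonoidHom.mem_ker]
    · intro u
      simp [parity, MonoidHom.mem_ker, Rep.gadget]
  exact this hy

theorem conj_θ_notMem (y : Mast Q) (u : ℤ) : y * inl (gad u Gadget.θ) * y⁻¹ ∉ (sub E m).map inl := by
  intro h
  have := parity_eq_one_of_mem h
  rw [map_mul, map_mul, map_inv, mul_inv_eq_one, mul_eq_left] at this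
  simp only [parity, lift_gad, Rep.gadget, Gadget.lift_θ] at this
  revert this
  simp

theorem conj_w_mem {F : ℤ} (hF : F ≠ 0) (hm : ∀ u N, m u ∣ N * F → m u ∣ N) {u N : ℤ}
    {y : Mast Q} (h : y * inl (gad u (Gadget.w (N * F))) * y⁻¹ ∈ (sub E m).map inl) :
    y * inl (gad u (Gadget.w N)) * y⁻¹ ∈ (sub E m).map inl := by
  obtain ⟨τ, n, l, rfl⟩ := eq_inl_mul_x y
  rw [conj_inl_gad, inl_mem_map] at h ⊢
  exact conj_w_mem_sub hF hm h

theorem exists_conj_eq_θ {y : Mast Q} (h : y * y = 1) (h1 : y ≠ 1) :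
    ∃ c u, c * y * c⁻¹ = inl (gad u Gadget.θ) := by
  have hr : y.right = 1 := by
    have : y.right.toAdd + y.right.toAdd = 0 := congrArg (fun z : Mast Q => z.right.toAdd) h
    have h1 := congrArg Prod.fst this
    have h2 := congrArg Prod.snd this
    simp only [Prod.fst_add, Prod.snd_add, Prod.fst_zero, Prod.snd_zero] at h1 h2
    have : y.right.toAdd = 0 := Prod.ext (by simp; omega) (by simp; omega)
    simpa using this
  obtain ⟨τ, rfl⟩ : ∃ τ, y = inl τ := ⟨y.left, by
    rw [← inl_left_mul_inr_right y, hr]; simp⟩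
  obtain ⟨c, u, hc⟩ := Tower.exists_conj_eq_θ (τ := τ)
    (inl_injective (φ := act) (by simpa using h)) (by rintro rfl; simp at h1)
  exact ⟨inl c, u, by rw [← hc]; simp⟩

theorem inl_gad_ne_one {u : ℤ} {g : Gadget} (hg : g ≠ 1) : (inl (gad u g) : Mast Q) ≠ 1 := by
  intro h
  rw [← map_one inl] at h
  exact hg (Monoid.CoprodI.of_injective (M := Fac Q) (some u)
    ((inl_injective h).trans (map_one _).symm))

end Mast

namespace IsStage

open SemidirectProduct Tower Mast HNNExtension

variable {Q : Type} {E : Set (Q × ℤ)} {m : ℤ → ℤ} {B : Type*} [Group B] {ι : Mast Q →* B}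
  {A : Subgroup B} (h : IsStage (core Q) ((sub E m).map inl) ι A)

include h

theorem conj_θ_notMem (b : B) (u : ℤ) : b * ι (inl (gad u Gadget.θ)) * b⁻¹ ∉ A := by
  intro hb
  obtain ⟨a, ha, y, rfl⟩ := h.conj _ (gad_mem_core u _) (inl_gad_ne_one Gadget.θ_ne_one) b hb
  apply Mast.conj_θ_notMem y u (E := E) (m := m)
  rw [← h.mem]
  have := mul_mem (mul_mem (inv_mem ha) hb) ha
  convert this using 1
  simp only [map_mul, map_inv]
  group

theorem conj_w_mem {F : ℤ} (hF : F ≠ 0) (hm : ∀ u N, m u ∣ N * F → m u ∣ N) {u N : ℤ} (b : B)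
    (hb : b * ι (inl (gad u (Gadget.w (N * F)))) * b⁻¹ ∈ A) :
    b * ι (inl (gad u (Gadget.w N))) * b⁻¹ ∈ A := by
  by_cases hN : N = 0
  · simp [hN]
  have hw : Gadget.w (N * F) ≠ 1 := fun h => by
    have := Gadget.w_injective (h.trans Gadget.w_zero.symm)
    simp [hN, hF] at this
  obtain ⟨a, ha, y, rfl⟩ := h.conj _ (gad_mem_core u _) (inl_gad_ne_one hw) b hb
  have h1 : y * inl (gad u (Gadget.w (N * F))) * y⁻¹ ∈ (sub E m).map inl := by
    rw [← h.mem]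
    have := mul_mem (mul_mem (inv_mem ha) hb) ha
    convert this using 1
    simp only [map_mul, map_inv]
    group
  have := mul_mem (mul_mem ha ((h.mem _).2 (Mast.conj_w_mem hF hm h1))) (inv_mem ha)
  convert this using 1
  simp only [map_mul, map_inv]
  group

/-- Elements of `B` conjugating an element of a gadget into the same gadget. -/
theorem eq_of_conj {u : ℤ} {g g' : Gadget} (hg : g ≠ 1) {b : B}
    (hb : b * ι (inl (gad u g)) * b⁻¹ = ι (inl (gad u g'))) :
    ∃ c l, b = ι (inl (gad u c) * x 0 l) ∧ c * g * c⁻¹ = g' := by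
  obtain ⟨y, rfl⟩ := h.mal _ (gad_mem_core u _) (inl_gad_ne_one hg) b ⟨_, hb.symm⟩
  rw [← map_mul, ← map_inv, ← map_mul] at hb
  obtain ⟨c, l, rfl, hc⟩ := eq_gad_mul_x_of_conj hg (h.inj hb)
  exact ⟨c, l, rfl, hc⟩

/-- The centralizer of the central involution of a gadget. -/
theorem eq_of_commute_θ {u : ℤ} {g : HNNExtension B A A (MulEquiv.refl A)}
    (hg : Commute (of (ι (inl (gad u Gadget.θ)))) g) :
    ∃ c l, g = of (ι (inl (gad u c) * x 0 l)) := by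
  obtain ⟨b, rfl⟩ := exists_of_of_conj (z := ι (inl (gad u Gadget.θ)))
    (fun b v => by rw [mem_toSubgroup_self]; exact h.conj_θ_notMem b u) hg.symm.eq
  have h1 : b * ι (inl (gad u Gadget.θ)) * b⁻¹ = ι (inl (gad u Gadget.θ)) := by
    apply of_injective (MulEquiv.refl A)
    rw [map_mul, map_mul, map_inv, mul_inv_eq_iff_eq_mul]
    exact hg.symm.eq
  obtain ⟨c, l, rfl, -⟩ := h.eq_of_conj Gadget.θ_ne_one h1
  exact ⟨c, l, rfl⟩

theorem commute_of_commute_pow {F : ℕ} (hF : F ≠ 0) (hm : ∀ u N, m u ∣ N * F → m u ∣ N) {u : ℤ}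
    {v w e : HNNExtension B A A (MulEquiv.refl A)}
    (hw : Commute (of (ι (inl (gad u Gadget.θ)))) w)
    (he : Commute (of (ι (inl (gad u Gadget.θ)))) e)
    (hew : e * w * e⁻¹ = w⁻¹) (hv : Commute v (w ^ F)) : Commute v (w * w) := by
  obtain ⟨c, l, rfl⟩ := h.eq_of_commute_θ hw
  obtain ⟨c', l', rfl⟩ := h.eq_of_commute_θ he
  have hew := h.inj (of_injective (MulEquiv.refl A)
    (a₁ := ι (inl (gad u c') * x 0 l' * (inl (gad u c) * x 0 l) * (inl (gad u c') * x 0 l')⁻¹))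
    (a₂ := ι (inl (gad u c) * x 0 l)⁻¹) (by simpa only [map_mul, map_inv] using hew))
  have hl : l = 0 := by
    have := congrArg (fun z : Mast Q => z.right.toAdd.2) hew
    simp [x] at this
    omega
  subst hl
  rw [x_zero, mul_one, conj_inl_gad, add_zero, ← map_inv, ← map_inv, ← map_mul, ← map_mul,
    ← map_inv] at hew
  obtain ⟨a, ha⟩ := Gadget.exists_mul_self_eq_w
    (Monoid.CoprodI.of_injective (M := Fac Q) (some u) (inl_injective hew))
  set f : Gadget →* HNNExtension B A A (MulEquiv.refl A) :=
    of.comp (ι.comp (inl.comp (gad u))) with hf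
  have hfc : of (ι (inl (gad u c) * x 0 0)) = f c := by simp [hf]
  rw [hfc] at hv ⊢
  rw [← map_mul, ha]
  by_cases ha0 : a + a = 0
  · simp [ha0]
  have hz : Gadget.w ((a + a) * F) ≠ 1 := fun h => by
    have := Gadget.w_injective (h.trans Gadget.w_zero.symm)
    simp [hF] at this
    omega
  have hvz : Commute v (f (Gadget.w ((a + a) * F))) := by
    have h2 : Gadget.w ((a + a) * F) = (c ^ F) * (c ^ F) := by
      rw [← (Commute.refl c).mul_pow, ha, ← zpow_natCast, Gadget.w_zpow, mul_comm]
    rw [h2, map_mul, map_pow]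
    exact hv.mul_right hv
  have hv1 := conj_of_eq_of_retract (z := ι (inl (gad u (Gadget.w ((a + a) * F)))))
    (z' := ι (inl (gad u (Gadget.w (a + a)))))
    (fun b hb => h.conj_w_mem (Nat.cast_ne_zero.2 hF) hm b hb) hvz
  have hr := congrArg (retract A) hvz.eq
  simp only [hf, map_mul, MonoidHom.comp_apply, retract_of] at hr
  rw [← mul_inv_eq_iff_eq_mul] at hr
  obtain ⟨c'', l'', hc, hcw⟩ := h.eq_of_conj hz hr
  have hcw' : c'' * Gadget.w (a + a) * c''⁻¹ = Gadget.w (a + a) := by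
    rcases Gadget.conj_w_eq_or c'' with h | h
    · exact h _
    · rw [h] at hcw
      have := Gadget.w_injective hcw
      rw [neg_eq_iff_add_eq_zero, ← two_mul] at this
      simp [ha0, hF] at this
  have h4 : f (Gadget.w (a + a)) = v * f (Gadget.w (a + a)) * v⁻¹ := by
    refine Eq.trans ?_ hv1.symm
    rw [hc, ← map_inv, ← map_mul, ← map_mul, conj_inl_gad, add_zero, ← map_inv, ← map_mul,
      ← map_mul, hcw']
    rfl
  exact (eq_mul_inv_iff_mul_eq.1 h4).symm

theorem commute_of_commute_pow_of_involution {F : ℕ} (hF : F ≠ 0)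
    (hm : ∀ u N, m u ∣ N * F → m u ∣ N) {v w e θ : HNNExtension B A A (MulEquiv.refl A)}
    (hθ : θ * θ = 1) (hθ1 : θ ≠ 1) (hw : Commute θ w) (he : Commute θ e)
    (hew : e * w * e⁻¹ = w⁻¹) (hv : Commute v (w ^ F)) : Commute v (w * w) := by
  obtain ⟨d, u, hd⟩ : ∃ d u, d * θ * d⁻¹ = of (ι (inl (gad u Gadget.θ))) := by
    obtain ⟨c₁, b, h1⟩ := HNNExtension.exists_conj_of_mul_self_eq_one hθ
    have hb : b * b = 1 := by
      apply of_injective (MulEquiv.refl A)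
      rw [map_mul, ← h1, map_one]
      calc _ = c₁ * (θ * θ) * c₁⁻¹ := by group
        _ = 1 := by simp [hθ]
    obtain ⟨c₂, y, h2⟩ := h.invol b hb
    have hy : y * y = 1 := by
      apply h.inj
      rw [map_mul, ← h2, map_one]
      calc _ = c₂ * (b * b) * c₂⁻¹ := by group
        _ = 1 := by simp [hb]
    obtain ⟨c₃, u, h3⟩ := Mast.exists_conj_eq_θ hy (by
      rintro rfl
      rw [map_one, mul_inv_eq_one, mul_eq_left] at h2
      rw [h2, map_one, mul_inv_eq_one, mul_eq_left] at h1
      exact hθ1 h1)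
    refine ⟨of (ι c₃ * c₂) * c₁, u, ?_⟩
    rw [← h3, map_mul, map_mul, map_mul, map_mul, map_mul, ← h2, map_mul, map_mul, ← h1]
    simp [mul_assoc]
  have key := h.commute_of_commute_pow hF hm (u := u) (v := MulAut.conj d v) (w := MulAut.conj d w)
    (e := MulAut.conj d e) (by rw [← hd]; exact hw.map (MulAut.conj d))
    (by rw [← hd]; exact he.map (MulAut.conj d))
    (by rw [← map_inv, ← map_inv, ← map_mul, ← map_mul, hew])
    (by rw [← map_pow]; exact hv.map (MulAut.conj d))
  rw [← map_mul] at key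
  have := key.map (MulAut.conj d).symm
  simpa only [MulEquiv.symm_apply_apply] using this

end IsStage

/-- A correspondence between two arithmetic progressions `i + j n` and `i' + j' n` attached to the
states `q` and `q'`. -/
structure Transition (Q : Type) where
  q : Q
  i : ℤ
  j : ℤ
  q' : Q
  i' : ℤ
  j' : ℤ

/-- A set of configurations is compatible with a transition if it is closed under it in both
directions. -/
def Transition.Compatible {Q : Type} (e : Transition Q) (E : Set (Q × ℤ)) : Prop :=
  ∀ n, (e.q, e.i + e.j * n) ∈ E ↔ (e.q', e.i' + e.j' * n) ∈ E

open Classical in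
/-- The exponents of the powers of `w` in the subgroup: `1` on the fibre of `E` over `q₂`, `u + 1`
on the rest of the fibre over `q₁`, and `0` elsewhere. -/
noncomputable def fibreExponent {Q : Type} (E : Set (Q × ℤ)) (q₁ q₂ : Q) (u : ℤ) : ℤ :=
  if (q₂, u) ∈ E then 1 else if (q₁, u) ∈ E then u + 1 else 0

open SemidirectProduct Tower Mast in
theorem exists_isStage_fg {Q : Type} [Finite Q] {E seeds : Set (Q × ℤ)} (q₁ q₂ : Q)
    (L : List (Transition Q)) (hj : ∀ e ∈ L, e.j ≠ 0 ∧ e.j' ≠ 0) (hE : ∀ e ∈ L, e.Compatible E)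
    (hfin : seeds.Finite) (hseeds : seeds ⊆ E)
    (hgen : ∀ X : Set (Q × ℤ), seeds ⊆ X → (∀ e ∈ L, e.Compatible X) → E ⊆ X) :
    ∃ (B : Type) (_ : Group B) (ι : Mast Q →* B) (A : Subgroup B),
      IsStage (core Q) ((sub E (fibreExponent E q₁ q₂)).map inl) ι A ∧
        Group.IsFinitelyPresented B ∧ A.FG := by
  set m := fibreExponent E q₁ q₂ with hm
  have hm₁ : ∀ u, (q₁, u) ∈ E → m u ∣ u + 1 := by
    intro u hu
    by_cases h : (q₂, u) ∈ E <;> simp [hm, fibreExponent, h, hu]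
  have hm₂ : ∀ u, (q₂, u) ∈ E → m u = 1 := by
    intro u hu
    simp [hm, fibreExponent, hu]
  obtain ⟨B, _, ι, A, S, hB, hfp, hS, hA, hr⟩ := exists_isStage (core Q) ((sub E m).map inl)
    ((L.map fun e => (Mast.arm e.q e.i e.j 0 0, Mast.arm e.q' e.i' e.j' 0 0)) ++
      [(Mast.arm q₁ 0 1 0 0, Mast.arm q₁ 0 1 1 1), (Mast.arm q₂ 0 1 0 0, Mast.arm q₂ 0 1 1 0)])
    (by
      intro e he k
      simp only [List.mem_append, List.mem_map, List.mem_cons, List.not_mem_nil, or_false] at he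
      rcases he with ⟨e, he, rfl⟩ | rfl | rfl
      · exact eq_one_of_arm_mem_core (hj e he).1
      · exact eq_one_of_arm_mem_core one_ne_zero
      · exact eq_one_of_arm_mem_core one_ne_zero)
    (by
      intro e he k
      simp only [List.mem_append, List.mem_map, List.mem_cons, List.not_mem_nil, or_false] at he
      rcases he with ⟨e, he, rfl⟩ | rfl | rfl
      · exact eq_one_of_arm_mem_core (hj e he).2
      · exact eq_one_of_arm_mem_core one_ne_zero
      · exact eq_one_of_arm_mem_core one_ne_zero)
    (by
      intro e he k
      simp only [List.mem_append, List.mem_map, List.mem_cons, List.not_mem_nil, or_false] at he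
      rcases he with ⟨e, he, rfl⟩ | rfl | rfl
      · dsimp only
        rw [arm_mem_map_sub_iff (hj e he).1 (by simp), arm_mem_map_sub_iff (hj e he).2 (by simp),
          show {n | (e.q, e.i + e.j * n) ∈ E} = {n | (e.q', e.i' + e.j' * n) ∈ E} from
            Set.ext (hE e he)]
      · dsimp only
        rw [arm_mem_map_sub_iff one_ne_zero (by simp), arm_mem_map_sub_iff one_ne_zero]
        intro n hn
        have := hm₁ _ hn
        simp only [zero_add, one_mul] at this ⊢
        rwa [add_comm]
      · dsimp only
        rw [arm_mem_map_sub_iff one_ne_zero (by simp), arm_mem_map_sub_iff one_ne_zero]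
        intro n hn
        rw [hm₂ _ hn]
        exact one_dvd _)
  refine ⟨B, _, ι, A, hB, hfp, ?_⟩
  set T := Subgroup.closure ((fun p : Q × ℤ => ι (inl (t p.1 p.2))) '' seeds ∪ S) with hT
  have hST : ∀ s ∈ S, s ∈ T := fun s hs => Subgroup.subset_closure (Or.inr hs)
  have key : ∀ {q i j κ l q' i' j' κ' l'}, ((Mast.arm q i j κ l, Mast.arm q' i' j' κ' l') :
      (ShiftGroup →* Mast Q) × (ShiftGroup →* Mast Q)) ∈
      ((L.map fun e => (Mast.arm e.q e.i e.j 0 0, Mast.arm e.q' e.i' e.j' 0 0)) ++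
      [(Mast.arm q₁ 0 1 0 0, Mast.arm q₁ 0 1 1 1), (Mast.arm q₂ 0 1 0 0, Mast.arm q₂ 0 1 1 0)]) →
      ∀ n, (ι (inl (Tower.arm q i j κ l (FreeGroup.of n))) ∈ T ↔
        ι (inl (Tower.arm q' i' j' κ' l' (FreeGroup.of n))) ∈ T) := by
    intro q i j κ l q' i' j' κ' l' he n
    obtain ⟨s, hs, h⟩ := hr _ he
    have := h (inl (FreeGroup.of n))
    rw [arm_inl, arm_inl] at this
    rw [← this]
    rw [Subgroup.mul_mem_cancel_right T (inv_mem (hST s hs)),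
      Subgroup.mul_mem_cancel_left T (hST s hs)]
  have hE' : E ⊆ {p | ι (inl (t p.1 p.2)) ∈ T} := by
    apply hgen
    · exact fun p hp => Subgroup.subset_closure (Or.inl ⟨p, hp, rfl⟩)
    · intro e he n
      simpa [Tower.arm_of] using key (List.mem_append_left _ (List.mem_map_of_mem he)) n
  suffices A = T by
    rw [this, hT, Subgroup.fg_iff]
    exact ⟨_, rfl, (hfin.image _).union hS⟩
  apply le_antisymm
  · rw [hA, Subgroup.closure_le, Set.union_subset_iff]
    refine ⟨?_, hST⟩
    have : sub E m ≤ T.comap (ι.comp inl) := by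
      rw [sub_le]
      refine ⟨fun p hp => hE' hp, fun u => ?_⟩
      by_cases h2 : (q₂, u) ∈ E
      · have h := (key (q := q₂) (List.mem_append_right _
          (List.mem_cons_of_mem _ (List.mem_cons_self ..))) u).1
          (by simpa [Tower.arm_of] using hE' h2)
        simp only [Tower.arm_of, zero_add, one_mul, map_mul, zero_mul, add_zero] at h
        rw [Subgroup.mul_mem_cancel_left T (hE' h2)] at h
        simpa [hm₂ u h2] using h
      · by_cases h1 : (q₁, u) ∈ E
        · have h := (key (q := q₁) (List.mem_append_right _ (List.mem_cons_self ..)) u).1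
            (by simpa [Tower.arm_of] using hE' h1)
          simp only [Tower.arm_of, zero_add, one_mul, map_mul] at h
          rw [Subgroup.mul_mem_cancel_left T (hE' h1)] at h
          simpa [hm, fibreExponent, h1, h2, add_comm] using h
        · simp [hm, fibreExponent, h1, h2]
    rintro _ ⟨_, ⟨τ, hτ, rfl⟩, rfl⟩
    exact this hτ
  · rw [hT, Subgroup.closure_le, Set.union_subset_iff, hA]
    refine ⟨?_, fun s hs => Subgroup.subset_closure (Or.inr hs)⟩
    rintro _ ⟨p, hp, rfl⟩
    exact Subgroup.subset_closure (Or.inl ⟨_, ⟨_, t_mem_sub (hseeds hp), rfl⟩, rfl⟩)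

namespace HNNExtension

variable {G G' : Type*} [Group G] [Group G'] {A : Subgroup G} {A' : Subgroup G'}

/-- The functoriality of HNN extensions with trivial twist. -/
noncomputable def map (f : G →* G') (h : ∀ g, f g ∈ A' ↔ g ∈ A) :
    HNNExtension G A A (MulEquiv.refl A) →* HNNExtension G' A' A' (MulEquiv.refl A') :=
  lift (of.comp f) t fun a => t_mul_of (φ := MulEquiv.refl A') ⟨f a, (h a).2 a.2⟩

variable {f : G →* G'} {h : ∀ g, f g ∈ A' ↔ g ∈ A}

@[simp] theorem map_of (g : G) : map f h (of g) = of (f g) := lift_of ..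

@[simp] theorem map_t : map f h t = t := lift_t ..

theorem len_map (g : HNNExtension G A A (MulEquiv.refl A)) : len (map f h g) = len g := by
  induction hn : len g using Nat.strong_induction_on generalizing g with
  | _ n ih =>
  by_cases h0 : len g = 0
  · obtain ⟨k, rfl⟩ := len_eq_zero_iff.1 h0
    rw [map_of, len_of, ← hn, len_of]
  obtain ⟨v, c, hl⟩ := exists_len_t_mul h0
  set g₁ := t ^ (v : ℤ) * (of c * g) with hg₁
  have h1 := ih _ (by omega) g₁ rfl
  have hg : of c * g = t ^ ((-v : ℤˣ) : ℤ) * g₁ := by simp [hg₁]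
  have h2 : len (map f h g) = len (t ^ ((-v : ℤˣ) : ℤ) * map f h g₁) := by
    rw [← len_of_mul (f c), ← map_of (f := f) (h := h), ← map_mul, hg, map_mul, map_zpow, map_t]
  rcases len_t_mul (-v) (map f h g₁) with h3 | h3
  · omega
  exfalso
  obtain ⟨v', c', hl'⟩ := exists_len_t_mul (g := g₁) (by omega)
  have h4 : len (t ^ (v' : ℤ) * (of (f c') * map f h g₁)) < len (map f h g₁) := by
    have := ih _ (by omega) (t ^ (v' : ℤ) * (of c' * g₁)) rfl
    rw [map_mul, map_mul, map_zpow, map_t, map_of] at this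
    omega
  obtain ⟨rfl, hc⟩ := eq_of_len_t_mul_lt (u := -v) (by omega) h4
  rw [mem_toSubgroup_self, h] at hc
  rw [← mul_assoc, (t_zpow_commute hc _).eq, mul_assoc, len_of_mul, ← hg, len_of_mul] at hl'
  omega

theorem map_injective (hf : Function.Injective f) : Function.Injective (map f h) := by
  rw [injective_iff_map_eq_one]
  intro g hg
  have h0 := len_map (h := h) g
  rw [hg, ← map_one of, len_of] at h0
  obtain ⟨k, rfl⟩ := len_eq_zero_iff.1 h0.symm
  rw [map_of, ← map_one of] at hg
  rw [hf ((of_injective _ hg).trans (map_one f).symm), map_one]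

end HNNExtension

/-- The word `v w ^ F v⁻¹ w ^ (-F)` in the generators `v`, `w`, `e`, `θ`. -/
def powerCommutator (F : ℕ) : Word 4 :=
  (0, true) :: (List.replicate F (1, true) ++ (0, false) :: List.replicate F (1, false))

/-- The relators `e w e⁻¹ w`, `θ²`, `[θ, w]`, `[θ, e]`, `[v, w ^ F]`. -/
def guestRelators (F : ℕ) : List (Word 4) :=
  [[(2, true), (1, true), (2, false), (1, true)], [(3, true), (3, true)],
    [(3, true), (1, true), (3, false), (1, false)], [(3, true), (2, true), (3, false), (2, false)],
    powerCommutator F]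

/-- The finite presentation with generators `v`, `w`, `e`, `θ` and relators `guestRelators F`. -/
def guestPres (F : ℕ) : FinPres := ⟨4, guestRelators F⟩

theorem FreeGroup.mk_replicate {α : Type*} (a : α) (b : Bool) (n : ℕ) :
    FreeGroup.mk (List.replicate n (a, b)) = FreeGroup.mk [(a, b)] ^ n := by
  induction n with
  | zero => rfl
  | succ n ih => rw [pow_succ', ← ih, FreeGroup.mul_mk]; rfl

theorem FreeGroup.lift_mk_cons {α G : Type*} [Group G] (f : α → G) (a : α) (b : Bool)
    (l : List (α × Bool)) : FreeGroup.lift f (FreeGroup.mk ((a, b) :: l)) =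
      (if b then f a else (f a)⁻¹) * FreeGroup.lift f (FreeGroup.mk l) := by
  cases b <;> simp

theorem lift_powerCommutator {G : Type*} [Group G] (f : Fin 4 → G) (F : ℕ) :
    FreeGroup.lift f (FreeGroup.mk (powerCommutator F)) =
      f 0 * f 1 ^ F * (f 0)⁻¹ * (f 1 ^ F)⁻¹ := by
  rw [powerCommutator, FreeGroup.lift_mk_cons, ← FreeGroup.mul_mk, map_mul,
    FreeGroup.mk_replicate, FreeGroup.lift_mk_cons, FreeGroup.mk_replicate]
  simp [FreeGroup.lift_mk, mul_assoc]

namespace GuestPres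

variable {F : ℕ} {G : Type*} [Group G]

/-- The generators of the guest group. -/
def gen (F : ℕ) (i : Fin 4) : (guestPres F).Grp := PresentedGroup.of i

theorem lift_rels_iff (f : Fin 4 → G) :
    (∀ r ∈ (guestPres F).rels, FreeGroup.lift f r = 1) ↔
      f 2 * f 1 * (f 2)⁻¹ = (f 1)⁻¹ ∧ f 3 * f 3 = 1 ∧ Commute (f 3) (f 1) ∧ Commute (f 3) (f 2) ∧
        Commute (f 0) (f 1 ^ F) := by
  have : ∀ x y : G, Commute x y ↔ x * y * x⁻¹ * y⁻¹ = 1 := fun x y => by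
    rw [mul_inv_eq_one, mul_inv_eq_iff_eq_mul]; rfl
  have h : (∀ r ∈ (guestPres F).rels, FreeGroup.lift f r = 1) ↔
      ∀ l ∈ guestRelators F, FreeGroup.lift f (FreeGroup.mk l) = 1 :=
    ⟨fun h l hl => h _ ⟨l, hl, rfl⟩, by rintro h _ ⟨l, hl, rfl⟩; exact h l hl⟩
  rw [h]
  simp only [this, guestRelators, List.forall_mem_cons, lift_powerCommutator, FreeGroup.lift_mk_cons]
  simp [mul_assoc, eq_inv_iff_mul_eq_one, ← FreeGroup.one_eq_mk]

theorem relations (F : ℕ) : gen F 2 * gen F 1 * (gen F 2)⁻¹ = (gen F 1)⁻¹ ∧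
    gen F 3 * gen F 3 = 1 ∧ Commute (gen F 3) (gen F 1) ∧ Commute (gen F 3) (gen F 2) ∧
      Commute (gen F 0) (gen F 1 ^ F) := by
  rw [← lift_rels_iff]
  intro r hr
  have : FreeGroup.lift (gen F) = PresentedGroup.mk (guestPres F).rels := by
    apply FreeGroup.ext_hom
    intro i
    exact FreeGroup.lift_apply_of
  rw [this]
  exact PresentedGroup.one_of_mem hr

/-- The homomorphism from the guest group determined by elements satisfying its relations. -/
def lift (v w e θ : G) (h₁ : e * w * e⁻¹ = w⁻¹) (h₂ : θ * θ = 1) (h₃ : Commute θ w)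
    (h₄ : Commute θ e) (h₅ : Commute v (w ^ F)) : (guestPres F).Grp →* G :=
  PresentedGroup.toGroup (f := ![v, w, e, θ]) ((lift_rels_iff _).2 ⟨h₁, h₂, h₃, h₄, h₅⟩)

variable {v w e θ : G} {h₁ : e * w * e⁻¹ = w⁻¹} {h₂ : θ * θ = 1} {h₃ : Commute θ w}
  {h₄ : Commute θ e} {h₅ : Commute v (w ^ F)}

@[simp] theorem lift_gen_zero : lift v w e θ h₁ h₂ h₃ h₄ h₅ (gen F 0) = v :=
  PresentedGroup.toGroup.of _

@[simp] theorem lift_gen_one : lift v w e θ h₁ h₂ h₃ h₄ h₅ (gen F 1) = w :=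
  PresentedGroup.toGroup.of _

@[simp] theorem lift_gen_two : lift v w e θ h₁ h₂ h₃ h₄ h₅ (gen F 2) = e :=
  PresentedGroup.toGroup.of _

@[simp] theorem lift_gen_three : lift v w e θ h₁ h₂ h₃ h₄ h₅ (gen F 3) = θ :=
  PresentedGroup.toGroup.of _

theorem hom_ext {f g : (guestPres F).Grp →* G} (h₀ : f (gen F 0) = g (gen F 0))
    (h₁ : f (gen F 1) = g (gen F 1)) (h₂ : f (gen F 2) = g (gen F 2))
    (h₃ : f (gen F 3) = g (gen F 3)) : f = g := by
  have h : ∀ i : Fin 4, f (gen F i) = g (gen F i)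
    | 0 => h₀
    | 1 => h₁
    | 2 => h₂
    | 3 => h₃
  exact PresentedGroup.ext h

end GuestPres

namespace GuestPres

open HNNExtension (of t t_mul_of map_injective)
open SemidirectProduct (inl inl_injective)
open Tower (gad sub gad_mem_sub)
open Mast (core inl_mem_map)

variable {F : ℕ}

/-- The guest group as an HNN extension of a gadget. -/
noncomputable def toHNN (F : ℕ) : (guestPres F).Grp →* HNNExtension Gadget
    (Subgroup.zpowers (Gadget.w F)) (Subgroup.zpowers (Gadget.w F)) (MulEquiv.refl _) :=
  lift t (of (Gadget.w 1)) (of Gadget.e) (of Gadget.θ)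
    (by simp only [← map_mul, ← map_inv, Gadget.e_conj_w])
    (by rw [← map_mul, Gadget.θ_mul_θ, map_one]) ((Gadget.θ_commute _).map of)
    ((Gadget.θ_commute _).map of) (by
      rw [← map_pow, ← zpow_natCast, Gadget.w_one_zpow]
      exact t_mul_of (φ := MulEquiv.refl (Subgroup.zpowers (Gadget.w F)))
        ⟨_, Subgroup.mem_zpowers _⟩)

theorem toHNN_injective (F : ℕ) : Function.Injective (toHNN F) := by
  obtain ⟨h1, h2, h3, h4, h5⟩ := relations F
  set f := HNNExtension.lift (φ := MulEquiv.refl (Subgroup.zpowers (Gadget.w F)))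
    (Gadget.lift _ _ _ h1 h2 h3 h4) (gen F 0) (by
      rintro ⟨_, k, rfl⟩
      simp only [Gadget.w_zpow, MulEquiv.coe_refl, id_eq, Gadget.lift_w]
      have := h5.zpow_right k
      rw [← zpow_natCast, ← zpow_mul, mul_comm] at this
      exact this)
  have : f.comp (toHNN F) = MonoidHom.id _ := by
    apply hom_ext <;> simp [f, toHNN]
  exact Function.LeftInverse.injective (g := f) (DFunLike.congr_fun this)

variable {Q : Type} {E : Set (Q × ℤ)} {m : ℤ → ℤ} {B : Type*} [Group B] {ι : Mast Q →* B}
  {A : Subgroup B}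

theorem exists_injective (h : IsStage (core Q) ((sub E m).map inl) ι A) {u : ℤ} (hu : m u = F) :
    ∃ f : (guestPres F).Grp →* HNNExtension B A A (MulEquiv.refl A), Function.Injective f := by
  have hA : ∀ g, (ι.comp (inl.comp (gad u))) g ∈ A ↔ g ∈ Subgroup.zpowers (Gadget.w F) := by
    intro g
    rw [MonoidHom.comp_apply, h.mem, MonoidHom.comp_apply, inl_mem_map, gad_mem_sub, hu]
  refine ⟨(HNNExtension.map _ hA).comp (toHNN F),
    (map_injective (h := hA) ?_).comp (toHNN_injective F)⟩
  exact h.inj.comp (inl_injective.comp (Monoid.CoprodI.of_injective (M := Fac Q) (some u)))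

theorem gen_three_ne_one : gen F 3 ≠ 1 := by
  intro h
  have := congrArg (lift (F := F) 1 1 1 (Multiplicative.ofAdd (1 : ZMod 2)) (by simp) (by rfl)
    (by simp) (by simp) (by simp)) h
  simp at this

theorem not_commute (hF : 3 ≤ F) (hodd : Odd F) : ¬ Commute (gen F 0) (gen F 1 * gen F 1) := by
  intro h
  have h1 : DihedralGroup.sr (0 : ZMod F) * DihedralGroup.r 1 * (DihedralGroup.sr 0)⁻¹ =
      (DihedralGroup.r 1)⁻¹ := by simp
  have h2 : Commute (DihedralGroup.sr (0 : ZMod F)) (DihedralGroup.r 1 ^ F) := by simp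
  have := h.map (lift (F := F) (DihedralGroup.sr (0 : ZMod F)) (DihedralGroup.r 1)
    (DihedralGroup.sr 0) 1 h1 (one_mul 1) (Commute.one_left _) (Commute.one_left _) h2)
  have h4 : ((4 : ℕ) : ZMod F) = 0 := by
    have := this.eq
    simp only [map_mul, lift_gen_zero, lift_gen_one, DihedralGroup.r_mul_r,
      DihedralGroup.sr_mul_r, DihedralGroup.r_mul_sr, DihedralGroup.sr.injEq] at this
    push_cast
    linear_combination this
  have h4 := (ZMod.natCast_eq_zero_iff _ _).1 h4
  have : F ≤ 4 := Nat.le_of_dvd (by norm_num) h4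
  interval_cases F
  · omega
  · exact absurd hodd (by decide)

theorem not_exists_injective (h : IsStage (core Q) ((sub E m).map inl) ι A) (hF : 3 ≤ F)
    (hodd : Odd F) (hm : ∀ u N, m u ∣ N * F → m u ∣ N) :
    ¬ ∃ f : (guestPres F).Grp →* HNNExtension B A A (MulEquiv.refl A), Function.Injective f := by
  rintro ⟨f, hf⟩
  obtain ⟨h1, h2, h3, h4, h5⟩ := relations F
  apply not_commute hF hodd
  apply hf
  have := h.commute_of_commute_pow_of_involution (F := F) (by omega) hm (v := f (gen F 0))
    (w := f (gen F 1)) (e := f (gen F 2)) (θ := f (gen F 3))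
    (by rw [← map_mul, h2, map_one]) (by rw [← map_one f]; exact hf.ne gen_three_ne_one)
    (h3.map f) (h4.map f) (by simp only [← map_mul, ← map_inv, h1])
    (by rw [← map_pow]; exact h5.map f)
  simpa only [map_mul] using this.eq

end GuestPres

/-- Programs for counter machines. The program `loop r p` executes `p` as long as the register `r`
is not zero, decreasing `r` before each execution. -/
inductive Prog where
  | skip : Prog
  | inc : ℕ → Prog
  | seq : Prog → Prog → Prog
  | loop : ℕ → Prog → Prog

namespace Prog

open Finsupp (single)

/-- The big-step semantics of programs. -/
inductive Eval : Prog → (ℕ →₀ ℕ) → (ℕ →₀ ℕ) → Prop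
  | skip (σ) : Eval skip σ σ
  | inc (r σ) : Eval (inc r) σ (σ + single r 1)
  | seq {p q σ σ' σ''} : Eval p σ σ' → Eval q σ' σ'' → Eval (seq p q) σ σ''
  | loop_zero {r p σ} : σ r = 0 → Eval (loop r p) σ σ
  | loop_succ {r p σ σ' σ''} : Eval p σ σ' → Eval (loop r p) σ' σ'' →
      Eval (loop r p) (σ + single r 1) σ''

theorem Eval.loop_iterate {r : ℕ} {p : Prog} (S : ℕ → ℕ →₀ ℕ)
    (h : ∀ k j, Eval p (S k + single r j) (S (k + 1) + single r j)) (n : ℕ) (h0 : S n r = 0) :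
    Eval (loop r p) (S 0 + single r n) (S n) := by
  suffices ∀ j k, k + j = n → Eval (loop r p) (S k + single r j) (S n) from this n 0 (zero_add n)
  intro j
  induction j with
  | zero =>
    rintro k rfl
    simpa using Eval.loop_zero (p := p) h0
  | succ j ih =>
    intro k hk
    rw [Finsupp.single_add, ← add_assoc]
    exact .loop_succ (h k j) (ih (k + 1) (by omega))

/-- The program setting a register to zero. -/
def clear (r : ℕ) : Prog := loop r skip

theorem eval_clear {r : ℕ} {σ : ℕ →₀ ℕ} (h : σ r = 0) (n : ℕ) :
    Eval (clear r) (σ + single r n) σ :=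
  Eval.loop_iterate (r := r) (p := skip) (fun _ => σ) (fun _ _ => .skip _) n h

/-- The program setting all registers in a list to zero. -/
def clears : List ℕ → Prog
  | [] => skip
  | r :: l => seq (clear r) (clears l)

theorem eval_clears (l : List ℕ) (σ : ℕ →₀ ℕ) :
    ∃ τ, Eval (clears l) σ τ ∧ ∀ r, τ r = if r ∈ l then 0 else σ r := by
  induction l generalizing σ with
  | nil => exact ⟨σ, .skip σ, by simp⟩
  | cons s l ih =>
    obtain ⟨τ, h1, h2⟩ := ih (σ.erase s)
    refine ⟨τ, .seq ?_ h1, fun r => ?_⟩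
    · simpa [Finsupp.erase_add_single] using eval_clear (Finsupp.erase_same (a := s) (f := σ)) (σ s)
    rw [h2]
    by_cases hr : r = s
    · simp [hr]
    · simp [hr, Finsupp.erase_ne hr]

/-- The program adding the register `r` to the register `s` and setting `r` to zero. -/
def move (r s : ℕ) : Prog := loop r (inc s)

theorem eval_move {r s : ℕ} (hrs : r ≠ s) {σ : ℕ →₀ ℕ} (h : σ r = 0) (n : ℕ) :
    Eval (move r s) (σ + single r n) (σ + single s n) := by
  have := Eval.loop_iterate (r := r) (p := inc s) (fun k => σ + single s k) (fun k j => by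
    have := Eval.inc s (σ + single s k + single r j)
    convert this using 1
    rw [Finsupp.single_add]
    abel) n (by simp [h, hrs.symm])
  rw [move]
  simpa using this

/-- The program adding the register `r` to the register `s` with the help of the register `t`. -/
def copy (r s t : ℕ) : Prog := seq (loop r (seq (inc s) (inc t))) (move t r)

theorem eval_copy {r s t : ℕ} (hrs : r ≠ s) (hrt : r ≠ t) (hst : s ≠ t) {σ : ℕ →₀ ℕ}
    (h : σ t = 0) : Eval (copy r s t) σ (σ + single s (σ r)) := by
  have h1 := Eval.loop_iterate (r := r) (p := seq (inc s) (inc t))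
    (fun k => σ.erase r + single s k + single t k) (fun k j => by
      have := Eval.seq (Eval.inc s (σ.erase r + single s k + single t k + single r j))
        (Eval.inc t _)
      convert this using 1
      rw [Finsupp.single_add, Finsupp.single_add]
      abel) (σ r) (by simp [hrs.symm, hrt.symm])
  have h2 := eval_move hrt.symm (σ := σ.erase r + single s (σ r))
    (by simp [h, hst, Finsupp.erase_ne hrt.symm]) (σ r)
  have h3 := Eval.seq h1 h2
  simp only [Finsupp.single_zero, add_zero, Finsupp.erase_add_single] at h3
  have h4 : σ + single s (σ r) = σ.erase r + single s (σ r) + single r (σ r) := by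
    conv_lhs => rw [← Finsupp.erase_add_single r σ]
    simp only [Finsupp.add_apply, Finsupp.erase_same, Finsupp.single_eq_same, zero_add]
    abel
  rw [h4]
  exact h3

/-- A program computes a function if it adds its value at the arguments stored in the registers
`ins` to the register `out`, provided that the scratch registers between `b` and `B` are zero. -/
def Computes (p : Prog) {n : ℕ} (ins : Fin n → ℕ) (out b B : ℕ) (f : List.Vector ℕ n → ℕ) : Prop :=
  ∀ (σ : ℕ →₀ ℕ) (v : List.Vector ℕ n), (∀ i, σ (ins i) = v.get i) →
    (∀ r, b ≤ r → r < B → σ r = 0) → Eval p σ (σ + single out (f v))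

theorem Computes.mono {p : Prog} {n : ℕ} {ins : Fin n → ℕ} {out b B B' : ℕ}
    {f : List.Vector ℕ n → ℕ} (h : Computes p ins out b B f) (hB : B ≤ B') :
    Computes p ins out b B' f :=
  fun σ v h1 h2 => h σ v h1 fun r hr hr' => h2 r hr (by omega)

theorem exists_eval_sum {m n : ℕ} {ins : Fin m → ℕ} {b B : ℕ} (hins : ∀ i, ins i < b)
    {g : Fin n → List.Vector ℕ m → ℕ} {p : Fin n → Prog}
    (hp : ∀ i, Computes (p i) ins (b + i) (b + n) B (g i)) (l : List (Fin n)) :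
    ∃ P, ∀ (σ : ℕ →₀ ℕ) (v : List.Vector ℕ m), (∀ i, σ (ins i) = v.get i) →
      (∀ r, b + n ≤ r → r < B → σ r = 0) →
      Eval P σ (σ + (l.map fun i : Fin n => single (b + i : ℕ) (g i v)).sum) := by
  induction l with
  | nil => exact ⟨skip, fun σ v _ _ => by simpa using .skip σ⟩
  | cons i l ih =>
    obtain ⟨P, hP⟩ := ih
    refine ⟨seq (p i) P, fun σ v h1 h2 => .seq (hp i σ v h1 h2) ?_⟩
    rw [List.map_cons, List.sum_cons, ← add_assoc]
    refine hP _ v (fun j => ?_) fun r hr hr' => ?_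
    · have := hins j
      rw [Finsupp.add_apply, Finsupp.single_eq_of_ne (by omega), h1, add_zero]
    · have := i.isLt
      rw [Finsupp.add_apply, Finsupp.single_eq_of_ne (by omega), h2 r hr hr', add_zero]

theorem sum_single_apply {n b : ℕ} (w : Fin n → ℕ) (i : Fin n) :
    (∑ i : Fin n, single (b + i : ℕ) (w i)) (b + i : ℕ) = w i := by
  rw [Finsupp.finsetSum_apply, Finset.sum_eq_single i, Finsupp.single_eq_same]
  · intro j _ hj
    exact Finsupp.single_eq_of_ne (by simpa [Fin.ext_iff] using hj.symm)
  · simp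

theorem sum_single_apply_of_notMem {n b r : ℕ} (w : Fin n → ℕ) (hr : r < b ∨ b + n ≤ r) :
    (∑ i : Fin n, single (b + i : ℕ) (w i)) r = 0 := by
  rw [Finsupp.finsetSum_apply]
  exact Finset.sum_eq_zero fun i _ => Finsupp.single_eq_of_ne (by omega)

theorem exists_computes_comp {m n : ℕ} {ins : Fin m → ℕ} {out b B : ℕ} (hins : ∀ i, ins i < b)
    (hout : out < b) {f : List.Vector ℕ n → ℕ}
    {g : Fin n → List.Vector ℕ m → ℕ} {p : Fin n → Prog} {q : Prog} (hB : b + n ≤ B)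
    (hp : ∀ i, Computes (p i) ins (b + i) (b + n) B (g i))
    (hq : Computes q (fun i : Fin n => b + i) out (b + n) B f) :
    ∃ P, Computes P ins out b B fun a => f (List.Vector.ofFn fun i => g i a) := by
  obtain ⟨P, hP⟩ := exists_eval_sum hins hp (List.finRange n)
  refine ⟨seq P (seq q (clears (List.range' b n))), fun σ v h1 h2 => ?_⟩
  have h3 := hP σ v h1 fun r hr hr' => h2 r (by omega) hr'
  rw [← Fin.sum_univ_def] at h3
  refine .seq h3 (.seq (hq _ (List.Vector.ofFn fun i => g i v) (fun i => ?_) fun r hr hr' => ?_) ?_)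
  · beta_reduce
    have := i.isLt
    rw [Finsupp.add_apply, sum_single_apply (fun i => g i v), h2 _ (by omega) (by omega)]
    simp
  · rw [Finsupp.add_apply, sum_single_apply_of_notMem _ (.inr hr), h2 r (by omega) hr', add_zero]
  · obtain ⟨τ, h4, h5⟩ := eval_clears (List.range' b n)
      (σ + ∑ i : Fin n, single (b + i : ℕ) (g i v) +
        single out (f (List.Vector.ofFn fun i => g i v)))
    convert h4 using 1
    ext r
    rw [h5]
    split_ifs with h6
    · rw [List.mem_range'_1] at h6
      rw [Finsupp.add_apply, h2 r h6.1 (by omega), Finsupp.single_eq_of_ne (by omega), add_zero]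
    · rw [List.mem_range'_1] at h6
      simp only [Finsupp.add_apply]
      rw [sum_single_apply_of_notMem _ (by omega), add_zero]

theorem computes_prec {n : ℕ} {ins : Fin (n + 1) → ℕ} {out b B : ℕ} (hins : ∀ i, ins i < b)
    (hout : out < b) {f : List.Vector ℕ n → ℕ}
    {g : List.Vector ℕ (n + 2) → ℕ} {p q : Prog} (hB : b + 4 ≤ B)
    (hp : Computes p (fun i => ins i.succ) (b + 2) (b + 4) B f)
    (hq : Computes q (Fin.cons (b + 1) (Fin.cons (b + 2) fun i => ins i.succ)) (b + 3) (b + 4) B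
      g) :
    Computes (seq (copy (ins 0) b (b + 3)) (seq p (seq (loop b (seq q (seq (clear (b + 2))
      (seq (move (b + 3) (b + 2)) (inc (b + 1)))))) (seq (clear (b + 1)) (move (b + 2) out)))))
      ins out b B fun v => v.head.rec (f v.tail) fun y IH => g (y ::ᵥ IH ::ᵥ v.tail) := by
  intro σ v h1 h2
  have hi := hins 0
  have hs (i : Fin n) := hins i.succ
  have hv (i : Fin n) : σ (ins i.succ) = v.tail.get i := by rw [h1, List.Vector.get_tail_succ]
  have h0 (r : ℕ) (h : b ≤ r) (h' : r < b + 4) : σ r = 0 := h2 r h (by omega)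
  set F : ℕ → ℕ := fun k => k.rec (f v.tail) fun y IH => g (y ::ᵥ IH ::ᵥ v.tail) with hF
  have e1 := eval_copy (r := ins 0) (s := b) (t := b + 3) (by omega) (by omega) (by omega)
    (h0 (b + 3) (by omega) (by omega))
  have e2 := hp (σ + single b (σ (ins 0))) v.tail (fun i => by
    have := hs i
    beta_reduce
    rw [Finsupp.add_apply, Finsupp.single_eq_of_ne (by omega), hv, add_zero]) fun r hr hr' => by
    rw [Finsupp.add_apply, Finsupp.single_eq_of_ne (by omega), h2 r (by omega) hr', add_zero]
  have e3 := Eval.loop_iterate (r := b) (fun k => σ + single (b + 1) k + single (b + 2) (F k))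
    (p := seq q (seq (clear (b + 2)) (seq (move (b + 3) (b + 2)) (inc (b + 1)))))
    (fun k j => by
      refine .seq (hq _ (k ::ᵥ F k ::ᵥ v.tail) (fun i => ?_) fun r hr hr' => ?_)
        (.seq (σ' := σ + single (b + 1) k + single b j + single (b + 3) (F (k + 1))) ?_
          (.seq (σ' := σ + single (b + 1) k + single b j + single (b + 2) (F (k + 1))) ?_ ?_))
      · refine Fin.cases ?_ (fun i => Fin.cases ?_ (fun i => ?_) i) i
        · simp [h0 (b + 1)]
        · simp [h0 (b + 2)]
          rfl
        · have := hs i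
          simp only [Fin.cons_succ, Finsupp.add_apply, List.Vector.get_cons_succ]
          rw [Finsupp.single_eq_of_ne (by omega), Finsupp.single_eq_of_ne (by omega),
            Finsupp.single_eq_of_ne (by omega), hv]
          rfl
      · simp only [Finsupp.add_apply]
        rw [Finsupp.single_eq_of_ne (by omega), Finsupp.single_eq_of_ne (by omega),
            Finsupp.single_eq_of_ne (by omega), h2 r (by omega) hr']
        rfl
      · convert eval_clear (σ := σ + single (b + 1) k + single b j +
          single (b + 3) (F (k + 1))) (r := b + 2) ?_ (F k) using 1
        · abel
        · simp [h0 (b + 2)]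
      · exact eval_move (by omega) (by simp [h0 (b + 3)]) _
      · convert Eval.inc (b + 1) _ using 1
        rw [Finsupp.single_add]
        abel) (σ (ins 0)) (by simp [h0 b])
  refine .seq e1 (.seq e2 (.seq (σ' := σ + single (b + 1) (σ (ins 0)) +
    single (b + 2) (F (σ (ins 0)))) ?_ (.seq (σ' := σ + single (b + 2) (F (σ (ins 0)))) ?_ ?_)))
  · convert e3 using 1
    simp only [Finsupp.single_zero, add_zero]
    exact add_right_comm _ _ _
  · convert eval_clear (σ := σ + single (b + 2) (F (σ (ins 0)))) (r := b + 1) ?_ (σ (ins 0))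
      using 1
    · exact add_right_comm _ _ _
    · simp [h0 (b + 1)]
  · rw [h1 0, List.Vector.get_zero]
    exact eval_move (by omega) (h0 _ (by omega) (by omega)) _

theorem exists_computes {n : ℕ} {f : List.Vector ℕ n → ℕ} (hf : Nat.Primrec' f)
    (ins : Fin n → ℕ) (out b : ℕ) (hins : ∀ i, ins i < b) (hout : out < b)
    (hne : ∀ i, out ≠ ins i) : ∃ p B, Computes p ins out b B f := by
  induction hf generalizing out b with
  | zero => exact ⟨skip, b, fun σ v _ _ => by simpa using .skip σ⟩
  | succ =>
    refine ⟨seq (copy (ins 0) out b) (inc out), b + 1, fun σ v h1 h2 => ?_⟩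
    have := hins 0
    beta_reduce
    rw [Nat.succ_eq_add_one, Finsupp.single_add, ← add_assoc, ← List.Vector.get_zero, ← h1 0]
    exact .seq (eval_copy (hne 0).symm (by omega) (by omega) (h2 b le_rfl (by omega))) (.inc _ _)
  | get i =>
    refine ⟨copy (ins i) out b, b + 1, fun σ v h1 h2 => ?_⟩
    have := hins i
    beta_reduce
    rw [← h1 i]
    exact eval_copy (hne i).symm (by omega) (by omega) (h2 b le_rfl (by omega))
  | @comp m n f g _ _ ihf ihg =>
    obtain ⟨q, B₀, hq⟩ := ihf (fun i : Fin _ => b + i) out (b + n) (by simp) (by omega)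
      (fun i => by omega)
    choose p C hp using fun i => ihg i ins (b + i) (b + n) (fun j => by have := hins j; omega)
      (by simp) (fun j => by have := hins j; omega)
    obtain ⟨P, hP⟩ := exists_computes_comp (B := b + n + B₀ + ∑ i, C i) hins hout (by omega)
      (fun i => (hp i).mono ((Finset.single_le_sum (f := C) (by simp) (Finset.mem_univ i)).trans
        (by omega))) (hq.mono (by omega))
    exact ⟨P, _, hP⟩
  | @prec n f g _ _ ihf ihg =>
    have hs (i : Fin n) := hins i.succ
    obtain ⟨p, B₁, hp⟩ := ihf (fun i => ins i.succ) (b + 2) (b + 4)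
      (fun i => by have := hs i; omega) (by omega) (fun i => by have := hs i; omega)
    obtain ⟨q, B₂, hq⟩ := ihg (Fin.cons (b + 1) (Fin.cons (b + 2) fun i => ins i.succ)) (b + 3)
      (b + 4) (fun i => by
        refine Fin.cases ?_ (fun i => Fin.cases ?_ (fun i => ?_) i) i
        · simp
        · simp
        · have := hs i
          simp only [Fin.cons_succ]
          omega) (by omega) (fun i => by
        refine Fin.cases ?_ (fun i => Fin.cases ?_ (fun i => ?_) i) i
        · simp
        · simp
        · have := hs i
          simp only [Fin.cons_succ]
          omega)
    exact ⟨_, b + 4 + B₁ + B₂, computes_prec hins hout (by omega) (hp.mono (by omega))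
      (hq.mono (by omega))⟩

end Prog

namespace Transition

variable {Q Q' : Type}

/-- The image of a transition under a map of states. -/
def map (f : Q → Q') (e : Transition Q) : Transition Q' := ⟨f e.q, e.i, e.j, f e.q', e.i', e.j'⟩

/-- The directed graph of configurations defined by a list of transitions. -/
def Step (L : List (Transition Q)) (a b : Q × ℤ) : Prop :=
  ∃ e ∈ L, ∃ n, a = (e.q, e.i + e.j * n) ∧ b = (e.q', e.i' + e.j' * n)

theorem step_append {L L' : List (Transition Q)} {a b : Q × ℤ} :
    Step (L ++ L') a b ↔ Step L a b ∨ Step L' a b := by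
  simp only [Step, List.mem_append, or_and_right, exists_or]

theorem step_cons {e : Transition Q} {L : List (Transition Q)} {a b : Q × ℤ} :
    Step (e :: L) a b ↔
      (∃ n, a = (e.q, e.i + e.j * n) ∧ b = (e.q', e.i' + e.j' * n)) ∨ Step L a b := by
  simp only [Step, List.mem_cons, or_and_right, exists_or, exists_eq_left]

theorem step_map {f : Q → Q'} {L : List (Transition Q)} {a b : Q' × ℤ} :
    Step (L.map (map f)) a b ↔
      ∃ a' b', Step L a' b' ∧ a = Prod.map f id a' ∧ b = Prod.map f id b' := by
  constructor
  · rintro ⟨e', he', n, rfl, rfl⟩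
    obtain ⟨e, he, rfl⟩ := List.mem_map.1 he'
    exact ⟨_, _, ⟨e, he, n, rfl, rfl⟩, rfl, rfl⟩
  · rintro ⟨_, _, ⟨e, he, n, rfl, rfl⟩, rfl, rfl⟩
    exact ⟨_, List.mem_map_of_mem he, n, rfl, rfl⟩

end Transition

namespace Prog

open Finsupp (single)
open Relation (ReflTransGen)
open Transition (Step)

/-- The control states of a program. The exit state is added separately. -/
def State : Prog → Type
  | skip => Unit
  | inc _ => Unit
  | seq p q => State p ⊕ State q
  | loop _ p => Option (State p)

instance : (p : Prog) → Finite (State p)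
  | skip => inferInstanceAs (Finite Unit)
  | inc _ => inferInstanceAs (Finite Unit)
  | seq p q =>
    have := instFiniteState p
    have := instFiniteState q
    inferInstanceAs (Finite (State p ⊕ State q))
  | loop _ p =>
    have := instFiniteState p
    inferInstanceAs (Finite (Option (State p)))

/-- The initial state of a program. -/
def entry : (p : Prog) → State p
  | skip => ()
  | inc _ => ()
  | seq p _ => Sum.inl (entry p)
  | loop _ _ => none

/-- The states of the first part of a composite program, its exit being the entry of the second
part. -/
def seqLeft (p q : Prog) : Option (State p) → Option (State (seq p q))
  | none => some (Sum.inr (entry q))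
  | some s => some (Sum.inl s)

/-- The states of the second part of a composite program. -/
def seqRight (p q : Prog) : Option (State q) → Option (State (seq p q)) :=
  Option.map Sum.inr

/-- The states of the body of a loop, its exit being the entry of the loop. -/
def loopBody (r : ℕ) (p : Prog) : Option (State p) → Option (State (loop r p)) := some

/-- The prime number attached to a register. -/
noncomputable def base (r : ℕ) : ℕ := Nat.nth Nat.Prime r

theorem prime_base (r : ℕ) : (base r).Prime := Nat.prime_nth_prime r

theorem base_pos (r : ℕ) : (0 : ℤ) < base r := by exact_mod_cast (prime_base r).pos

/-- The flow chart of a program, the memory being encoded by a single integer. -/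
noncomputable def transitions : (p : Prog) → List (Transition (Option (State p)))
  | skip => [⟨some (), 0, 1, none, 0, 1⟩]
  | inc r => [⟨some (), 0, 1, none, 0, base r⟩]
  | seq p q => (transitions p).map (.map (seqLeft p q)) ++ (transitions q).map (.map (seqRight p q))
  | loop r p => ⟨some (entry (loop r p)), 0, base r, loopBody r p (some (entry p)), 0, 1⟩ ::
    (((List.range (base r - 1)).map fun c =>
      ⟨some (entry (loop r p)), c + 1, base r, none, c + 1, base r⟩) ++
      (transitions p).map (.map (loopBody r p)))

/-- The successor function of the flow chart of a program. -/
noncomputable def next : (p : Prog) → State p → ℤ → Option (State p) × ℤ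
  | skip, _, u => (none, u)
  | inc r, _, u => (none, base r * u)
  | seq p q, .inl s, u => (next p s u).map (seqLeft p q) id
  | seq p q, .inr s, u => (next q s u).map (seqRight p q) id
  | loop r p, none, u => if (base r : ℤ) ∣ u then (loopBody r p (some (entry p)), u / base r)
      else (none, u)
  | loop r p, some s, u => (next p s u).map (loopBody r p) id

theorem step_transitions_iff (p : Prog) (a b : Option (State p) × ℤ) :
    Step (transitions p) a b ↔ ∃ s u, a = (some s, u) ∧ b = next p s u := by
  induction p with
  | skip =>
    simp only [transitions, Step, List.mem_singleton, exists_eq_left, zero_add, one_mul, next]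
    exact ⟨fun ⟨n, h⟩ => ⟨(), n, h⟩, fun ⟨_, n, h⟩ => ⟨n, h⟩⟩
  | inc r =>
    simp only [transitions, Step, List.mem_singleton, exists_eq_left, zero_add, one_mul, next]
    exact ⟨fun ⟨n, h⟩ => ⟨(), n, h⟩, fun ⟨_, n, h⟩ => ⟨n, h⟩⟩
  | seq p q ihp ihq =>
    rw [transitions, Transition.step_append, Transition.step_map, Transition.step_map]
    simp only [ihp, ihq]
    constructor
    · rintro (⟨_, _, ⟨s, u, rfl, rfl⟩, rfl, rfl⟩ | ⟨_, _, ⟨s, u, rfl, rfl⟩, rfl, rfl⟩)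
      · exact ⟨.inl s, u, rfl, rfl⟩
      · exact ⟨.inr s, u, rfl, rfl⟩
    · rintro ⟨s | s, u, rfl, rfl⟩
      · exact .inl ⟨_, _, ⟨s, u, rfl, rfl⟩, rfl, rfl⟩
      · exact .inr ⟨_, _, ⟨s, u, rfl, rfl⟩, rfl, rfl⟩
  | loop r p ih =>
    have hr := base_pos r
    rw [transitions, Transition.step_cons, Transition.step_append, Transition.step_map]
    simp only [ih]
    constructor
    · rintro (⟨n, rfl, rfl⟩ | ⟨e, he, n, rfl, rfl⟩ | ⟨_, _, ⟨s, u, rfl, rfl⟩, rfl, rfl⟩)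
      · refine ⟨none, 0 + base r * n, rfl, ?_⟩
        rw [zero_add, zero_add, one_mul, next, if_pos (dvd_mul_right _ _),
          Int.mul_ediv_cancel_left _ hr.ne']
      · obtain ⟨c, hc, rfl⟩ := List.mem_map.1 he
        rw [List.mem_range] at hc
        refine ⟨none, _, rfl, ?_⟩
        rw [next, if_neg]
        rw [dvd_add_left (dvd_mul_right _ _)]
        intro h
        have := Int.le_of_dvd (show (0 : ℤ) < (c : ℤ) + 1 by omega) h
        omega
      · exact ⟨some s, u, rfl, rfl⟩
    · rintro ⟨_ | s, u, rfl, rfl⟩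
      · by_cases h : (base r : ℤ) ∣ u
        · obtain ⟨n, rfl⟩ := h
          refine .inl ⟨n, ?_, ?_⟩
          · simp [entry]
          · rw [zero_add, one_mul, next, if_pos (dvd_mul_right _ _),
              Int.mul_ediv_cancel_left _ hr.ne']
        · refine .inr (.inl ⟨_, List.mem_map_of_mem (a := (u % base r).toNat - 1) ?_, u / base r,
            ?_, ?_⟩)
          all_goals
            have h1 := Int.emod_nonneg u hr.ne'
            have h2 := Int.emod_lt_of_pos u hr
            have h3 : u % base r ≠ 0 := fun h' => h (Int.dvd_of_emod_eq_zero h')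
            have h4 := Int.emod_add_mul_ediv u (base r)
            have h5 : ((((u % base r).toNat - 1 : ℕ) : ℤ) + 1) = u % base r := by omega
          · rw [List.mem_range]
            omega
          · rw [h5, h4]
            rfl
          · rw [h5, h4, next, if_neg h]
      · exact .inr (.inr ⟨_, _, ⟨s, u, rfl, rfl⟩, rfl, rfl⟩)

theorem pos_next_iff (p : Prog) (s : State p) (u : ℤ) : 0 < (next p s u).2 ↔ 0 < u := by
  induction p with
  | skip => rfl
  | inc r => exact mul_pos_iff_of_pos_left (base_pos r)
  | seq p q ihp ihq =>
    rcases s with s | s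
    · exact ihp s
    · exact ihq s
  | loop r p ih =>
    rcases s with _ | s
    · rw [next]
      split_ifs with h
      · obtain ⟨n, rfl⟩ := h
        have := base_pos r
        rw [Int.mul_ediv_cancel_left _ this.ne', mul_pos_iff_of_pos_left this]
      · rfl
    · exact ih s

theorem transitions_ne_zero {p : Prog} {e : Transition (Option (State p))}
    (he : e ∈ transitions p) : e.j ≠ 0 ∧ e.j' ≠ 0 := by
  induction p with
  | skip =>
    rw [transitions, List.mem_singleton] at he
    simp [he]
  | inc r =>
    rw [transitions, List.mem_singleton] at he
    simp [he, (prime_base r).ne_zero]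
  | seq p q ihp ihq =>
    rw [transitions, List.mem_append] at he
    rcases he with he | he
    · obtain ⟨e, he', rfl⟩ := List.mem_map.1 he
      exact ihp he'
    · obtain ⟨e, he', rfl⟩ := List.mem_map.1 he
      exact ihq he'
  | loop r p ih =>
    rw [transitions, List.mem_cons, List.mem_append] at he
    rcases he with rfl | he | he
    · simp [(prime_base r).ne_zero]
    · obtain ⟨c, _, rfl⟩ := List.mem_map.1 he
      simp [(prime_base r).ne_zero]
    · obtain ⟨e, he', rfl⟩ := List.mem_map.1 he
      exact ih he'

/-- The configurations from which the program halts with zero memory. -/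
def halting (p : Prog) : Set (Option (State p) × ℤ) :=
  {c | ReflTransGen (Step (transitions p)) c (none, 1)}

theorem compatible_halting {p : Prog} {e : Transition (Option (State p))}
    (he : e ∈ transitions p) : e.Compatible (halting p) := by
  intro n
  have h : Step (transitions p) (e.q, e.i + e.j * n) (e.q', e.i' + e.j' * n) :=
    ⟨e, he, n, rfl, rfl⟩
  refine ⟨fun h' => ?_, fun h' => .head h h'⟩
  obtain ⟨s, u, h1, h2⟩ := (step_transitions_iff p _ _).1 h
  rcases ReflTransGen.cases_head h' with h3 | ⟨c, h3, h4⟩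
  · rw [h1] at h3
    simp at h3
  · obtain ⟨s', u', h5, rfl⟩ := (step_transitions_iff p _ _).1 h3
    rw [h1] at h5
    simp only [Prod.mk.injEq, Option.some.injEq] at h5
    rw [h2, h5.1, h5.2]
    exact h4

theorem halting_subset {p : Prog} {X : Set (Option (State p) × ℤ)} (h : (none, 1) ∈ X)
    (hX : ∀ e ∈ transitions p, e.Compatible X) : halting p ⊆ X := by
  intro c hc
  induction hc using ReflTransGen.head_induction_on with
  | refl => exact h
  | head h' _ ih =>
    obtain ⟨e, he, n, rfl, rfl⟩ := h'
    exact (hX e he n).2 ih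

theorem pos_of_mem_halting {p : Prog} {c : Option (State p) × ℤ} (hc : c ∈ halting p) :
    0 < c.2 := by
  induction hc using ReflTransGen.head_induction_on with
  | refl => exact one_pos
  | head h' _ ih =>
    obtain ⟨s, u, rfl, rfl⟩ := (step_transitions_iff p _ _).1 h'
    exact (pos_next_iff p s u).1 ih

/-- The number encoding the memory. -/
noncomputable def code (σ : ℕ →₀ ℕ) : ℕ := σ.prod fun r k => base r ^ k

theorem code_add_single (σ : ℕ →₀ ℕ) (r : ℕ) : code (σ + single r 1) = base r * code σ := by
  rw [code, Finsupp.prod_add_index' (by simp) (by simp [pow_add]), mul_comm]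
  simp [code]

theorem code_zero : code 0 = 1 := Finsupp.prod_zero_index

theorem base_dvd_code_iff {σ : ℕ →₀ ℕ} {r : ℕ} : base r ∣ code σ ↔ σ r ≠ 0 := by
  constructor
  · intro h
    rw [code, Finsupp.prod, (prime_base r).prime.dvd_finsetProd_iff] at h
    obtain ⟨s, hs, h⟩ := h
    have := (Nat.prime_dvd_prime_iff_eq (prime_base r) (prime_base s)).1
      ((prime_base r).dvd_of_dvd_pow h)
    rw [Nat.nth_injective Nat.infinite_setOfPred_prime this]
    simpa using hs
  · intro h
    have h1 : σ = σ.erase r + single r (σ r - 1) + single r 1 := by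
      rw [add_assoc, ← Finsupp.single_add, Nat.sub_add_cancel (by omega), Finsupp.erase_add_single]
    rw [h1, code_add_single]
    exact dvd_mul_right _ _

theorem code_eq_one_iff {σ : ℕ →₀ ℕ} : code σ = 1 ↔ σ = 0 := by
  constructor
  · intro h
    ext r
    by_contra h'
    exact (prime_base r).one_lt.ne' (Nat.dvd_one.1 (h ▸ base_dvd_code_iff.2 h'))
  · rintro rfl
    exact code_zero

theorem exists_code_eq {u : ℕ} (hu : u ≠ 0) : ∃ σ, code σ = u := by
  induction u using induction_on_primes with
  | zero => exact absurd rfl hu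
  | one => exact ⟨0, code_zero⟩
  | prime_mul q a hq ih =>
    obtain ⟨σ, rfl⟩ := ih (by rintro rfl; simp at hu)
    refine ⟨σ + single (Nat.count Nat.Prime q) 1, ?_⟩
    rw [code_add_single, base, Nat.nth_count hq]

theorem Eval.reflTransGen {p : Prog} {σ σ' : ℕ →₀ ℕ} (h : Eval p σ σ') :
    ReflTransGen (Step (transitions p)) (some (entry p), (code σ : ℤ)) (none, (code σ' : ℤ)) := by
  induction h with
  | skip σ => exact .single ((step_transitions_iff _ _ _).2 ⟨(), code σ, rfl, rfl⟩)
  | inc r σ =>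
    refine .single ((step_transitions_iff _ _ _).2 ⟨(), code σ, rfl, ?_⟩)
    rw [code_add_single, Nat.cast_mul]
    rfl
  | @seq p q σ σ' σ'' _ _ ihp ihq =>
    refine .trans (ihp.lift (Prod.map (seqLeft p q) id) fun a b h => ?_)
      (ihq.lift (Prod.map (seqRight p q) id) fun a b h => ?_)
    · exact Transition.step_append.2 (.inl (Transition.step_map.2 ⟨a, b, h, rfl, rfl⟩))
    · exact Transition.step_append.2 (.inr (Transition.step_map.2 ⟨a, b, h, rfl, rfl⟩))
  | @loop_zero r p σ h =>
    refine .single ((step_transitions_iff _ _ _).2 ⟨none, code σ, rfl, ?_⟩)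
    rw [next, if_neg]
    rw [Int.natCast_dvd_natCast, base_dvd_code_iff]
    exact not_not.2 h
  | @loop_succ r p σ σ' σ'' _ _ ih ih' =>
    refine .head (b := (loopBody r p (some (entry p)), (code σ : ℤ)))
      ((step_transitions_iff _ _ _).2 ⟨none, code (σ + single r 1), rfl, ?_⟩)
      (.trans (ih.lift (Prod.map (loopBody r p) id) fun a b h => ?_) ih')
    · rw [code_add_single, next, Nat.cast_mul, if_pos (dvd_mul_right _ _),
        Int.mul_ediv_cancel_left _ (base_pos r).ne']
    · exact Transition.step_cons.2
        (.inr (Transition.step_append.2 (.inr (Transition.step_map.2 ⟨a, b, h, rfl, rfl⟩))))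

theorem eq_of_reflTransGen {p : Prog} {u : ℤ} {c : Option (State p) × ℤ}
    (h : ReflTransGen (Step (transitions p)) (none, u) c) : c = (none, u) := by
  obtain h | ⟨c, h1, -⟩ := h.cases_head
  · exact h.symm
  · obtain ⟨s, u, h2, -⟩ := (step_transitions_iff _ _ _).1 h1
    simp at h2

theorem exists_reflTransGen_of_seq {p q : Prog} {a : Option (State p) × ℤ} {v : ℤ}
    (h : ReflTransGen (Step (transitions (seq p q))) (a.map (seqLeft p q) id) (none, v)) :
    ∃ w, ReflTransGen (Step (transitions p)) a (none, w) ∧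
      ReflTransGen (Step (transitions (seq p q))) (some (Sum.inr (entry q)), w) (none, v) := by
  generalize hc : a.map (seqLeft p q) id = c at h
  induction h using ReflTransGen.head_induction_on generalizing a with
  | refl =>
    obtain ⟨_ | s, u⟩ := a
    all_goals exact absurd (Prod.mk.inj hc).1 (Option.some_ne_none _)
  | head h h' ih =>
    obtain ⟨_ | s, u⟩ := a
    · subst hc
      exact ⟨u, .refl, .head h h'⟩
    · subst hc
      obtain ⟨s', u', h1, h2⟩ := (step_transitions_iff _ _ _).1 h
      obtain ⟨h3, rfl⟩ := Prod.mk.inj h1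
      obtain rfl := Option.some.inj h3
      obtain ⟨w, h3, h4⟩ := ih h2.symm
      exact ⟨w, .head ((step_transitions_iff _ _ _).2 ⟨s, u, rfl, rfl⟩) h3, h4⟩

theorem reflTransGen_of_seqRight {p q : Prog} {a : Option (State q) × ℤ} {v : ℤ}
    (h : ReflTransGen (Step (transitions (seq p q))) (a.map (seqRight p q) id) (none, v)) :
    ReflTransGen (Step (transitions q)) a (none, v) := by
  generalize hc : a.map (seqRight p q) id = c at h
  induction h using ReflTransGen.head_induction_on generalizing a with
  | refl =>
    obtain ⟨_ | s, u⟩ := a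
    · simp only [Prod.map_apply, seqRight, id, Prod.mk.injEq] at hc
      rw [hc.2]
    · exact absurd (Prod.mk.inj hc).1 (Option.some_ne_none _)
  | head h h' ih =>
    obtain ⟨_ | s, u⟩ := a
    · subst hc
      obtain ⟨s', u', h1, h2⟩ := (step_transitions_iff _ _ _).1 h
      exact absurd (Prod.mk.inj h1).1.symm (Option.some_ne_none _)
    · subst hc
      obtain ⟨s', u', h1, h2⟩ := (step_transitions_iff _ _ _).1 h
      obtain ⟨h3, rfl⟩ := Prod.mk.inj h1
      obtain rfl := Option.some.inj h3
      exact .head ((step_transitions_iff _ _ _).2 ⟨s, u, rfl, rfl⟩) (ih h2.symm)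

theorem exists_eval_of_reflTransGen {p : Prog} {σ : ℕ →₀ ℕ} {v : ℤ}
    (h : ReflTransGen (Step (transitions p)) (some (entry p), (code σ : ℤ)) (none, v)) :
    ∃ σ', Eval p σ σ' ∧ (code σ' : ℤ) = v := by
  induction p generalizing σ v with
  | skip =>
    obtain h | ⟨c, h1, h2⟩ := h.cases_head
    · simp at h
    obtain ⟨s, u, h3, rfl⟩ := (step_transitions_iff _ _ _).1 h1
    obtain ⟨-, rfl⟩ := Prod.mk.inj h3
    exact ⟨σ, .skip σ, (Prod.mk.inj (eq_of_reflTransGen h2)).2.symm⟩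
  | inc r =>
    obtain h | ⟨c, h1, h2⟩ := h.cases_head
    · simp at h
    obtain ⟨s, u, h3, rfl⟩ := (step_transitions_iff _ _ _).1 h1
    obtain ⟨-, rfl⟩ := Prod.mk.inj h3
    refine ⟨_, .inc r σ, ?_⟩
    rw [code_add_single, Nat.cast_mul]
    exact (Prod.mk.inj (eq_of_reflTransGen h2)).2.symm
  | seq p q ihp ihq =>
    obtain ⟨w, h1, h2⟩ := exists_reflTransGen_of_seq (a := (some (entry p), (code σ : ℤ))) h
    obtain ⟨τ, h3, rfl⟩ := ihp h1
    obtain ⟨σ', h4, rfl⟩ :=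
      ihq (reflTransGen_of_seqRight (a := (some (entry q), (code τ : ℤ))) h2)
    exact ⟨σ', .seq h3 h4, rfl⟩
  | loop r p ih =>
    suffices ∀ c, ReflTransGen (Step (transitions (loop r p))) c (none, v) →
        ∀ a, Prod.map (loopBody r p) id a = c → ∃ w,
          ReflTransGen (Step (transitions p)) a (none, w) ∧
          ∀ τ, (code τ : ℤ) = w → ∃ σ', Eval (loop r p) τ σ' ∧ (code σ' : ℤ) = v by
      obtain ⟨w, h1, h2⟩ := this _ h (none, (code σ : ℤ)) rfl
      exact h2 σ (Prod.mk.inj (eq_of_reflTransGen h1)).2.symm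
    intro c hc
    induction hc using ReflTransGen.head_induction_on with
    | refl =>
      intro a ha
      exact absurd (Prod.mk.inj ha).1 (Option.some_ne_none _)
    | head h h' ih' =>
      rintro ⟨_ | s, u⟩ rfl
      · refine ⟨u, .refl, ?_⟩
        rintro τ rfl
        obtain ⟨s', u', h1, rfl⟩ := (step_transitions_iff _ _ _).1 h
        obtain ⟨h3, rfl⟩ : _ ∧ (code τ : ℤ) = u' := Prod.mk.inj h1
        obtain rfl := Option.some.inj h3
        by_cases hd : τ r = 0
        · rw [next, if_neg (by rwa [Int.natCast_dvd_natCast, base_dvd_code_iff, not_not])] at h'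
          exact ⟨τ, .loop_zero hd, (Prod.mk.inj (eq_of_reflTransGen h')).2.symm⟩
        · have h2 : τ = τ.erase r + single r (τ r - 1) + single r 1 := by
            rw [add_assoc, ← Finsupp.single_add, Nat.sub_add_cancel (by omega),
              Finsupp.erase_add_single]
          generalize τ.erase r + single r (τ r - 1) = τ' at h2
          subst h2
          obtain ⟨w, h4, h5⟩ := ih' (some (entry p), (code τ' : ℤ)) (by
            rw [next, if_pos (by
              rwa [Int.natCast_dvd_natCast, base_dvd_code_iff]), code_add_single, Nat.cast_mul,
              Int.mul_ediv_cancel_left _ (base_pos r).ne']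
            rfl)
          obtain ⟨σ₁, h6, rfl⟩ := ih h4
          obtain ⟨σ', h7, h8⟩ := h5 σ₁ rfl
          exact ⟨σ', .loop_succ h6 h7, h8⟩
      · obtain ⟨s', u', h1, rfl⟩ := (step_transitions_iff _ _ _).1 h
        obtain ⟨h3, rfl⟩ := Prod.mk.inj h1
        obtain rfl := Option.some.inj h3
        obtain ⟨w, h4, h5⟩ := ih' _ rfl
        exact ⟨w, .head ((step_transitions_iff _ _ _).2 ⟨s, u, rfl, rfl⟩) h4, h5⟩

theorem mem_halting_iff {p : Prog} {u : ℤ} :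
    (some (entry p), u) ∈ halting p ↔ ∃ σ, u = code σ ∧ Eval p σ 0 := by
  constructor
  · intro h
    have hu : 0 < u := pos_of_mem_halting h
    lift u to ℕ using hu.le
    obtain ⟨σ, rfl⟩ := exists_code_eq (u := u) (by omega)
    obtain ⟨σ', h1, h2⟩ := exists_eval_of_reflTransGen h
    rw [Nat.cast_eq_one, code_eq_one_iff] at h2
    exact ⟨σ, rfl, h2 ▸ h1⟩
  · rintro ⟨σ, rfl, h⟩
    have := h.reflTransGen
    rwa [code_zero, Nat.cast_one] at this

end Prog

namespace Prog

open Finsupp (single)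

theorem Eval.eq {p : Prog} {σ σ₁ σ₂ : ℕ →₀ ℕ} (h₁ : Eval p σ σ₁) (h₂ : Eval p σ σ₂) : σ₁ = σ₂ := by
  induction h₁ generalizing σ₂ with
  | skip => cases h₂; rfl
  | inc => cases h₂; rfl
  | seq _ _ ihp ihq =>
    cases h₂ with
    | seq h h' =>
      obtain rfl := ihp h
      exact ihq h'
  | @loop_zero r p σ h0 =>
    generalize hP : loop r p = P at h₂
    cases h₂ with
    | loop_zero => rfl
    | loop_succ =>
      obtain ⟨rfl, rfl⟩ := loop.inj hP
      simp at h0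
    | _ => cases hP
  | @loop_succ r p σ σ' σ'' _ _ ih ih' =>
    generalize hP : loop r p = P at h₂
    generalize hτ : σ + single r 1 = τ at h₂
    cases h₂ with
    | loop_zero h0 =>
      obtain ⟨rfl, rfl⟩ := loop.inj hP
      subst hτ
      simp at h0
    | loop_succ h h' =>
      obtain ⟨rfl, rfl⟩ := loop.inj hP
      obtain rfl := add_right_cancel hτ
      obtain rfl := ih h
      exact ih' h'
    | _ => cases hP

theorem eval_seq_iff {p q : Prog} {σ τ : ℕ →₀ ℕ} :
    Eval (seq p q) σ τ ↔ ∃ ρ, Eval p σ ρ ∧ Eval q ρ τ := by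
  constructor
  · rintro (_ | _ | ⟨h, h'⟩)
    exact ⟨_, h, h'⟩
  · rintro ⟨ρ, h, h'⟩
    exact .seq h h'

/-- The program which diverges unless the registers in a list are zero. -/
def asserts : List ℕ → Prog
  | [] => skip
  | r :: l => seq (loop r (inc r)) (asserts l)

theorem eval_loop_inc {r : ℕ} {σ τ : ℕ →₀ ℕ} (h : Eval (loop r (inc r)) σ τ) :
    σ r = 0 ∧ τ = σ := by
  generalize hP : loop r (inc r) = P at h
  induction h with
  | loop_zero h0 =>
    obtain ⟨rfl, rfl⟩ := loop.inj hP
    exact ⟨h0, rfl⟩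
  | loop_succ h _ _ ih =>
    obtain ⟨rfl, rfl⟩ := loop.inj hP
    cases h
    simpa using (ih rfl).1
  | _ => cases hP

theorem eval_asserts_iff {l : List ℕ} {σ τ : ℕ →₀ ℕ} :
    Eval (asserts l) σ τ ↔ (∀ r ∈ l, σ r = 0) ∧ τ = σ := by
  induction l with
  | nil =>
    refine ⟨fun h => ?_, fun h => ?_⟩
    · cases h
      simp
    · rw [h.2]
      exact .skip σ
  | cons r l ih =>
    rw [asserts, eval_seq_iff]
    constructor
    · rintro ⟨ρ, h, h'⟩
      obtain ⟨h0, rfl⟩ := eval_loop_inc h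
      rw [ih] at h'
      exact ⟨List.forall_mem_cons.2 ⟨h0, h'.1⟩, h'.2⟩
    · rintro ⟨h, rfl⟩
      rw [List.forall_mem_cons] at h
      exact ⟨_, .loop_zero h.1, ih.2 ⟨h.2, rfl⟩⟩

/-- The body of the search for a zero of a function computed by `p`. The argument in the register
`0` is kept, the argument in the register `2` is increased, and the flag in the register `1` is
raised if the value in the register `3` was not zero. -/
def searchStep (p : Prog) : Prog := seq p (seq (loop 3 (seq (clear 3) (inc 1))) (inc 2))

section Search

variable {h : List.Vector ℕ 2 → ℕ} {p : Prog} {B : ℕ}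

theorem eval_searchStep (hp : Computes p ![2, 0] 3 4 B h) {σ : ℕ →₀ ℕ}
    (hσ : ∀ r, r = 3 ∨ 4 ≤ r ∧ r < B → σ r = 0) :
    Eval (searchStep p) σ (σ + single 2 1 +
      single 1 (if h (σ 2 ::ᵥ σ 0 ::ᵥ List.Vector.nil) = 0 then 0 else 1)) := by
  have h1 := hp σ (σ 2 ::ᵥ σ 0 ::ᵥ List.Vector.nil) (fun i => by fin_cases i <;> rfl)
    fun r hr hr' => hσ r (.inr ⟨hr, hr'⟩)
  refine .seq h1 ?_
  have h3 : σ 3 = 0 := hσ 3 (.inl rfl)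
  generalize h (σ 2 ::ᵥ σ 0 ::ᵥ List.Vector.nil) = z
  rcases z with _ | z
  · simp only [Finsupp.single_zero, add_zero, if_true]
    exact .seq (.loop_zero h3) (.inc 2 σ)
  · rw [if_neg (Nat.succ_ne_zero z), Finsupp.single_add, ← add_assoc, add_right_comm σ (single 2 1)]
    exact .seq (.loop_succ (.seq (eval_clear h3 z) (.inc 1 σ)) (.loop_zero (by simp [h3])))
      (.inc 2 _)

theorem eval_searchStep_add_single (hp : Computes p ![2, 0] 3 4 B h) {σ : ℕ →₀ ℕ}
    (hσ : ∀ r, 1 ≤ r → r < max 4 B → σ r = 0) (k : ℕ) :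
    Eval (searchStep p) (σ + single 2 k) (σ + single 2 (k + 1) +
      single 1 (if h (k ::ᵥ σ 0 ::ᵥ List.Vector.nil) = 0 then 0 else 1)) := by
  have := eval_searchStep hp (σ := σ + single 2 k) fun r hr => by
    rw [Finsupp.add_apply, hσ r (by omega) (by omega), Finsupp.single_eq_of_ne (by omega), add_zero]
  have h2 : σ 2 = 0 := hσ 2 (by omega) (by omega)
  simpa [h2, add_assoc, ← Finsupp.single_add] using this

theorem exists_eval_search (hp : Computes p ![2, 0] 3 4 B h) {σ : ℕ →₀ ℕ}
    (hσ : ∀ r, 1 ≤ r → r < max 4 B → σ r = 0) {k d : ℕ}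
    (hk : h ((k + d) ::ᵥ σ 0 ::ᵥ List.Vector.nil) = 0) :
    ∃ l, Eval (loop 1 (searchStep p)) (σ + single 2 k + single 1 1) (σ + single 2 l) := by
  have h1 : σ 1 = 0 := hσ 1 le_rfl (by omega)
  have h2 := eval_searchStep_add_single hp hσ k
  induction d generalizing k with
  | zero =>
    refine ⟨k + 1, .loop_succ h2 ?_⟩
    rw [add_zero] at hk
    rw [hk, if_pos rfl, Finsupp.single_zero, add_zero]
    exact .loop_zero (by simp [h1])
  | succ d ih =>
    split_ifs at h2 with h3
    · refine ⟨k + 1, .loop_succ h2 ?_⟩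
      rw [Finsupp.single_zero, add_zero]
      exact .loop_zero (by simp [h1])
    · obtain ⟨l, hl⟩ := ih (k := k + 1) (by rwa [add_assoc, add_comm 1])
        (eval_searchStep_add_single hp hσ _)
      exact ⟨l, .loop_succ h2 hl⟩

theorem exists_eq_zero_of_eval_search (hp : Computes p ![2, 0] 3 4 B h) {σ : ℕ →₀ ℕ}
    (hσ : ∀ r, 1 ≤ r → r < max 4 B → σ r = 0) {k : ℕ} {τ : ℕ →₀ ℕ}
    (he : Eval (loop 1 (searchStep p)) (σ + single 2 k + single 1 1) τ) :
    ∃ l, h (l ::ᵥ σ 0 ::ᵥ List.Vector.nil) = 0 := by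
  generalize hP : loop 1 (searchStep p) = P at he
  generalize hρ : σ + single 2 k + single 1 1 = ρ at he
  induction he generalizing k with
  | loop_zero h0 =>
    obtain ⟨rfl, rfl⟩ := loop.inj hP
    subst hρ
    simp at h0
  | loop_succ h1 _ _ ih =>
    obtain ⟨rfl, rfl⟩ := loop.inj hP
    obtain rfl := add_right_cancel hρ
    by_cases hk : h (k ::ᵥ σ 0 ::ᵥ List.Vector.nil) = 0
    · exact ⟨k, hk⟩
    · refine ih (k := k + 1) rfl ?_
      have := eval_searchStep_add_single hp hσ k
      rw [if_neg hk] at this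
      exact this.eq h1
  | _ => cases hP

/-- The program which halts with zero memory if and only if the argument in the register `0` belongs
to the projection of the zero set of the function computed by `p`, and the other registers are
initially zero. -/
def search (p : Prog) (B : ℕ) : Prog :=
  seq (asserts (List.range' 1 B)) (seq (inc 1) (seq (loop 1 (searchStep p))
    (clears (List.range (B + 1)))))

theorem eval_search_iff (hp : Computes p ![2, 0] 3 4 B h) (hB : 4 ≤ B) {σ : ℕ →₀ ℕ} :
    Eval (search p B) σ 0 ↔
      ∃ n, (∃ k, h (k ::ᵥ n ::ᵥ List.Vector.nil) = 0) ∧ σ = single 0 n := by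
  simp only [search, eval_seq_iff, eval_asserts_iff]
  have key {σ : ℕ →₀ ℕ} (hσ : ∀ r ∈ List.range' 1 B, σ r = 0) (k : ℕ)
      (hk : h (k ::ᵥ σ 0 ::ᵥ List.Vector.nil) = 0) : ∃ l τ,
      Eval (loop 1 (searchStep p)) (σ + single 1 1) (σ + single 2 l) ∧
      Eval (clears (List.range (B + 1))) (σ + single 2 l) τ ∧
      ∀ r, τ r = if r < B + 1 then 0 else σ r := by
    obtain ⟨l, hl⟩ := exists_eval_search hp (fun r hr hr' => hσ r (List.mem_range'_1.2 (by omega)))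
      (k := 0) (d := k) (by rwa [zero_add])
    obtain ⟨τ, h1, h2⟩ := eval_clears (List.range (B + 1)) (σ + single 2 l)
    refine ⟨l, τ, by simpa using hl, h1, fun r => ?_⟩
    rw [h2]
    by_cases hr : r < B + 1
    · simp [hr]
    · rw [if_neg (by simpa using hr), if_neg hr, Finsupp.add_apply,
        Finsupp.single_eq_of_ne (by omega), add_zero]
  constructor
  · rintro ⟨_, ⟨hσ, hρ⟩, _, h1, _, h2, h3⟩
    obtain rfl := hρ.symm
    cases h1
    obtain ⟨k, hk⟩ := exists_eq_zero_of_eval_search hp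
      (fun r hr hr' => hσ r (List.mem_range'_1.2 (by omega))) (k := 0) (by simpa using h2)
    refine ⟨σ 0, ⟨k, hk⟩, ?_⟩
    obtain ⟨l, τ', h4, h5, h6⟩ := key hσ k hk
    obtain rfl := h4.eq h2
    obtain rfl := h5.eq h3
    ext r
    rcases Nat.eq_zero_or_pos r with rfl | hr
    · simp
    · rw [Finsupp.single_eq_of_ne (by omega)]
      by_cases hr' : r < B + 1
      · exact hσ r (List.mem_range'_1.2 (by omega))
      · simpa [hr'] using (h6 r).symm
  · rintro ⟨n, ⟨k, hk⟩, rfl⟩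
    have hσ : ∀ r ∈ List.range' 1 B, single 0 n r = 0 := fun r hr => by
      rw [List.mem_range'_1] at hr
      exact Finsupp.single_eq_of_ne (by omega)
    obtain ⟨l, τ, h4, h5, h6⟩ := key hσ k (by simpa using hk)
    have : τ = 0 := by
      ext r
      rw [h6]
      split_ifs with hr
      · rfl
      · exact Finsupp.single_eq_of_ne (by omega)
    subst this
    exact ⟨_, ⟨hσ, rfl⟩, _, .inc 1 _, _, h4, h5⟩

end Search

theorem base_zero : base 0 = 2 := Nat.nth_prime_zero_eq_two

theorem code_single_zero (n : ℕ) : code (single 0 n) = 2 ^ n := by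
  rw [code, Finsupp.prod_single_index (by simp), base_zero]

open Nat.Partrec (Code) in
theorem exists_primrec_of_re {K : ℕ → Prop} (hK : REPred K) {f : ℕ → ℕ} (hf : Primrec f) :
    ∃ h : List.Vector ℕ 2 → ℕ, Nat.Primrec' h ∧
      ∀ n, (∃ r, K r ∧ n = f r) ↔ ∃ k, h (k ::ᵥ n ::ᵥ List.Vector.nil) = 0 := by
  obtain ⟨c, hc⟩ := Code.exists_code.1 (Partrec.nat_iff.1
    (hK.map ((Computable.const (0 : ℕ)).to₂)))
  have h1 : Primrec fun v : List.Vector ℕ 2 => v.head.unpair :=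
    Primrec.unpair.comp Primrec.vector_head
  have h2 : Primrec fun v : List.Vector ℕ 2 => v.head.unpair.2 := Primrec.snd.comp h1
  refine ⟨fun v => bif (c.evaln v.head.unpair.1 v.head.unpair.2).isSome &&
    (v.tail.head == f v.head.unpair.2) then 0 else 1, ?_, fun n => ?_⟩
  · refine Nat.Primrec'.of_prim (Primrec.cond (Primrec.and.comp (Primrec.option_isSome.comp ?_)
      (Primrec.beq.comp (Primrec.vector_head.comp Primrec.vector_tail) (hf.comp h2)))
      (Primrec.const 0) (Primrec.const 1))
    exact Code.primrec_evaln.comp (((Primrec.fst.comp h1).pair (Primrec.const c)).pair h2)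
  · have h3 (r) : K r ↔ ∃ k, (c.evaln k r).isSome := by
      have : K r ↔ ∃ x, x ∈ c.eval r := by simp [hc]
      simp only [this, Code.evaln_complete, Option.isSome_iff_exists]
      exact exists_comm
    simp only [h3, List.Vector.head_cons, List.Vector.tail_cons]
    constructor
    · rintro ⟨r, ⟨k, hk⟩, rfl⟩
      exact ⟨Nat.pair k r, by simp [hk]⟩
    · rintro ⟨k, hk⟩
      cases h4 : (c.evaln k.unpair.1 k.unpair.2).isSome && (n == f k.unpair.2) with
      | false => simp [h4] at hk
      | true =>
        rw [Bool.and_eq_true, beq_iff_eq] at h4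
        exact ⟨_, ⟨_, h4.1⟩, h4.2⟩

theorem exists_mem_halting_iff {K : ℕ → Prop} (hK : REPred K) {f : ℕ → ℕ} (hf : Primrec f) :
    ∃ p : Prog, ∀ u : ℤ, (some (entry p), u) ∈ halting p ↔ ∃ r, K r ∧ u = 2 ^ f r := by
  obtain ⟨h, h1, h2⟩ := exists_primrec_of_re hK hf
  obtain ⟨p, B, hp⟩ := exists_computes h1 ![2, 0] 3 4 (fun i => by fin_cases i <;> simp)
    (by simp) (fun i => by fin_cases i <;> simp)
  refine ⟨search p (max 4 B), fun u => ?_⟩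
  rw [mem_halting_iff]
  simp only [eval_search_iff (hp.mono (le_max_right 4 B)) (le_max_left 4 B), ← h2]
  constructor
  · rintro ⟨_, rfl, _, ⟨r, hr, rfl⟩, rfl⟩
    exact ⟨r, hr, by rw [code_single_zero]; simp⟩
  · rintro ⟨r, hr, rfl⟩
    exact ⟨_, by rw [code_single_zero]; simp, _, ⟨r, hr, rfl⟩, rfl⟩

end Prog

/-- The union of two sets of configurations with disjoint sets of states. -/
def sumConfigs {Q Q' : Type} (E : Set (Q × ℤ)) (E' : Set (Q' × ℤ)) : Set ((Q ⊕ Q') × ℤ) :=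
  {c | Sum.elim (fun q => (q, c.2) ∈ E) (fun q => (q, c.2) ∈ E') c.1}

theorem primrec_two_pow_succ : Primrec fun r : ℕ => 2 ^ (r + 1) :=
  (Primrec₂.unpaired'.1 Nat.Primrec.pow).comp (Primrec.const 2) Primrec.succ

open SemidirectProduct Tower Mast Prog Transition in
theorem exists_isStage_of_re {K : ℕ → Prop} (hK : REPred K) :
    ∃ (Q : Type) (E : Set (Q × ℤ)) (q₁ q₂ : Q) (B : Type) (_ : Group B) (ι : Mast Q →* B)
      (A : Subgroup B),
      IsStage (core Q) ((sub E (fibreExponent E q₁ q₂)).map inl) ι A ∧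
      Group.IsFinitelyPresented B ∧ A.FG ∧
      (∀ u, (q₁, u) ∈ E ↔ ∃ r : ℕ, u = 2 ^ 2 ^ (r + 1)) ∧
      ∀ u, (q₂, u) ∈ E ↔ ∃ r : ℕ, K r ∧ u = 2 ^ 2 ^ (r + 1) := by
  obtain ⟨p₁, hp₁⟩ := exists_mem_halting_iff (K := fun _ => True)
    (ComputablePred.to_re (Computable.computablePred (by simpa using Computable.const true)))
    primrec_two_pow_succ
  obtain ⟨p₂, hp₂⟩ := exists_mem_halting_iff hK primrec_two_pow_succ
  let E := sumConfigs (halting p₁) (halting p₂)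
  let q₁ : Option (State p₁) ⊕ Option (State p₂) := .inl (some (entry p₁))
  let q₂ : Option (State p₁) ⊕ Option (State p₂) := .inr (some (entry p₂))
  have h₁ (u : ℤ) : (q₁, u) ∈ E ↔ ∃ r : ℕ, u = 2 ^ 2 ^ (r + 1) :=
    (hp₁ u).trans (by simp)
  obtain ⟨B, hB, ι, A, h⟩ := exists_isStage_fg (E := E)
    (seeds := {(.inl none, 1), (.inr none, 1)}) q₁ q₂
    ((transitions p₁).map (map .inl) ++ (transitions p₂).map (map .inr))
    (by
      simp only [List.mem_append, List.mem_map]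
      rintro _ (⟨e, he, rfl⟩ | ⟨e, he, rfl⟩)
      · exact transitions_ne_zero he
      · exact transitions_ne_zero he)
    (by
      simp only [List.mem_append, List.mem_map]
      rintro _ (⟨e, he, rfl⟩ | ⟨e, he, rfl⟩)
      · exact compatible_halting he
      · exact compatible_halting he)
    (Set.toFinite _)
    (by
      rintro _ (rfl | rfl)
      · exact Relation.ReflTransGen.refl
      · exact Relation.ReflTransGen.refl)
    (by
      rintro X hs hX ⟨q | q, u⟩ hq
      · exact halting_subset (X := {c | (Sum.inl c.1, c.2) ∈ X}) (hs (.inl rfl))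
          (fun e he => hX _ (List.mem_append_left _ (List.mem_map_of_mem he))) hq
      · exact halting_subset (X := {c | (Sum.inr c.1, c.2) ∈ X}) (hs (.inr rfl))
          (fun e he => hX _ (List.mem_append_right _ (List.mem_map_of_mem he))) hq)
  exact ⟨_, E, q₁, q₂, B, hB, ι, A, h.1, h.2.1, h.2.2, h₁, hp₂⟩

theorem FinPres.exists_mulEquiv_grp (G : Type*) [Group G] [Group.IsFinitelyPresented G] :
    ∃ P : FinPres, Nonempty (G ≃* P.Grp) := by
  obtain ⟨n, s, hs, ⟨e⟩⟩ := Group.IsFinitelyPresented.exists_mulEquiv_presentedGroup (G := G)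
  lift s to Finset (FreeGroup (Fin n)) using hs
  let P : FinPres := ⟨n, s.toList.map FreeGroup.toWord⟩
  have hP : P.rels = s := by
    ext x
    constructor
    · rintro ⟨r, hr, rfl⟩
      obtain ⟨y, hy, rfl⟩ := List.mem_map.1 hr
      rw [FreeGroup.mk_toWord]
      exact Finset.mem_toList.1 hy
    · intro hx
      exact ⟨_, List.mem_map_of_mem (Finset.mem_toList.2 hx), FreeGroup.mk_toWord.symm⟩
  refine ⟨P, ⟨?_⟩⟩
  change G ≃* PresentedGroup P.rels
  rw [hP]
  exact e

theorem computable_encode_guestPres {f : ℕ → ℕ} (hf : Primrec f) :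
    Computable fun r => Encodable.encode (guestPres (f r)) := by
  have hrep (x : Fin 4 × Bool) : Primrec fun r => List.replicate (f r) x :=
    (Primrec.list_map (Primrec.list_range.comp hf) (Primrec.const x).to₂).of_eq fun r => by
      rw [List.map_const', List.length_range]
  have hpc : Primrec fun r => powerCommutator (f r) :=
    Primrec.list_cons.comp (Primrec.const _) (Primrec.list_append.comp (hrep _)
      (Primrec.list_cons.comp (Primrec.const _) (hrep _)))
  have hgr : Primrec fun r => guestRelators (f r) :=
    (Primrec.list_append.comp (Primrec.const [[(2, true), (1, true), (2, false), (1, true)],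
      [(3, true), (3, true)], [(3, true), (1, true), (3, false), (1, false)],
      [(3, true), (2, true), (3, false), (2, false)]])
      (Primrec.list_cons.comp hpc (Primrec.const []))).of_eq fun r => rfl
  exact ((Primrec₂.natPair.comp (Primrec.const _) (Primrec.encode.comp hgr)).of_eq
    fun r => rfl).to_comp

open GuestPres in
theorem exists_finPres_guestPres {K : ℕ → Prop} (hK : REPred K) :
    ∃ P : FinPres, ∀ r, (∃ f : (guestPres (Nat.fermatNumber (r + 1))).Grp →* P.Grp,
      Function.Injective f) ↔ ¬ K r := by
  obtain ⟨Q, E, q₁, q₂, B, _, ι, A, h, _, hA, h₁, h₂⟩ := exists_isStage_of_re hK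
  have := HNNExtension.isFinitelyPresented (MulEquiv.refl A) hA
  obtain ⟨P, ⟨e⟩⟩ := FinPres.exists_mulEquiv_grp (HNNExtension B A A (MulEquiv.refl A))
  have hinj {r s : ℕ} (h : (2 : ℤ) ^ 2 ^ (r + 1) = 2 ^ 2 ^ (s + 1)) : r = s := by
    have h' : 2 ^ 2 ^ (r + 1) = 2 ^ 2 ^ (s + 1) := by exact_mod_cast h
    exact Nat.succ_injective (Nat.pow_right_injective le_rfl (Nat.pow_right_injective le_rfl h'))
  refine ⟨P, fun r => ⟨?_, fun hr => ?_⟩⟩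
  · rintro ⟨f, hf⟩ hr
    refine not_exists_injective h (F := Nat.fermatNumber (r + 1)) (Nat.three_le_fermatNumber _)
      (Nat.odd_fermatNumber _) (fun u N => ?_)
      ⟨e.symm.toMonoidHom.comp f, e.symm.injective.comp hf⟩
    rw [fibreExponent]
    split_ifs with hu₂ hu₁
    · exact fun _ => one_dvd N
    · obtain ⟨s, rfl⟩ := (h₁ u).1 hu₁
      have hs : s ≠ r := by
        rintro rfl
        exact hu₂ ((h₂ _).2 ⟨s, hr, rfl⟩)
      have hF : (2 : ℤ) ^ 2 ^ (s + 1) + 1 = (Nat.fermatNumber (s + 1) : ℤ) := by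
        simp [Nat.fermatNumber]
      rw [hF]
      exact IsCoprime.dvd_of_dvd_mul_right (Nat.isCoprime_iff_coprime.2
        (Nat.coprime_fermatNumber_fermatNumber (by simpa using hs)))
    · simp only [zero_dvd_iff, mul_eq_zero, Nat.cast_eq_zero]
      exact fun h => h.resolve_right (by have := Nat.three_le_fermatNumber (r + 1); omega)
  · obtain ⟨f, hf⟩ := exists_injective h (F := Nat.fermatNumber (r + 1))
      (u := 2 ^ 2 ^ (r + 1)) (by
        rw [fibreExponent, if_neg, if_pos ((h₁ _).2 ⟨r, rfl⟩)]
        · simp [Nat.fermatNumber]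
        · rw [h₂]
          rintro ⟨s, hs, hrs⟩
          exact hr (hinj hrs ▸ hs))
    exact ⟨e.toMonoidHom.comp f, e.injective.comp hf⟩

theorem primrec_fermatNumber_succ : Primrec fun r : ℕ => Nat.fermatNumber (r + 1) :=
  Primrec.succ.comp ((Primrec₂.unpaired'.1 Nat.Primrec.pow).comp (Primrec.const 2)
    primrec_two_pow_succ)

/-- Theorem 6.9 (Chiodo): there exists a finitely presented group `G` such that the set
of codes of finite presentations whose presented groups embed into `G` is not
recursively enumerable. -/
theorem exists_group_with_non_re_subgroup_list :
    ∃ P : FinPres,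
      ¬ ∃ g : ℕ →. ℕ, Nat.Partrec g ∧
        ∀ c : ℕ, (g c).Dom ↔
          ∃ Q : FinPres, c = Encodable.encode Q ∧
            ∃ φ : Q.Grp →* P.Grp, Function.Injective φ := by
  let K (r : ℕ) : Prop := ((Denumerable.ofNat Nat.Partrec.Code r).eval 0).Dom
  have hK : REPred K :=
    (Nat.Partrec.Code.eval_part.comp (Computable.ofNat _) (Computable.const 0)).dom_re
  obtain ⟨P, hP⟩ := exists_finPres_guestPres hK
  refine ⟨P, fun ⟨g, hg, hgP⟩ => ComputablePred.halting_problem_not_re 0 ?_⟩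
  have h : REPred fun c : Nat.Partrec.Code => (g (Encodable.encode
      (guestPres (Nat.fermatNumber (Encodable.encode c + 1))))).Dom :=
    ((Partrec.nat_iff.2 hg).comp ((computable_encode_guestPres primrec_fermatNumber_succ).comp
      Computable.encode)).dom_re
  refine h.of_eq fun c => ?_
  rw [hgP]
  have hc : K (Encodable.encode c) ↔ (c.eval 0).Dom := by
    simp only [K, Denumerable.ofNat_encode]
  rw [← hc, ← hP]
  constructor
  · rintro ⟨Q, hQ, hf⟩
    obtain rfl := Encodable.encode_injective hQ
    exact hf
  · exact fun hf => ⟨_, rfl, hf⟩
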